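/- Let Ω ⊂ ℂ² ≅ ℝ⁴ be a bounded, strictly convex open set with smooth boundary and let λ > 0. Suppose u : closure(Ω) → ℝ is continuous, smooth on Ω, of class C^{1,1} on closure(Ω), plurisubharmonic on Ω (i.e. the complex Hessian (∂²u/∂z_i∂z̄_j)_{1≤i,j≤2} is positive semidefinite at every point of Ω), and satisfies det(∂²u/∂z_i∂z̄_j)_{1≤i,j≤2} = λ·(−u)² in Ω, u < 0 in Ω, and u = 0 on ∂Ω. Then the function v = −log(−u/4) is strictly convex in Ω; in fact the real Hessian ∇²v(x) is positive definite at every x ∈ Ω. -/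

import Mathlib

open scoped ComplexOrder

/-- First-order real partial derivative `∂f/∂xᵢ` on `ℝ⁴ ≅ ℂ²`. -/
noncomputable def pd (f : (Fin 4 → ℝ) → ℝ) (i : Fin 4) (x : Fin 4 → ℝ) : ℝ :=
  fderiv ℝ f x (Pi.single i 1)

/-- Second-order real partial derivative `∂²f/∂xᵢ∂xⱼ`. -/
noncomputable def pd2 (f : (Fin 4 → ℝ) → ℝ) (i j : Fin 4) (x : Fin 4 → ℝ) : ℝ :=
  pd (fun y => pd f i y) j x

/-- The real Hessian matrix of `f` at `x`. -/
noncomputable def hessM (f : (Fin 4 → ℝ) → ℝ) (x : Fin 4 → ℝ) :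
    Matrix (Fin 4) (Fin 4) ℝ :=
  Matrix.of fun i j => pd2 f i j x

/-- Index of the real part of `z_i` under `z₁ = x₁ + i x₃`, `z₂ = x₂ + i x₄`. -/
def xi : Fin 2 → Fin 4 := ![0, 1]

/-- Index of the imaginary part of `z_i`. -/
def yi : Fin 2 → Fin 4 := ![2, 3]

/-- The complex Hessian `(∂²u/∂z_i∂z̄_j)_{1≤i,j≤2}` of a real-valued function on
`ℝ⁴ ≅ ℂ²`, via `∂²u/∂z_i∂z̄_j = (1/4)((u_{xᵢxⱼ} + u_{yᵢyⱼ}) + i(u_{xᵢyⱼ} − u_{yᵢxⱼ}))`. -/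
noncomputable def cHess (u : (Fin 4 → ℝ) → ℝ) (x : Fin 4 → ℝ) :
    Matrix (Fin 2) (Fin 2) ℂ := fun i j =>
  (1/4 : ℂ) * (((pd2 u (xi i) (xi j) x + pd2 u (yi i) (yi j) x : ℝ) : ℂ)
    + Complex.I * ((pd2 u (xi i) (yi j) x - pd2 u (yi i) (xi j) x : ℝ) : ℂ))

/-- The squared Euclidean norm on `ℝ⁴`. -/
def normSqE (w : Fin 4 → ℝ) : ℝ := w 0 ^ 2 + w 1 ^ 2 + w 2 ^ 2 + w 3 ^ 2

/-- The Euclidean inner product on `ℝ⁴`. -/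
def dotE (p w : Fin 4 → ℝ) : ℝ := p 0 * w 0 + p 1 * w 1 + p 2 * w 2 + p 3 * w 3

/-- Multiplication by `i` on `ℝ⁴ ≅ ℂ²`. -/
def rotJ (w : Fin 4 → ℝ) : Fin 4 → ℝ := ![-w 2, -w 3, w 0, w 1]

/-- The Hermitian form on `ℂ² ≅ ℝ⁴` whose matrix has diagonal `B 0, B 1` and upper right
entry `B 2 + i B 3`. -/
def hermQ (B w : Fin 4 → ℝ) : ℝ :=
  B 0 * (w 0 ^ 2 + w 2 ^ 2) + B 1 * (w 1 ^ 2 + w 3 ^ 2) + 2 * B 2 * (w 0 * w 1 + w 2 * w 3)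
    + 2 * B 3 * (w 0 * w 3 - w 1 * w 2)

/-- The determinant of the Hermitian matrix encoded by `B`. -/
def hermDet (B : Fin 4 → ℝ) : ℝ := B 0 * B 1 - B 2 ^ 2 - B 3 ^ 2

/-- The adjugate of the Hermitian matrix encoded by `B`. -/
def hermAdj (B : Fin 4 → ℝ) : Fin 4 → ℝ := ![B 1, B 0, -B 2, -B 3]

/-- The polarization of `hermDet`. -/
def hermPair (X Y : Fin 4 → ℝ) : ℝ := X 0 * Y 1 + X 1 * Y 0 - 2 * X 2 * Y 2 - 2 * X 3 * Y 3

/-- The action of the Hermitian matrix encoded by `B` on `ℂ² ≅ ℝ⁴`. -/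
def hermMul (B w : Fin 4 → ℝ) : Fin 4 → ℝ :=
  ![B 0 * w 0 + B 2 * w 1 + B 3 * w 3, B 2 * w 0 - B 3 * w 2 + B 1 * w 1,
    B 0 * w 2 + B 2 * w 3 - B 3 * w 1, B 2 * w 2 + B 3 * w 0 + B 1 * w 3]

/-- The rank one Hermitian form `|∂_w f|²` (up to a factor) attached to a real gradient `p`. -/
def rankOne (p : Fin 4 → ℝ) : Fin 4 → ℝ :=
  ![p 0 ^ 2 + p 2 ^ 2, p 1 ^ 2 + p 3 ^ 2, p 0 * p 1 + p 2 * p 3, p 0 * p 3 - p 2 * p 1]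

/-- The inverse of the Hermitian matrix encoded by `B`. -/
noncomputable def hermInv (B : Fin 4 → ℝ) : Fin 4 → ℝ := (hermDet B)⁻¹ • hermAdj B

lemma hermQ_rankOne (p w : Fin 4 → ℝ) :
    hermQ (rankOne p) w = dotE p w ^ 2 + dotE p (rotJ w) ^ 2 := by
  simp [hermQ, rankOne, dotE, rotJ]; ring

lemma hermQ_add (X Y w : Fin 4 → ℝ) : hermQ (X + Y) w = hermQ X w + hermQ Y w := by
  simp [hermQ]; ring

lemma hermQ_sub (X Y w : Fin 4 → ℝ) : hermQ (X - Y) w = hermQ X w - hermQ Y w := by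
  simp [hermQ]; ring

lemma hermQ_smul (c : ℝ) (X w : Fin 4 → ℝ) : hermQ (c • X) w = c * hermQ X w := by
  simp [hermQ]; ring

lemma hermDet_rankOne (p : Fin 4 → ℝ) : hermDet (rankOne p) = 0 := by
  simp [hermDet, rankOne]; ring

lemma hermDet_add (X Y : Fin 4 → ℝ) :
    hermDet (X + Y) = hermDet X + hermDet Y + hermPair X Y := by
  simp [hermDet, hermPair]; ring

lemma hermDet_smul (c : ℝ) (X : Fin 4 → ℝ) : hermDet (c • X) = c ^ 2 * hermDet X := by
  simp [hermDet]; ring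

lemma two_mul_le_hermPair {X Y : Fin 4 → ℝ} {k : ℝ} (hk : 0 ≤ k) (hX0 : 0 ≤ X 0) (hX1 : 0 ≤ X 1)
    (hX : k ≤ hermDet X) (hY0 : 0 ≤ Y 0) (hY1 : 0 ≤ Y 1) (hY : k ≤ hermDet Y) :
    2 * k ≤ hermPair X Y := by
  unfold hermDet at hX hY
  unfold hermPair
  have h1 : (k + X 2 ^ 2 + X 3 ^ 2) * (k + Y 2 ^ 2 + Y 3 ^ 2) ≤ (X 0 * X 1) * (Y 0 * Y 1) :=
    mul_le_mul (by linarith) (by linarith) (by positivity) (by positivity)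
  have h2 : (2 * (k + X 2 * Y 2 + X 3 * Y 3)) ^ 2 ≤ (X 0 * Y 1 + X 1 * Y 0) ^ 2 := by
    nlinarith [sq_nonneg (X 0 * Y 1 - X 1 * Y 0), sq_nonneg (X 2 * Y 3 - X 3 * Y 2),
      mul_nonneg hk (sq_nonneg (X 2 - Y 2)), mul_nonneg hk (sq_nonneg (X 3 - Y 3))]
  have h3 := le_of_abs_le (abs_le_of_sq_le_sq h2 (by positivity))
  linarith

lemma hermPair_nonneg {X Y : Fin 4 → ℝ} (hX0 : 0 ≤ X 0) (hX1 : 0 ≤ X 1)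
    (hX : 0 ≤ hermDet X) (hY0 : 0 ≤ Y 0) (hY1 : 0 ≤ Y 1) (hY : 0 ≤ hermDet Y) :
    0 ≤ hermPair X Y := by
  simpa using two_mul_le_hermPair le_rfl hX0 hX1 hX hY0 hY1 hY

lemma herm_entries_of_hermQ_nonneg {X : Fin 4 → ℝ} (h : ∀ w, 0 ≤ hermQ X w) :
    0 ≤ X 0 ∧ 0 ≤ X 1 ∧ 0 ≤ hermDet X := by
  have h0 := h ![1, 0, 0, 0]
  have h1 := h ![0, 1, 0, 0]
  simp [hermQ] at h0 h1
  refine ⟨h0, h1, ?_⟩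
  set s := X 2 ^ 2 + X 3 ^ 2 with hs
  have hs0 : 0 ≤ s := by positivity
  have ht : ∀ t : ℝ, 0 ≤ X 0 - 2 * t * s + t ^ 2 * X 1 * s := by
    intro t
    have := h ![1, -t * X 2, 0, -t * X 3]
    simp [hermQ] at this
    rw [hs]; linarith
  have hd : hermDet X = X 0 * X 1 - s := by rw [hs]; unfold hermDet; ring
  rw [hd]
  rcases h1.eq_or_lt with h1 | h1
  · have := ht (X 0 + 1)
    rw [← h1] at this ⊢
    rcases hs0.eq_or_lt with h2 | h2
    · rw [← h2]; simp
    · have h3 := ht ((X 0 + 1) / s)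
      rw [← h1] at h3
      field_simp at h3
      nlinarith
  · have := ht (1 / X 1)
    field_simp at this
    nlinarith

lemma hermDet_le_of_hermQ_le {X Y : Fin 4 → ℝ} (h : ∀ w, hermQ Y w ≤ hermQ X w) (hY0 : 0 ≤ Y 0)
    (hY1 : 0 ≤ Y 1) (hY : 0 ≤ hermDet Y) : hermDet Y ≤ hermDet X := by
  obtain ⟨h0, h1, h2⟩ := herm_entries_of_hermQ_nonneg (X := X - Y)
    (fun w => by rw [hermQ_sub]; linarith [h w])
  have := hermDet_add Y (X - Y)
  rw [add_sub_cancel] at this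
  have := hermPair_nonneg hY0 hY1 hY h0 h1 h2
  linarith

lemma hermDet_hermInv {B : Fin 4 → ℝ} (hB : hermDet B ≠ 0) :
    hermDet (hermInv B) = (hermDet B)⁻¹ := by
  have : hermDet (hermAdj B) = hermDet B := by simp [hermDet, hermAdj]; ring
  rw [hermInv, hermDet_smul, this]
  field_simp

lemma hermMul_hermInv {B : Fin 4 → ℝ} (hB : hermDet B ≠ 0) (w : Fin 4 → ℝ) :
    hermMul B (hermMul (hermInv B) w) = w := by
  have key : hermMul B (hermMul (hermInv B) w) = ((hermDet B)⁻¹ * hermDet B) • w := by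
    ext i
    fin_cases i <;> simp [hermMul, hermInv, hermAdj, hermDet] <;> ring
  rw [key, inv_mul_cancel₀ hB, one_smul]

lemma hermQ_hermMul_hermInv {B : Fin 4 → ℝ} (hB : hermDet B ≠ 0) (w : Fin 4 → ℝ) :
    hermQ B (hermMul (hermInv B) w) = hermQ (hermInv B) w := by
  have key : hermQ B (hermMul (hermInv B) w)
      = ((hermDet B)⁻¹ * hermDet B) * hermQ (hermInv B) w := by
    simp [hermQ, hermMul, hermInv, hermAdj, hermDet]; ring
  rw [key, inv_mul_cancel₀ hB, one_mul]

lemma hermMul_rotJ (B w : Fin 4 → ℝ) : hermMul B (rotJ w) = rotJ (hermMul B w) := by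
  ext i
  fin_cases i <;> simp [hermMul, rotJ] <;> ring

/-- The harmonic mean of two Hermitian matrices. -/
noncomputable def harmMean (X Y : Fin 4 → ℝ) : Fin 4 → ℝ :=
  hermInv ((1 / 2 : ℝ) • (hermInv X + hermInv Y))

lemma hermDet_mean_hermInv_ge {X Y : Fin 4 → ℝ} (hX0 : 0 < X 0) (hX1 : 0 < X 1)
    (hX : 0 < hermDet X) (hY0 : 0 < Y 0) (hY1 : 0 < Y 1) (hY : 0 < hermDet Y) :
    (hermDet X)⁻¹ / 4 ≤ hermDet ((1 / 2 : ℝ) • (hermInv X + hermInv Y)) := by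
  have hp : 0 ≤ hermPair (hermInv X) (hermInv Y) := by
    apply hermPair_nonneg
    · simp [hermInv, hermAdj]; positivity
    · simp [hermInv, hermAdj]; positivity
    · rw [hermDet_hermInv hX.ne']; positivity
    · simp [hermInv, hermAdj]; positivity
    · simp [hermInv, hermAdj]; positivity
    · rw [hermDet_hermInv hY.ne']; positivity
  rw [hermDet_smul, hermDet_add, hermDet_hermInv hX.ne', hermDet_hermInv hY.ne']
  have : 0 < (hermDet Y)⁻¹ := by positivity
  nlinarith

/-- The displacement realizing the harmonic mean as an infimal convolution. -/
noncomputable def harmShift (X Y w : Fin 4 → ℝ) : Fin 4 → ℝ :=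
  (1 / 2 : ℝ) • hermMul (hermInv X - hermInv Y) (hermMul (harmMean X Y) w)

lemma harmShift_rotJ (X Y w : Fin 4 → ℝ) :
    harmShift X Y (rotJ w) = rotJ (harmShift X Y w) := by
  unfold harmShift
  rw [hermMul_rotJ, hermMul_rotJ]
  ext i
  fin_cases i <;> simp [rotJ]

lemma hermQ_harmShift {X Y : Fin 4 → ℝ} (hX : hermDet X ≠ 0) (hY : hermDet Y ≠ 0)
    (hXY : hermDet ((1 / 2 : ℝ) • (hermInv X + hermInv Y)) ≠ 0) (w : Fin 4 → ℝ) :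
    hermQ X (w + harmShift X Y w) + hermQ Y (w - harmShift X Y w) = 2 * hermQ (harmMean X Y) w := by
  set G := (1 / 2 : ℝ) • (hermInv X + hermInv Y) with hG
  set η := hermMul (harmMean X Y) w with hη
  have hw : w = hermMul G η := (hermMul_hermInv hXY w).symm
  have h1 : w + harmShift X Y w = hermMul (hermInv X) η := by
    rw [harmShift, ← hη, hw, hG]
    ext i
    fin_cases i <;> simp [hermMul] <;> ring
  have h2 : w - harmShift X Y w = hermMul (hermInv Y) η := by
    rw [harmShift, ← hη, hw, hG]
    ext i
    fin_cases i <;> simp [hermMul] <;> ring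
  rw [h1, h2, hermQ_hermMul_hermInv hX, hermQ_hermMul_hermInv hY]
  have h3 : hermQ (harmMean X Y) w = hermQ G η := by
    have hG' : hermDet (harmMean X Y) ≠ 0 := by
      rw [harmMean, hermDet_hermInv hXY]; exact inv_ne_zero hXY
    have h4 := hermQ_hermMul_hermInv hXY w
    rw [hη, ← hG] at *
    exact h4.symm
  rw [h3, hG, hermQ_smul, hermQ_add]
  ring

lemma hermDet_sub_rankOne {B p : Fin 4 → ℝ} :
    hermDet (B - rankOne p) = hermDet B - hermPair B (rankOne p) := by
  simp [hermDet, hermPair, rankOne]; ring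

/-- In complex dimension two the operator `B ↦ det (B - p p*)` is inverse-concave along its level
sets, jointly in `p` up to a quadratic error. -/
lemma hermDet_harmMean_sub_rankOne_le {X Y p δ : Fin 4 → ℝ} {Λ : ℝ} (hΛ : 0 < Λ)
    (hX0 : 0 < X 0) (hX1 : 0 < X 1) (hX : 0 < hermDet X) (hY0 : 0 < Y 0) (hY1 : 0 < Y 1)
    (hY : 0 < hermDet Y) (hXΛ : hermDet (X - rankOne (p + δ)) = Λ)
    (hYΛ : hermDet (Y - rankOne (p - δ)) = Λ) :
    hermDet (harmMean X Y - rankOne p) ≤ Λ + hermPair (harmMean X Y) (rankOne δ)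
      + hermDet (harmMean X Y) * hermPair (rankOne p) (rankOne δ) / Λ := by
  have hG0 : 0 < hermDet ((1 / 2 : ℝ) • (hermInv X + hermInv Y)) :=
    lt_of_lt_of_le (by positivity) (hermDet_mean_hermInv_ge hX0 hX1 hX hY0 hY1 hY)
  set H := harmMean X Y with hH
  have hHdet : hermDet H = (hermDet ((1 / 2 : ℝ) • (hermInv X + hermInv Y)))⁻¹ :=
    hermDet_hermInv hG0.ne'
  have hHpos : 0 < hermDet H := by rw [hHdet]; positivity
  have hadj : ∀ {B : Fin 4 → ℝ} (q : Fin 4 → ℝ), 0 < hermDet B → hermDet (B - rankOne q) = Λ →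
      hermDet ((hermDet B)⁻¹ • B + Λ⁻¹ • rankOne q) = Λ⁻¹ := by
    intro B q hB h
    rw [hermDet_sub_rankOne] at h
    have : hermDet ((hermDet B)⁻¹ • B + Λ⁻¹ • rankOne q)
        = (hermDet B)⁻¹ ^ 2 * hermDet B + Λ⁻¹ ^ 2 * hermDet (rankOne q)
          + (hermDet B)⁻¹ * Λ⁻¹ * hermPair B (rankOne q) := by
      rw [hermDet_add, hermDet_smul, hermDet_smul]
      simp [hermPair]; ring
    rw [this, hermDet_rankOne, show hermPair B (rankOne q) = hermDet B - Λ by linarith]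
    field_simp
    ring
  have hVx := hadj (p + δ) hX hXΛ
  have hVy := hadj (p - δ) hY hYΛ
  have hpos : ∀ {B : Fin 4 → ℝ} (q : Fin 4 → ℝ), 0 < hermDet B → 0 < B 0 → 0 < B 1 →
      0 ≤ ((hermDet B)⁻¹ • B + Λ⁻¹ • rankOne q) 0 ∧
      0 ≤ ((hermDet B)⁻¹ • B + Λ⁻¹ • rankOne q) 1 := by
    intro B q hB h0 h1
    constructor <;> simp [rankOne] <;> positivity
  have hpair := two_mul_le_hermPair (k := Λ⁻¹) (by positivity) (hpos (p + δ) hX hX0 hX1).1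
    (hpos (p + δ) hX hX0 hX1).2 hVx.ge (hpos (p - δ) hY hY0 hY1).1 (hpos (p - δ) hY hY0 hY1).2
    hVy.ge
  have hsum := hermDet_add ((hermDet X)⁻¹ • X + Λ⁻¹ • rankOne (p + δ))
    ((hermDet Y)⁻¹ • Y + Λ⁻¹ • rankOne (p - δ))
  rw [hVx, hVy] at hsum
  have hHadj : (hermDet X)⁻¹ • X + (hermDet Y)⁻¹ • Y = (2 * (hermDet H)⁻¹) • H := by
    rw [hHdet, inv_inv, hH, harmMean, hermInv.eq_def ((1 / 2 : ℝ) • _), smul_smul, mul_assoc,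
      mul_inv_cancel₀ hG0.ne']
    ext i
    fin_cases i <;> simp [hermInv, hermAdj] <;> ring
  have hV : (hermDet X)⁻¹ • X + Λ⁻¹ • rankOne (p + δ) + ((hermDet Y)⁻¹ • Y + Λ⁻¹ • rankOne (p - δ))
      = (2 : ℝ) • ((hermDet H)⁻¹ • H + Λ⁻¹ • (rankOne p + rankOne δ)) := by
    have : rankOne (p + δ) + rankOne (p - δ) = (2 : ℝ) • (rankOne p + rankOne δ) := by
      ext i
      fin_cases i <;> simp [rankOne] <;> ring
    calc _ = ((hermDet X)⁻¹ • X + (hermDet Y)⁻¹ • Y)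
          + Λ⁻¹ • (rankOne (p + δ) + rankOne (p - δ)) := by rw [smul_add]; abel
      _ = _ := by rw [hHadj, this]; module
  rw [hV, hermDet_smul] at hsum
  have hfin : hermDet ((hermDet H)⁻¹ • H + Λ⁻¹ • (rankOne p + rankOne δ))
      = (hermDet H)⁻¹ + (hermDet H)⁻¹ * Λ⁻¹ * (hermPair H (rankOne p) + hermPair H (rankOne δ))
        + Λ⁻¹ ^ 2 * hermPair (rankOne p) (rankOne δ) := by
    rw [hermDet_add, hermDet_smul, hermDet_smul, hermDet_add, hermDet_rankOne, hermDet_rankOne]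
    have : hermPair ((hermDet H)⁻¹ • H) (Λ⁻¹ • (rankOne p + rankOne δ))
      = (hermDet H)⁻¹ * Λ⁻¹ * (hermPair H (rankOne p) + hermPair H (rankOne δ)) := by
      simp [hermPair]; ring
    rw [this]
    field_simp
    ring
  have hge : Λ⁻¹ ≤ hermDet ((hermDet H)⁻¹ • H + Λ⁻¹ • (rankOne p + rankOne δ)) := by linarith
  rw [hfin] at hge
  rw [hermDet_sub_rankOne]
  have := mul_le_mul_of_nonneg_left hge (by positivity : 0 ≤ hermDet H * Λ)
  field_simp at this
  have h5 : hermDet H * hermPair (rankOne p) (rankOne δ) / Λ * Λ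
    = hermDet H * hermPair (rankOne p) (rankOne δ) := by field_simp
  nlinarith

/-- The quadratic form of the real Hessian. -/
noncomputable def hessForm (f : (Fin 4 → ℝ) → ℝ) (x w : Fin 4 → ℝ) : ℝ :=
  fderiv ℝ (fderiv ℝ f) x w w

/-- The real gradient, as a vector. -/
noncomputable def gradVec (f : (Fin 4 → ℝ) → ℝ) (x : Fin 4 → ℝ) : Fin 4 → ℝ := fun i => pd f i x

/-- Four times the complex Hessian, encoded by its real entries. -/
noncomputable def levi (f : (Fin 4 → ℝ) → ℝ) (x : Fin 4 → ℝ) : Fin 4 → ℝ :=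
  ![pd2 f 0 0 x + pd2 f 2 2 x, pd2 f 1 1 x + pd2 f 3 3 x, pd2 f 0 1 x + pd2 f 2 3 x,
    pd2 f 0 3 x - pd2 f 2 1 x]

lemma clm_apply_eq_sum {F : Type*} [NormedAddCommGroup F] [NormedSpace ℝ F]
    (L : (Fin 4 → ℝ) →L[ℝ] F) (w : Fin 4 → ℝ) : L w = ∑ i, w i • L (Pi.single i 1) := by
  conv_lhs => rw [pi_eq_sum_univ' w]
  simp [map_sum]

lemma dotE_gradVec (f : (Fin 4 → ℝ) → ℝ) (x w : Fin 4 → ℝ) :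
    dotE (gradVec f x) w = fderiv ℝ f x w := by
  rw [clm_apply_eq_sum, Fin.sum_univ_four]
  simp [dotE, gradVec, pd]
  ring

lemma pd2_eq {f : (Fin 4 → ℝ) → ℝ} {x : Fin 4 → ℝ} (hf : ContDiffAt ℝ 2 f x) (i j : Fin 4) :
    pd2 f i j x = fderiv ℝ (fderiv ℝ f) x (Pi.single j 1) (Pi.single i 1) := by
  have hd : DifferentiableAt ℝ (fderiv ℝ f) x :=
    (hf.fderiv_right (m := 1) (by norm_num)).differentiableAt (by norm_num)
  unfold pd2 pd
  rw [fderiv_clm_apply hd (differentiableAt_const _)]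
  simp

lemma pd2_comm {f : (Fin 4 → ℝ) → ℝ} {x : Fin 4 → ℝ} (hf : ContDiffAt ℝ 2 f x) (i j : Fin 4) :
    pd2 f i j x = pd2 f j i x := by
  rw [pd2_eq hf, pd2_eq hf]
  exact hf.isSymmSndFDerivAt (by simp) _ _

lemma hessForm_eq_sum {f : (Fin 4 → ℝ) → ℝ} {x : Fin 4 → ℝ} (hf : ContDiffAt ℝ 2 f x)
    (w : Fin 4 → ℝ) : hessForm f x w = ∑ j, ∑ i, w j * w i * pd2 f i j x := by
  unfold hessForm
  have h1 : fderiv ℝ (fderiv ℝ f) x w w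
      = ∑ j, w j * fderiv ℝ (fderiv ℝ f) x (Pi.single j 1) w := by
    have := congrArg (fun L : (Fin 4 → ℝ) →L[ℝ] ℝ => L w)
      (clm_apply_eq_sum (fderiv ℝ (fderiv ℝ f) x) w)
    simpa [Fin.sum_univ_four] using this
  rw [h1]
  refine Finset.sum_congr rfl fun j _ => ?_
  rw [clm_apply_eq_sum (fderiv ℝ (fderiv ℝ f) x (Pi.single j 1)), Finset.mul_sum]
  refine Finset.sum_congr rfl fun i _ => ?_
  rw [pd2_eq hf, smul_eq_mul, mul_assoc]

lemma hermQ_levi {f : (Fin 4 → ℝ) → ℝ} {x : Fin 4 → ℝ} (hf : ContDiffAt ℝ 2 f x)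
    (w : Fin 4 → ℝ) : hermQ (levi f x) w = hessForm f x w + hessForm f x (rotJ w) := by
  rw [hessForm_eq_sum hf, hessForm_eq_sum hf]
  simp only [Fin.sum_univ_four]
  have h10 := pd2_comm hf 1 0
  have h20 := pd2_comm hf 2 0
  have h30 := pd2_comm hf 3 0
  have h21 := pd2_comm hf 2 1
  have h31 := pd2_comm hf 3 1
  have h32 := pd2_comm hf 3 2
  simp only [hermQ, levi, rotJ, Matrix.cons_val]
  rw [h10, h20, h30, h31, h32, h21]
  ring

lemma hermQ_ext {X Y : Fin 4 → ℝ} (h : ∀ w, hermQ X w = hermQ Y w) : X = Y := by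
  have h0 := h ![1, 0, 0, 0]
  have h1 := h ![0, 1, 0, 0]
  have h2 := h ![1, 1, 0, 0]
  have h3 := h ![1, 0, 0, 1]
  simp [hermQ] at h0 h1 h2 h3
  ext i
  fin_cases i <;> simp <;> linarith

lemma ContDiffAt.hasDerivAt_line {f : (Fin 4 → ℝ) → ℝ} {x : Fin 4 → ℝ} (hf : ContDiffAt ℝ 2 f x)
    (w : Fin 4 → ℝ) :
    ∀ᶠ t : ℝ in nhds 0, HasDerivAt (fun t => f (x + t • w)) (fderiv ℝ f (x + t • w) w) t := by
  have hev : ∀ᶠ y in nhds x, DifferentiableAt ℝ f y :=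
    (hf.eventually (by simp)).mono fun y hy => hy.differentiableAt (by norm_num)
  have hcont : Filter.Tendsto (fun t : ℝ => x + t • w) (nhds 0) (nhds x) := by
    have : Continuous fun t : ℝ => x + t • w := by fun_prop
    simpa using this.tendsto 0
  filter_upwards [hcont.eventually hev] with t ht
  have hl : HasDerivAt (fun t : ℝ => x + t • w) w t := by
    simpa using ((hasDerivAt_id t).smul_const w).const_add x
  exact ht.hasFDerivAt.comp_hasDerivAt t hl

lemma ContDiffAt.hasDerivAt_fderiv_line {f : (Fin 4 → ℝ) → ℝ} {x : Fin 4 → ℝ}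
    (hf : ContDiffAt ℝ 2 f x) (w : Fin 4 → ℝ) :
    HasDerivAt (fun t : ℝ => fderiv ℝ f (x + t • w) w) (hessForm f x w) 0 := by
  have hd : DifferentiableAt ℝ (fderiv ℝ f) x :=
    (hf.fderiv_right (m := 1) (by norm_num)).differentiableAt (by norm_num)
  have hD : HasFDerivAt (fun y => fderiv ℝ f y w) ((fderiv ℝ (fderiv ℝ f) x).flip w) x := by
    have h := hd.hasFDerivAt.clm_apply (hasFDerivAt_const w x)
    exact h.congr_fderiv (by ext v; simp)
  have hl : HasDerivAt (fun t : ℝ => x + t • w) w 0 := by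
    simpa using ((hasDerivAt_id (0 : ℝ)).smul_const w).const_add x
  exact hD.comp_hasDerivAt_of_eq (0 : ℝ) hl (by simp)

lemma second_derivative_test {g g' : ℝ → ℝ} {c : ℝ} (hmin : IsLocalMin g 0)
    (h1 : ∀ᶠ t in nhds 0, HasDerivAt g (g' t) t) (h2 : HasDerivAt g' c 0) : g' 0 = 0 ∧ 0 ≤ c := by
  have h0 : g' 0 = 0 := hmin.hasDerivAt_eq_zero h1.self_of_nhds
  refine ⟨h0, ?_⟩
  by_contra! hc
  have hlim := (hasDerivAt_iff_tendsto_slope_zero.1 h2).eventually (gt_mem_nhds hc)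
  simp only [zero_add, h0, sub_zero, smul_eq_mul] at hlim
  rw [eventually_nhdsWithin_iff] at hlim
  obtain ⟨r, hr, hball⟩ := Metric.eventually_nhds_iff.1 (hlim.and (h1.and hmin))
  have hin : ∀ t ∈ Set.Icc 0 (r / 2), dist t 0 < r := by
    intro t ht
    rw [Real.dist_eq, sub_zero, abs_of_nonneg ht.1]
    linarith [ht.2]
  obtain ⟨ξ, hξ, hξ'⟩ := exists_hasDerivAt_eq_slope g g' (half_pos hr)
    (fun t ht => (hball (hin t ht)).2.1.continuousAt.continuousWithinAt)
    (fun t ht => (hball (hin t (Set.Ioo_subset_Icc_self ht))).2.1)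
  have h3 := (hball (hin ξ (Set.Ioo_subset_Icc_self hξ))).1 (ne_of_gt hξ.1)
  have h4 := (hball (hin (r / 2) ⟨by positivity, le_rfl⟩)).2.2
  have h5 : 0 ≤ g' ξ := by rw [hξ']; apply div_nonneg <;> linarith
  have h6 : 0 ≤ ξ⁻¹ * g' ξ := mul_nonneg (inv_nonneg.2 hξ.1.le) h5
  linarith

lemma contDiffAt_negLog {f : (Fin 4 → ℝ) → ℝ} {x : Fin 4 → ℝ} {n : WithTop ℕ∞}
    (hf : ContDiffAt ℝ n f x) (hx : f x < 0) :
    ContDiffAt ℝ n (fun y => -Real.log (-(f y) / 4)) x :=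
  ((hf.neg.div_const 4).log (by linarith)).neg

lemma fderiv_negLog {f : (Fin 4 → ℝ) → ℝ} {x : Fin 4 → ℝ} (hf : DifferentiableAt ℝ f x)
    (hx : f x < 0) :
    fderiv ℝ (fun y => -Real.log (-(f y) / 4)) x = (-f x)⁻¹ • fderiv ℝ f x := by
  have h1 : HasFDerivAt (fun y => -(f y) / 4) ((-(4⁻¹ : ℝ)) • fderiv ℝ f x) x := by
    have := (hf.hasFDerivAt.const_mul (-(4⁻¹ : ℝ)))
    refine this.congr_of_eventuallyEq (Filter.Eventually.of_forall fun y => ?_)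
    simp only; ring
  have h2 : HasFDerivAt (fun y => -Real.log (-(f y) / 4))
      (-((-f x / 4)⁻¹ • (-(4⁻¹ : ℝ)) • fderiv ℝ f x)) x := (h1.log (by linarith)).neg
  rw [h2.fderiv]
  ext w
  simp
  field_simp

lemma hessForm_negLog {f : (Fin 4 → ℝ) → ℝ} {x : Fin 4 → ℝ} (hf : ContDiffAt ℝ 2 f x)
    (hx : f x < 0) (w : Fin 4 → ℝ) :
    hessForm (fun y => -Real.log (-(f y) / 4)) x w
      = (-f x)⁻¹ * hessForm f x w + ((-f x)⁻¹ * fderiv ℝ f x w) ^ 2 := by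
  have hev : fderiv ℝ (fun y => -Real.log (-(f y) / 4)) =ᶠ[nhds x]
      fun y => (-f y)⁻¹ • fderiv ℝ f y := by
    filter_upwards [hf.eventually (by simp), hf.continuousAt.eventually (gt_mem_nhds hx)]
      with y hy hy'
    exact fderiv_negLog (hy.differentiableAt (by norm_num)) hy'
  have hd : DifferentiableAt ℝ (fderiv ℝ f) x :=
    (hf.fderiv_right (m := 1) (by norm_num)).differentiableAt (by norm_num)
  have hd1 : HasFDerivAt f (fderiv ℝ f x) x := (hf.differentiableAt (by norm_num)).hasFDerivAt
  have hinv : HasFDerivAt (fun y => (-f y)⁻¹) (((-f x) ^ 2)⁻¹ • fderiv ℝ f x) x := by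
    have h1 : HasFDerivAt (fun y => -f y) (-fderiv ℝ f x) x := hd1.neg
    have h2 := (hasDerivAt_inv (x := -f x) (by linarith)).comp_hasFDerivAt x h1
    exact h2.congr_fderiv (by ext v; simp)
  have hmul : HasFDerivAt (fun y => (-f y)⁻¹ • fderiv ℝ f y) _ x := hinv.smul hd.hasFDerivAt
  unfold hessForm
  rw [hev.fderiv_eq, hmul.fderiv]
  simp
  ring

lemma levi_negLog {f : (Fin 4 → ℝ) → ℝ} {x : Fin 4 → ℝ} (hf : ContDiffAt ℝ 2 f x)
    (hx : f x < 0) :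
    levi (fun y => -Real.log (-(f y) / 4)) x
      - rankOne (gradVec (fun y => -Real.log (-(f y) / 4)) x) = (-f x)⁻¹ • levi f x := by
  apply hermQ_ext
  intro w
  rw [hermQ_sub, hermQ_smul, hermQ_levi hf, hermQ_levi (contDiffAt_negLog hf hx), hermQ_rankOne,
    hessForm_negLog hf hx, hessForm_negLog hf hx, dotE_gradVec, dotE_gradVec,
    fderiv_negLog (hf.differentiableAt (by norm_num)) hx]
  simp only [smul_apply, smul_eq_mul]
  ring

lemma hessM_posDef_of_hessForm {f : (Fin 4 → ℝ) → ℝ} {x : Fin 4 → ℝ} (hf : ContDiffAt ℝ 2 f x)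
    (h : ∀ w, w ≠ 0 → 0 < hessForm f x w) : (hessM f x).PosDef := by
  refine Matrix.PosDef.of_dotProduct_mulVec_pos ?_ fun w hw => ?_
  · ext i j
    rw [Matrix.conjTranspose_apply]
    simpa [hessM] using pd2_comm hf j i
  · have := h w hw
    rw [hessForm_eq_sum hf] at this
    have e : star w ⬝ᵥ (hessM f x).mulVec w = ∑ j, ∑ i, w j * w i * pd2 f i j x := by
      simp only [dotProduct, Matrix.mulVec, hessM, Matrix.of_apply, Finset.mul_sum]
      refine Finset.sum_congr rfl fun j _ => Finset.sum_congr rfl fun i _ => ?_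
      rw [pd2_comm hf i j]
      simp
      ring
    rw [e]
    exact this

lemma levi_of_cHess {u : (Fin 4 → ℝ) → ℝ} {x : Fin 4 → ℝ} {r : ℝ} (hu : ContDiffAt ℝ 2 u x)
    (hp : (cHess u x).PosSemidef) (hdet : (cHess u x).det = ((r : ℝ) : ℂ)) :
    0 ≤ levi u x 0 ∧ 0 ≤ levi u x 1 ∧ hermDet (levi u x) = 16 * r := by
  have h00 := hp.diag_nonneg (i := 0)
  have h11 := hp.diag_nonneg (i := 1)
  rw [Complex.nonneg_iff] at h00 h11
  have h00 := h00.1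
  have h11 := h11.1
  have hre := congrArg Complex.re hdet
  rw [Matrix.det_fin_two] at hre
  have c1 := pd2_comm hu 1 0
  have c2 := pd2_comm hu 3 2
  have c3 := pd2_comm hu 3 0
  have c4 := pd2_comm hu 2 1
  have c5 := pd2_comm hu 2 0
  have c6 := pd2_comm hu 3 1
  simp [cHess, xi, yi] at h00 h11 hre
  simp only [hermDet, levi, Matrix.cons_val]
  rw [c1, c2, c3, ← c4, c5, c6] at hre
  refine ⟨by linarith, by linarith, by rw [← hre, c4]; ring⟩

lemma norm_sq_le_normSqE (w : Fin 4 → ℝ) : ‖w‖ ^ 2 ≤ normSqE w := by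
  have h : ‖w‖ ≤ √(normSqE w) := by
    refine (pi_norm_le_iff_of_nonneg (Real.sqrt_nonneg _)).2 fun i => ?_
    rw [Real.norm_eq_abs]
    refine Real.abs_le_sqrt ?_
    unfold normSqE
    fin_cases i <;> simp <;> nlinarith [sq_nonneg (w 0), sq_nonneg (w 1), sq_nonneg (w 2),
      sq_nonneg (w 3)]
  have h0 : 0 ≤ normSqE w := by unfold normSqE; positivity
  calc ‖w‖ ^ 2 ≤ √(normSqE w) ^ 2 := by gcongr
    _ = normSqE w := Real.sq_sqrt h0

lemma normSqE_nonneg (w : Fin 4 → ℝ) : 0 ≤ normSqE w := by unfold normSqE; positivity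

lemma normSqE_pos {w : Fin 4 → ℝ} (hw : w ≠ 0) : 0 < normSqE w :=
  (pow_pos (norm_pos_iff.2 hw) 2).trans_le (norm_sq_le_normSqE w)

lemma normSqE_smul (c : ℝ) (w : Fin 4 → ℝ) : normSqE (c • w) = c ^ 2 * normSqE w := by
  simp [normSqE]; ring

lemma continuous_normSqE : Continuous normSqE := by unfold normSqE; fun_prop

/-- The interior sphere condition for a domain with smooth defining function. -/
lemma exists_interior_ball {f : (Fin 4 → ℝ) → ℝ} {x : Fin 4 → ℝ} (hf : ContDiff ℝ 2 f)
    (hx : f x = 0) (hdf : fderiv ℝ f x ≠ 0) :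
    ∃ w : Fin 4 → ℝ, w ≠ 0 ∧ ∀ y, normSqE (y - (x + w)) < normSqE w → f y < 0 := by
  obtain ⟨K, s, hs, hK⟩ := (hf.contDiffAt.fderiv_right (m := 1) (x₀ := x)
    (by norm_num)).exists_lipschitzOnWith
  obtain ⟨η, hη, hηs⟩ := Metric.mem_nhds_iff.1 hs
  set ν := gradVec f x with hν
  have hν0 : ν ≠ 0 := by
    intro h0
    apply hdf
    ext w
    rw [← dotE_gradVec, ← hν, h0]
    simp [dotE]
  have hN := normSqE_pos hν0
  set N := √(normSqE ν) with hNdef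
  have hNpos : 0 < N := Real.sqrt_pos.2 hN
  have hNsq : N ^ 2 = normSqE ν := Real.sq_sqrt hN.le
  set r : ℝ := min (η / (4 * N)) (1 / (2 * (K + 1))) with hr
  have hK0 : (0 : ℝ) ≤ K := K.2
  have hrpos : 0 < r := by rw [hr]; positivity
  have hr1 : r * (4 * N) ≤ η := (le_div_iff₀ (by positivity)).1 (min_le_left _ _)
  have hr2 : r * (2 * (K + 1)) ≤ 1 := (le_div_iff₀ (by positivity)).1 (min_le_right _ _)
  refine ⟨-r • ν, by simp [hrpos.ne', hν0], fun y hy => ?_⟩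
  set h := y - x with hh
  have hy1 : normSqE h < -2 * r * dotE ν h := by
    have : normSqE (y - (x + -r • ν)) = normSqE h + 2 * r * dotE ν h + normSqE (-r • ν) := by
      simp [normSqE, hh, dotE]; ring
    linarith
  have hnorm : ‖h‖ < η := by
    have hcs : dotE ν h ^ 2 ≤ normSqE ν * normSqE h := by
      simp only [dotE, normSqE]
      nlinarith [sq_nonneg (ν 0 * h 1 - ν 1 * h 0), sq_nonneg (ν 0 * h 2 - ν 2 * h 0),
        sq_nonneg (ν 0 * h 3 - ν 3 * h 0), sq_nonneg (ν 1 * h 2 - ν 2 * h 1),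
        sq_nonneg (ν 1 * h 3 - ν 3 * h 1), sq_nonneg (ν 2 * h 3 - ν 3 * h 2)]
    have h0 := normSqE_nonneg h
    have h2 : normSqE h ^ 2 ≤ 4 * r ^ 2 * N ^ 2 * normSqE h := by
      rw [hNsq]
      have : normSqE h ^ 2 ≤ (-2 * r * dotE ν h) ^ 2 := by gcongr
      have h4 : 4 * r ^ 2 * dotE ν h ^ 2 ≤ 4 * r ^ 2 * (normSqE ν * normSqE h) := by gcongr
      linarith
    have h3 : normSqE h ≤ (2 * r * N) ^ 2 := by
      rcases h0.eq_or_lt with h0 | h0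
      · rw [← h0]; positivity
      · rw [sq] at h2
        have := le_of_mul_le_mul_right h2 h0
        linarith
    have h4 : ‖h‖ ≤ 2 * r * N :=
      (abs_le_of_sq_le_sq' ((norm_sq_le_normSqE h).trans h3) (by positivity)).2
    nlinarith [mul_pos hrpos hNpos]
  have htaylor : ‖f y - f x - fderiv ℝ f x (y - x)‖ ≤ K * ‖h‖ * ‖y - x‖ := by
    refine (convex_closedBall x ‖h‖).norm_image_sub_le_of_norm_fderiv_le' (𝕜 := ℝ)
      (fun z _ => (hf.differentiable (by norm_num)) z) (fun z hz => ?_) (by simp)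
      (by simp [hh, dist_eq_norm])
    rw [Metric.mem_closedBall] at hz
    have := hK.dist_le_mul z (hηs (by simpa using hz.trans_lt hnorm)) x (hηs (by simpa using hη))
    rw [dist_eq_norm] at this
    exact this.trans (by gcongr)
  rw [hx, sub_zero, Real.norm_eq_abs, ← dotE_gradVec] at htaylor
  have h5 := (abs_le.1 htaylor).2
  have h6 := norm_sq_le_normSqE h
  have h7 : K * ‖h‖ * ‖y - x‖ ≤ K * normSqE h := by
    rw [← hh, mul_assoc, ← sq]; gcongr
  have h8 : normSqE h * (2 * (K + 1) * r) < (2 * (K + 1) * r) * (-2 * r * dotE ν h) := by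
    rw [mul_comm]; exact mul_lt_mul_of_pos_left hy1 (by positivity)
  have h9 : f y ≤ dotE ν h + K * normSqE h := by rw [hν, hh]; linarith
  have h10 : dotE ν h < 0 := by
    have := normSqE_nonneg h
    by_contra! h10
    nlinarith [mul_nonneg hrpos.le h10]
  have h11 : normSqE h * (2 * (K + 1)) ≤ -2 * dotE ν h := by
    have : normSqE h * (2 * (K + 1)) < 2 * (K + 1) * (-2 * r * dotE ν h) := by
      rw [mul_comm]; exact mul_lt_mul_of_pos_left hy1 (by positivity)
    nlinarith [mul_le_mul_of_nonneg_right hr2 (neg_nonneg.2 h10.le)]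
  nlinarith [normSqE_nonneg h]

lemma normSqE_add_smul_single (a : Fin 4 → ℝ) (t : ℝ) (i : Fin 4) :
    normSqE (a + t • Pi.single i 1) = normSqE a + 2 * t * a i + t ^ 2 := by
  fin_cases i <;> simp [normSqE] <;> ring

/-- Hopf's boundary point lemma in quantitative form. -/
lemma exists_linear_lower_bound {Ω : Set (Fin 4 → ℝ)} (hopen : IsOpen Ω)
    {u : (Fin 4 → ℝ) → ℝ} (hcont : ContinuousOn u (closure Ω)) (hu : ∀ x ∈ Ω, ContDiffAt ℝ 2 u x)
    (hsub : ∀ x ∈ Ω, 0 ≤ ∑ i, hessForm u x (Pi.single i 1)) (hneg : ∀ x ∈ Ω, u x < 0)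
    (hbdry : ∀ x ∈ frontier Ω, u x = 0) {x w : Fin 4 → ℝ} (hw : w ≠ 0)
    (hball : ∀ y, normSqE (y - (x + w)) < normSqE w → y ∈ Ω) :
    ∃ c > 0, ∀ t ∈ Set.Icc (0 : ℝ) (1 / 2), c * t ≤ -u (x + t • w) := by
  set z := x + w with hz
  set N := normSqE w with hN
  have hNpos : 0 < N := normSqE_pos hw
  set q : (Fin 4 → ℝ) → ℝ := fun y => normSqE (y - z) with hq
  have hqc : Continuous q := continuous_normSqE.comp (by fun_prop)
  have hclos : ∀ y, q y ≤ N → y ∈ closure Ω := by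
    intro y hy
    have hlim : Filter.Tendsto (fun t : ℝ => z + t • (y - z)) (nhdsWithin 1 (Set.Iio 1))
        (nhds y) := by
      have : Continuous fun t : ℝ => z + t • (y - z) := by fun_prop
      have h := this.tendsto 1
      simp only [one_smul, add_sub_cancel] at h
      exact h.mono_left nhdsWithin_le_nhds
    refine mem_closure_of_tendsto hlim ?_
    filter_upwards [Ioo_mem_nhdsLT (show (0 : ℝ) < 1 by norm_num)] with t ht
    refine hball _ ?_
    rw [add_sub_cancel_left, normSqE_smul]
    have h1 : t ^ 2 < 1 := by nlinarith [ht.1, ht.2]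
    have h2 := normSqE_nonneg (y - z)
    have h3 : normSqE (y - z) ≤ N := hy
    nlinarith
  have hbdd : ∀ r, Bornology.IsBounded {y | q y ≤ r} := by
    intro r
    refine (Metric.isBounded_closedBall (x := z) (r := r + 1)).subset fun y hy => ?_
    rw [Metric.mem_closedBall, dist_eq_norm]
    have h1 := norm_sq_le_normSqE (y - z)
    have h2 : normSqE (y - z) ≤ r := hy
    nlinarith [norm_nonneg (y - z)]
  set α : ℝ := 12 / N with hα
  have hαN : α * N = 12 := by rw [hα]; field_simp
  have hαpos : 0 < α := by positivity
  have hle0 : ∀ y ∈ closure Ω, u y ≤ 0 := by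
    intro y hy
    by_cases hyΩ : y ∈ Ω
    · exact (hneg y hyΩ).le
    · exact (hbdry y (by rw [hopen.frontier_eq]; exact ⟨hy, hyΩ⟩)).le
  obtain ⟨ε, hε, hεS⟩ : ∃ ε > 0, ∀ y, q y = N / 4 → ε ≤ -u y := by
    have hSc : IsCompact {y | q y = N / 4} := Metric.isCompact_of_isClosed_isBounded
      (isClosed_eq hqc continuous_const) ((hbdd (N / 4)).subset fun y hy => le_of_eq hy)
    have hSne : {y | q y = N / 4}.Nonempty := by
      refine ⟨z + (1 / 2 : ℝ) • w, ?_⟩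
      simp only [Set.mem_ofPred_eq, hq, add_sub_cancel_left, normSqE_smul]
      ring
    have hSΩ : {y | q y = N / 4} ⊆ Ω := fun y hy => hball y (by
      have : normSqE (y - z) = N / 4 := hy
      linarith)
    obtain ⟨y, hy, hymin⟩ := hSc.exists_isMinOn hSne
      (hcont.neg.mono (hSΩ.trans subset_closure))
    exact ⟨-u y, by linarith [hneg y (hSΩ hy)], fun y' hy' => hymin hy'⟩
  have hbarrier : ∀ y, N / 4 ≤ q y → q y ≤ N →
      ε * (Real.exp (-α * q y) - Real.exp (-α * N)) ≤ -u y := by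
    set F : (Fin 4 → ℝ) → ℝ := fun y => -u y - ε * (Real.exp (-α * q y) - Real.exp (-α * N))
      with hF
    set A := {y | N / 4 ≤ q y ∧ q y ≤ N} with hA
    have hAc : IsCompact A := Metric.isCompact_of_isClosed_isBounded
      ((isClosed_le continuous_const hqc).inter (isClosed_le hqc continuous_const))
      ((hbdd N).subset fun y hy => hy.2)
    by_contra! hcon
    obtain ⟨y₁, hy1, hy1', hy1''⟩ := hcon
    have hFc : ContinuousOn F A := by
      refine (hcont.neg.mono fun y hy => hclos y hy.2).sub (Continuous.continuousOn ?_)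
      fun_prop
    obtain ⟨y, hyA, hymin⟩ := hAc.exists_isMinOn ⟨y₁, hy1, hy1'⟩ hFc
    have hFy : F y < 0 := lt_of_le_of_lt (hymin (show y₁ ∈ A from ⟨hy1, hy1'⟩))
      (by simp only [hF]; linarith)
    have hq2 : q y ≠ N := by
      intro h
      simp only [hF, h, sub_self, mul_zero, sub_zero] at hFy
      linarith [hle0 y (hclos y hyA.2)]
    have hq1 : q y ≠ N / 4 := by
      intro h
      have h1 := hεS y h
      have h2 : Real.exp (-α * q y) ≤ 1 := Real.exp_le_one_iff.2 (by
        have : 0 ≤ q y := normSqE_nonneg _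
        nlinarith)
      have h3 := Real.exp_pos (-α * N)
      simp only [hF] at hFy
      nlinarith
    have hyA' : N / 4 < q y ∧ q y < N := ⟨lt_of_le_of_ne hyA.1 (Ne.symm hq1),
      lt_of_le_of_ne hyA.2 hq2⟩
    have hyΩ : y ∈ Ω := hball y hyA'.2
    have hloc : IsLocalMin F y := by
      refine hymin.isLocalMin ?_
      filter_upwards [hqc.continuousAt.eventually (lt_mem_nhds hyA'.1),
        hqc.continuousAt.eventually (gt_mem_nhds hyA'.2)] with y' h1 h2
      exact ⟨h1.le, h2.le⟩
    set E := Real.exp (-α * q y) with hE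
    have hdir : ∀ i, hessForm u y (Pi.single i 1)
        + ε * (E * (4 * α ^ 2 * (y - z) i ^ 2 - 2 * α)) ≤ 0 := by
      intro i
      set e : Fin 4 → ℝ := Pi.single i 1 with he
      set b := (y - z) i with hb
      have hline : ∀ t : ℝ, q (y + t • e) = q y + 2 * t * b + t ^ 2 := fun t => by
        have : y + t • e - z = (y - z) + t • e := by abel
        simp only [hq]
        rw [this, he, normSqE_add_smul_single]
      have hpoly : ∀ t : ℝ, HasDerivAt (fun t : ℝ => -α * (q y + 2 * t * b + t ^ 2))
          (-α * (2 * b + 2 * t)) t := fun t => by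
        have h1 : HasDerivAt (fun t : ℝ => q y + 2 * t * b + t ^ 2) (2 * b + 2 * t) t := by
          have := ((((hasDerivAt_id t).const_mul 2).mul_const b).const_add (q y)).add
            ((hasDerivAt_id t).pow 2)
          exact this.congr_deriv (by simp)
        exact h1.const_mul (-α)
      have htest := second_derivative_test
        (g := fun t : ℝ => -u (y + t • e)
          - ε * (Real.exp (-α * (q y + 2 * t * b + t ^ 2)) - Real.exp (-α * N)))
        (g' := fun t : ℝ => -fderiv ℝ u (y + t • e) e
          - ε * (Real.exp (-α * (q y + 2 * t * b + t ^ 2)) * (-α * (2 * b + 2 * t))))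
        (c := -hessForm u y e - ε * (E * (4 * α ^ 2 * b ^ 2 - 2 * α))) ?_ ?_ ?_
      · linarith [htest.2]
      · have hc : Filter.Tendsto (fun t : ℝ => y + t • e) (nhds 0) (nhds y) := by
          have : Continuous fun t : ℝ => y + t • e := by fun_prop
          simpa using this.tendsto 0
        filter_upwards [hc.eventually hloc] with t ht
        simp only [hF, hline] at ht
        simpa using ht
      · filter_upwards [(hu y hyΩ).hasDerivAt_line e] with t ht
        exact ht.neg.sub (((hpoly t).exp.sub_const _).const_mul ε)
      · have hlin : HasDerivAt (fun t : ℝ => -α * (2 * b + 2 * t)) (-α * 2) 0 := by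
          have := (((hasDerivAt_id (0 : ℝ)).const_mul 2).const_add (2 * b)).const_mul (-α)
          exact this.congr_deriv (by simp)
        have := ((hu y hyΩ).hasDerivAt_fderiv_line e).neg.sub
          ((((hpoly 0).exp).mul hlin).const_mul ε)
        refine this.congr_deriv ?_
        simp only [hE]
        ring_nf
    have hsum := Finset.sum_le_sum fun i (_ : i ∈ Finset.univ) => hdir i
    have hs := hsub y hyΩ
    have hqy : q y = (y - z) 0 ^ 2 + (y - z) 1 ^ 2 + (y - z) 2 ^ 2 + (y - z) 3 ^ 2 := rfl
    simp only [Fin.sum_univ_four, Finset.sum_const_zero] at hsum hs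
    have hEpos : 0 < E := Real.exp_pos _
    have h1 : ε * E * (4 * α * (α * q y - 2)) ≤ 0 := by
      rw [hqy]; linarith
    have h2 : 3 < α * q y := by nlinarith [hyA'.1]
    have h3 : 0 < ε * E * (4 * α * (α * q y - 2)) := by
      have : 0 < α * q y - 2 := by linarith
      positivity
    linarith
  refine ⟨ε * Real.exp (-12) * 12, by positivity, fun t ht => ?_⟩
  have hqt : q (x + t • w) = (1 - t) ^ 2 * N := by
    have : x + t • w - z = (t - 1) • w := by rw [hz, sub_smul, one_smul]; abel
    simp only [hq, this, normSqE_smul]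
    ring
  have h1 : (1 - t) ^ 2 ≤ 1 := by nlinarith [ht.1, ht.2]
  have h2 : 1 / 4 ≤ (1 - t) ^ 2 := by nlinarith [ht.1, ht.2]
  have h := hbarrier (x + t • w) (by rw [hqt]; nlinarith) (by rw [hqt]; nlinarith)
  refine le_trans ?_ h
  have e1 : -α * q (x + t • w) = -12 + 12 * (1 - (1 - t) ^ 2) := by
    rw [hqt]; linear_combination (-(1 - t) ^ 2) * hαN
  have e2 : -α * N = -12 := by linarith
  rw [e1, e2, Real.exp_add]
  have h3 := Real.add_one_le_exp (12 * (1 - (1 - t) ^ 2))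
  have h4 : 12 * t ≤ Real.exp (12 * (1 - (1 - t) ^ 2)) - 1 := by nlinarith [ht.1, ht.2]
  have h5 : 0 < ε * Real.exp (-12) := by positivity
  nlinarith

/-- On a segment leaving the closure of a convex open set through its interior, the mean value
theorem applies. -/
lemma exists_slope_of_mem_closure {Ω : Set (Fin 4 → ℝ)} (hopen : IsOpen Ω) (hconv : Convex ℝ Ω)
    {u : (Fin 4 → ℝ) → ℝ} (hcont : ContinuousOn u (closure Ω))
    (hu : ∀ x ∈ Ω, DifferentiableAt ℝ u x) {p w : Fin 4 → ℝ} {s : ℝ} (hs : 0 < s)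
    (hp : p ∈ closure Ω) (hps : p + s • w ∈ Ω) :
    ∃ t ∈ Set.Ioo 0 s, p + t • w ∈ Ω ∧ u (p + s • w) - u p = s * fderiv ℝ u (p + t • w) w := by
  have hmem : ∀ t ∈ Set.Ioo 0 s, p + t • w ∈ Ω := by
    intro t ht
    have h := hconv.openSegment_interior_closure_subset_interior
      (by rwa [hopen.interior_eq] : p + s • w ∈ interior Ω) hp
    rw [hopen.interior_eq] at h
    refine h ⟨t / s, 1 - t / s, by have := ht.1; positivity, ?_, by ring, ?_⟩
    · have := (div_lt_one hs).2 ht.2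
      linarith
    · rw [smul_add, smul_smul, div_mul_cancel₀ _ hs.ne', sub_smul, one_smul]
      abel
  have hmem' : ∀ t ∈ Set.Icc 0 s, p + t • w ∈ closure Ω := by
    intro t ht
    rcases ht.1.eq_or_lt with h0 | h0
    · simpa [← h0] using hp
    rcases ht.2.eq_or_lt with h1 | h1
    · rw [h1]; exact subset_closure hps
    exact subset_closure (hmem t ⟨h0, h1⟩)
  obtain ⟨t, ht, hteq⟩ := exists_hasDerivAt_eq_slope (fun t : ℝ => u (p + t • w))
    (fun t => fderiv ℝ u (p + t • w) w) hs
    (hcont.comp (Continuous.continuousOn (by fun_prop)) hmem')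
    (fun t ht => by
      have hl : HasDerivAt (fun t : ℝ => p + t • w) w t := by
        simpa using ((hasDerivAt_id t).smul_const w).const_add p
      exact (hu _ (hmem t ht)).hasFDerivAt.comp_hasDerivAt t hl)
  refine ⟨t, ht, hmem t ht, ?_⟩
  rw [hteq]
  simp only [zero_smul, add_zero, sub_zero]
  field_simp

lemma exists_mem_frontier_of_notMem {Ω : Set (Fin 4 → ℝ)} {x w : Fin 4 → ℝ} {s : ℝ} (hs : 0 ≤ s)
    (hopen : IsOpen Ω) (hx : x ∈ Ω) (hxs : x - s • w ∉ Ω) :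
    ∃ t ∈ Set.Ioc 0 s, x - t • w ∈ frontier Ω := by
  set S := {t : ℝ | t ∈ Set.Icc 0 s ∧ x - t • w ∉ Ω} with hS
  have hc : Continuous fun t : ℝ => x - t • w := by fun_prop
  have hSc : IsCompact S :=
    isCompact_Icc.inter_right (hopen.isClosed_compl.preimage hc)
  obtain ⟨t, ⟨ht, htΩ⟩, hmin⟩ := hSc.exists_isMinOn ⟨s, ⟨hs, le_rfl⟩, hxs⟩ continuousOn_id
  have ht0 : 0 < t := by
    refine lt_of_le_of_ne ht.1 fun h => htΩ ?_
    simpa [← h] using hx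
  refine ⟨t, ⟨ht0, ht.2⟩, ?_⟩
  rw [hopen.frontier_eq]
  refine ⟨?_, htΩ⟩
  refine mem_closure_of_tendsto (hc.continuousAt.mono_left nhdsWithin_le_nhds :
    Filter.Tendsto _ (nhdsWithin t (Set.Iio t)) _) ?_
  filter_upwards [Ioo_mem_nhdsLT ht0] with t' ht'
  by_contra hcon
  have : t ≤ t' := hmin (show t' ∈ S from ⟨⟨ht'.1.le, ht'.2.le.trans ht.2⟩, hcon⟩)
  linarith [ht'.2]

/-- Near a boundary point where the inner derivative is almost constant and positive, the product
of the values at two points is controlled by the squared value at the midpoint. -/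
lemma eventually_mul_le_sq_midpoint {Ω : Set (Fin 4 → ℝ)} (hopen : IsOpen Ω) (hconv : Convex ℝ Ω)
    {u : (Fin 4 → ℝ) → ℝ} (hcont : ContinuousOn u (closure Ω))
    (hu : ∀ x ∈ Ω, DifferentiableAt ℝ u x) (hneg : ∀ x ∈ Ω, u x < 0)
    (hbdry : ∀ x ∈ frontier Ω, u x = 0) {x₀ w : Fin 4 → ℝ} (hx₀ : x₀ ∈ frontier Ω)
    (hw : x₀ + w ∈ Ω) {a b r : ℝ} (ha : 0 < a) (hr : 0 < r)
    (hder : ∀ z ∈ Ω, dist z x₀ < r → -fderiv ℝ u z w ∈ Set.Icc a b) :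
    ∃ r' > 0, ∀ x ∈ Ω, ∀ y ∈ Ω, dist x x₀ < r' → dist y x₀ < r' →
      a ^ 2 * (u x * u y) ≤ b ^ 2 * u ((1 / 2 : ℝ) • (x + y)) ^ 2 := by
  obtain ⟨s, hs, hsw⟩ : ∃ s > 0, s * ‖w‖ < r / 2 := by
    refine ⟨r / 2 / (‖w‖ + 1), by positivity, ?_⟩
    rw [div_mul_eq_mul_div, div_lt_iff₀ (by positivity)]
    nlinarith [norm_nonneg w]
  have hout : x₀ - s • w ∉ closure Ω := by
    intro hcl
    have h := hconv.openSegment_interior_closure_subset_interior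
      (by rwa [hopen.interior_eq] : x₀ + w ∈ interior Ω) hcl
    rw [hopen.interior_eq] at h
    rw [hopen.frontier_eq] at hx₀
    refine hx₀.2 (h ⟨s / (1 + s), 1 / (1 + s), by positivity, by positivity, by field_simp; ring, ?_⟩)
    ext i
    simp
    field_simp
    ring
  obtain ⟨r₁, hr₁, hr₁out⟩ : ∃ r₁ > 0, ∀ x, dist x x₀ < r₁ → x - s • w ∉ closure Ω := by
    have hc : ContinuousAt (fun x : Fin 4 → ℝ => x - s • w) x₀ := by fun_prop
    exact Metric.eventually_nhds_iff.1
      (hc.eventually (isClosed_closure.isOpen_compl.mem_nhds hout))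
  refine ⟨min r₁ (r / 2), by positivity, fun x hx y hy hxr hyr => ?_⟩
  have hnear : ∀ x, dist x x₀ < r / 2 → ∀ t ∈ Set.Icc 0 s, dist (x - t • w) x₀ < r := by
    intro x hx t ht
    have h1 : dist (x - t • w) x = t * ‖w‖ := by
      rw [dist_eq_norm, sub_sub_cancel_left, norm_neg, norm_smul, Real.norm_of_nonneg ht.1]
    have h2 : t * ‖w‖ ≤ s * ‖w‖ := by gcongr; exact ht.2
    linarith [dist_triangle (x - t • w) x x₀]
  have hslope : ∀ x ∈ Ω, dist x x₀ < r / 2 → ∀ t ∈ Set.Ioc 0 s, x - t • w ∈ closure Ω →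
      -u x + u (x - t • w) ∈ Set.Icc (a * t) (b * t) := by
    intro x hx hxr t ht hcl
    obtain ⟨t', ht', hmem, heq⟩ := exists_slope_of_mem_closure hopen hconv hcont hu ht.1 hcl
      (w := w) (by simpa using hx)
    rw [sub_add_cancel] at heq
    have e : x - t • w + t' • w = x - (t - t') • w := by rw [sub_smul]; abel
    rw [e] at hmem heq
    have h := hder _ hmem (hnear x hxr _ ⟨by linarith [ht'.2], by linarith [ht'.1, ht.2]⟩)
    constructor <;> nlinarith [h.1, h.2, ht.1]
  have hm : (1 / 2 : ℝ) • (x + y) ∈ Ω := by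
    have := hconv hx hy (by norm_num : (0 : ℝ) ≤ 1 / 2) (by norm_num : (0 : ℝ) ≤ 1 / 2)
      (by norm_num)
    rwa [← smul_add] at this
  have hmr : dist ((1 / 2 : ℝ) • (x + y)) x₀ < r / 2 := by
    have := (convex_ball x₀ (r / 2)) (Metric.mem_ball.2 (hxr.trans_le (min_le_right _ _)))
      (Metric.mem_ball.2 (hyr.trans_le (min_le_right _ _)))
      (by norm_num : (0 : ℝ) ≤ 1 / 2) (by norm_num : (0 : ℝ) ≤ 1 / 2) (by norm_num)
    rwa [← smul_add] at this
  obtain ⟨t₁, ht₁, hf₁⟩ := exists_mem_frontier_of_notMem hs.le hopen hx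
    (fun h => hr₁out x (hxr.trans_le (min_le_left _ _)) (subset_closure h))
  obtain ⟨t₂, ht₂, hf₂⟩ := exists_mem_frontier_of_notMem hs.le hopen hy
    (fun h => hr₁out y (hyr.trans_le (min_le_left _ _)) (subset_closure h))
  have hc₁ := frontier_subset_closure hf₁
  have hc₂ := frontier_subset_closure hf₂
  have h₁ := hslope x hx (hxr.trans_le (min_le_right _ _)) t₁ ht₁ hc₁
  have h₂ := hslope y hy (hyr.trans_le (min_le_right _ _)) t₂ ht₂ hc₂
  rw [hbdry _ hf₁, add_zero] at h₁
  rw [hbdry _ hf₂, add_zero] at h₂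
  have hcm : (1 / 2 : ℝ) • (x + y) - ((t₁ + t₂) / 2) • w ∈ closure Ω := by
    have := hconv.closure hc₁ hc₂ (by norm_num : (0 : ℝ) ≤ 1 / 2) (by norm_num : (0 : ℝ) ≤ 1 / 2)
      (by norm_num)
    convert this using 1
    ext i
    simp
    ring
  have h₃ := hslope _ hm hmr ((t₁ + t₂) / 2) ⟨by linarith [ht₁.1, ht₂.1],
    by linarith [ht₁.2, ht₂.2]⟩ hcm
  have hle : u ((1 / 2 : ℝ) • (x + y) - ((t₁ + t₂) / 2) • w) ≤ 0 := by
    by_cases hin : (1 / 2 : ℝ) • (x + y) - ((t₁ + t₂) / 2) • w ∈ Ω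
    · exact (hneg _ hin).le
    · exact (hbdry _ (by rw [hopen.frontier_eq]; exact ⟨hcm, hin⟩)).le
  set m := (1 / 2 : ℝ) • (x + y)
  have h4 : a * ((t₁ + t₂) / 2) ≤ -u m := by linarith [h₃.1]
  have hb : 0 < b := by
    have : a * t₁ ≤ b * t₁ := h₁.1.trans h₁.2
    exact ha.trans_le (le_of_mul_le_mul_right this ht₁.1)
  have h5 : u x * u y ≤ b ^ 2 * (t₁ * t₂) := by
    have := mul_le_mul h₁.2 h₂.2 (by linarith [hneg y hy]) (by have := ht₁.1; positivity)
    nlinarith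
  have h6 : t₁ * t₂ ≤ ((t₁ + t₂) / 2) ^ 2 := by nlinarith [sq_nonneg (t₁ - t₂)]
  have h7 : (a * ((t₁ + t₂) / 2)) ^ 2 ≤ u m ^ 2 := by
    rw [← neg_sq (u m)]
    have := ht₁.1
    have := ht₂.1
    gcongr
  calc a ^ 2 * (u x * u y) ≤ a ^ 2 * (b ^ 2 * (t₁ * t₂)) := by gcongr
    _ ≤ a ^ 2 * (b ^ 2 * ((t₁ + t₂) / 2) ^ 2) := by gcongr
    _ = b ^ 2 * (a * ((t₁ + t₂) / 2)) ^ 2 := by ring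
    _ ≤ b ^ 2 * u m ^ 2 := by gcongr

/-- A negative subharmonic function vanishing on the boundary with continuous gradient up to the
boundary is almost midpoint log-concave near the boundary. -/
lemma exists_mul_lt_sq_midpoint {Ω : Set (Fin 4 → ℝ)} (hopen : IsOpen Ω) (hconv : Convex ℝ Ω)
    {ρ : (Fin 4 → ℝ) → ℝ} (hρ : ContDiff ℝ 2 ρ) (hΩρ : Ω = {x | ρ x < 0})
    (hρgrad : ∀ x ∈ frontier Ω, fderiv ℝ ρ x ≠ 0)
    {u : (Fin 4 → ℝ) → ℝ} (hcont : ContinuousOn u (closure Ω)) (hu : ∀ x ∈ Ω, ContDiffAt ℝ 2 u x)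
    (hgrad : ContinuousOn (fun x => fderivWithin ℝ u (closure Ω) x) (closure Ω))
    (hsub : ∀ x ∈ Ω, 0 ≤ ∑ i, hessForm u x (Pi.single i 1)) (hneg : ∀ x ∈ Ω, u x < 0)
    (hbdry : ∀ x ∈ frontier Ω, u x = 0) {x₀ : Fin 4 → ℝ} (hx₀ : x₀ ∈ frontier Ω) {R : ℝ}
    (hR : 1 < R) :
    ∃ r > 0, ∀ x ∈ Ω, ∀ y ∈ Ω, dist x x₀ < r → dist y x₀ < r →
      u x * u y < R * u ((1 / 2 : ℝ) • (x + y)) ^ 2 := by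
  have hρ0 : ρ x₀ = 0 := by
    rw [hΩρ] at hx₀
    exact frontier_lt_subset_eq hρ.continuous continuous_const hx₀
  obtain ⟨w, hw0, hball⟩ := exists_interior_ball hρ hρ0 (hρgrad x₀ hx₀)
  replace hball : ∀ y, normSqE (y - (x₀ + w)) < normSqE w → y ∈ Ω := fun y hy => by
    rw [hΩρ]; exact hball y hy
  obtain ⟨c, hc, hlow⟩ := exists_linear_lower_bound hopen hcont hu hsub hneg hbdry hw0 hball
  have hud : ∀ x ∈ Ω, DifferentiableAt ℝ u x := fun x hx => (hu x hx).differentiableAt (by norm_num)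
  have hx₀c := frontier_subset_closure hx₀
  have hw : x₀ + w ∈ Ω := hball _ (by
    rw [sub_self]; simpa [normSqE] using normSqE_pos hw0)
  set ℓ := -fderivWithin ℝ u (closure Ω) x₀ w with hℓ
  have hclose : ∀ η > 0, ∃ r > 0, ∀ z ∈ Ω, dist z x₀ < r → |-fderiv ℝ u z w - ℓ| < η := by
    intro η hη
    have h1 : ContinuousWithinAt (fun z => -fderivWithin ℝ u (closure Ω) z w) (closure Ω) x₀ :=
      ((hgrad x₀ hx₀c).clm_apply continuousWithinAt_const).neg
    obtain ⟨r, hr, h⟩ := Metric.continuousWithinAt_iff.1 h1 η hη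
    refine ⟨r, hr, fun z hz hzr => ?_⟩
    have := h (subset_closure hz) hzr
    rwa [Real.dist_eq, fderivWithin_of_mem_nhds
      (Filter.mem_of_superset (hopen.mem_nhds hz) subset_closure)] at this
  have hℓpos : c / 2 ≤ ℓ := by
    obtain ⟨r, hr, h⟩ := hclose (c / 2) (by positivity)
    set s := min (1 / 2) (r / (‖w‖ + 1)) with hs
    have hspos : 0 < s := by positivity
    have hsw : s * ‖w‖ < r := by
      have h1 : s * (‖w‖ + 1) ≤ r := (le_div_iff₀ (by positivity)).1 (min_le_right _ _)
      linarith
    have hsΩ : x₀ + s • w ∈ Ω := by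
      refine hball _ ?_
      have : x₀ + s • w - (x₀ + w) = (s - 1) • w := by rw [sub_smul, one_smul]; abel
      rw [this, normSqE_smul]
      have h1 : s ≤ 1 / 2 := min_le_left _ _
      have h2 : (s - 1) ^ 2 < 1 := by nlinarith
      have := normSqE_pos hw0
      nlinarith
    obtain ⟨t, ht, htΩ, hteq⟩ := exists_slope_of_mem_closure hopen hconv hcont hud hspos hx₀c hsΩ
    have h1 := hlow s ⟨hspos.le, min_le_left _ _⟩
    rw [hbdry x₀ hx₀, sub_zero] at hteq
    rw [hteq] at h1
    have h2 : c ≤ -fderiv ℝ u (x₀ + t • w) w := by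
      have : s * c ≤ s * -fderiv ℝ u (x₀ + t • w) w := by linarith
      exact le_of_mul_le_mul_left this hspos
    have h3 := h _ htΩ (by
      rw [dist_eq_norm, add_sub_cancel_left, norm_smul, Real.norm_of_nonneg ht.1.le]
      nlinarith [ht.2, norm_nonneg w])
    have := (abs_lt.1 h3).2
    linarith
  have hℓ0 : 0 < ℓ := by linarith
  obtain ⟨η, hη, hηℓ, hηR⟩ : ∃ η > 0, η < ℓ ∧ (ℓ + η) ^ 2 < R * (ℓ - η) ^ 2 := by
    have hcts : Continuous fun η : ℝ => R * (ℓ - η) ^ 2 - (ℓ + η) ^ 2 := by fun_prop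
    have h0 : 0 < R * (ℓ - 0) ^ 2 - (ℓ + 0) ^ 2 := by
      have := pow_pos hℓ0 2
      simp only [sub_zero, add_zero]
      nlinarith
    have hev := (hcts.continuousAt.eventually (lt_mem_nhds h0)).and (gt_mem_nhds hℓ0)
    obtain ⟨η, hη, h⟩ := ((hev.filter_mono nhdsWithin_le_nhds).and
      (self_mem_nhdsWithin : Set.Ioi (0 : ℝ) ∈ nhdsWithin 0 (Set.Ioi 0))).exists.imp
      fun η h => And.intro h.2 h.1
    exact ⟨η, hη, h.2, by linarith [h.1]⟩
  obtain ⟨r, hr, h⟩ := hclose η hη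
  obtain ⟨r', hr', hmain⟩ := eventually_mul_le_sq_midpoint hopen hconv hcont hud hneg hbdry hx₀ hw
    (a := ℓ - η) (b := ℓ + η) (by linarith) hr (fun z hz hzr => by
      have := abs_lt.1 (h z hz hzr)
      exact ⟨by linarith [this.1], by linarith [this.2]⟩)
  refine ⟨r', hr', fun x hx y hy hxr hyr => ?_⟩
  have h1 := hmain x hx y hy hxr hyr
  have hm : (1 / 2 : ℝ) • (x + y) ∈ Ω := by
    have := hconv hx hy (by norm_num : (0 : ℝ) ≤ 1 / 2) (by norm_num : (0 : ℝ) ≤ 1 / 2)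
      (by norm_num)
    rwa [← smul_add] at this
  have h2 : 0 < u ((1 / 2 : ℝ) • (x + y)) ^ 2 := sq_pos_of_neg (hneg _ hm)
  have h3 : (ℓ - η) ^ 2 * (u x * u y) < (ℓ - η) ^ 2 * (R * u ((1 / 2 : ℝ) • (x + y)) ^ 2) := by
    nlinarith
  exact lt_of_mul_lt_mul_left h3 (sq_nonneg _)

/-- The identity Hermitian matrix. -/
def hermOne : Fin 4 → ℝ := ![1, 1, 0, 0]

lemma hermQ_hermOne (w : Fin 4 → ℝ) : hermQ hermOne w = normSqE w := by
  simp [hermQ, hermOne, normSqE]; ring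

lemma normSqE_rotJ (w : Fin 4 → ℝ) : normSqE (rotJ w) = normSqE w := by
  simp [normSqE, rotJ]; ring

lemma rotJ_add (a b : Fin 4 → ℝ) : rotJ (a + b) = rotJ a + rotJ b := by
  ext i; fin_cases i <;> simp [rotJ] <;> ring

lemma rotJ_sub (a b : Fin 4 → ℝ) : rotJ (a - b) = rotJ a - rotJ b := by
  ext i; fin_cases i <;> simp [rotJ] <;> ring

lemma dotE_sq_le (a b : Fin 4 → ℝ) : dotE a b ^ 2 ≤ normSqE a * normSqE b := by
  simp only [dotE, normSqE]
  nlinarith [sq_nonneg (a 0 * b 1 - a 1 * b 0), sq_nonneg (a 0 * b 2 - a 2 * b 0),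
    sq_nonneg (a 0 * b 3 - a 3 * b 0), sq_nonneg (a 1 * b 2 - a 2 * b 1),
    sq_nonneg (a 1 * b 3 - a 3 * b 1), sq_nonneg (a 2 * b 3 - a 3 * b 2)]

lemma hermQ_nonneg {X : Fin 4 → ℝ} (h0 : 0 ≤ X 0) (h1 : 0 ≤ X 1) (hd : 0 ≤ hermDet X)
    (w : Fin 4 → ℝ) : 0 ≤ hermQ X w := by
  set z := ![w 1, -w 0, -w 3, w 2] with hz
  have h := hermPair_nonneg h0 h1 hd (Y := rankOne z) (by simp [rankOne]; positivity)
    (by simp [rankOne]; positivity) (by rw [hermDet_rankOne])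
  have e : hermQ X w = hermPair X (rankOne z) := by
    simp [hermQ, hermPair, rankOne, hz]; ring
  rw [e]
  exact h

lemma le_hermQ {X : Fin 4 → ℝ} {T D : ℝ} (h0 : 0 < X 0) (h1 : 0 < X 1) (hD : 0 < D)
    (hd : D ≤ hermDet X) (hT : X 0 + X 1 ≤ T) (w : Fin 4 → ℝ) :
    D / T * normSqE w ≤ hermQ X w := by
  have hTpos : 0 < T := by linarith
  set μ := D / T with hμ
  have hμT : μ * T = D := by rw [hμ]; field_simp
  have hμ0 : 0 < μ := by positivity
  have hdet : hermDet X ≤ X 0 * X 1 := by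
    unfold hermDet; nlinarith [sq_nonneg (X 2), sq_nonneg (X 3)]
  have h := hermQ_nonneg (X := X - μ • hermOne) ?_ ?_ ?_ w
  · rw [hermQ_sub, hermQ_smul, hermQ_hermOne] at h
    linarith
  · simp [hermOne]
    by_contra! hc
    nlinarith [mul_pos hμ0 h1, mul_pos hμ0 h0]
  · simp [hermOne]
    by_contra! hc
    nlinarith [mul_pos hμ0 h1, mul_pos hμ0 h0]
  · have : hermDet (X - μ • hermOne) = hermDet X - μ * (X 0 + X 1) + μ ^ 2 := by
      simp [hermDet, hermOne]; ring
    rw [this]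
    nlinarith [mul_le_mul_of_nonneg_left hT hμ0.le]

lemma hermQ_rankOne_le (p w : Fin 4 → ℝ) : hermQ (rankOne p) w ≤ normSqE p * normSqE w := by
  have h := hermQ_nonneg (X := normSqE p • hermOne - rankOne p) ?_ ?_ ?_ w
  · rw [hermQ_sub, hermQ_smul, hermQ_hermOne] at h
    linarith
  · simp [hermOne, rankOne, normSqE]
    nlinarith [sq_nonneg (p 1), sq_nonneg (p 3)]
  · simp [hermOne, rankOne, normSqE]
    nlinarith [sq_nonneg (p 0), sq_nonneg (p 2)]
  · apply le_of_eq
    simp [hermDet, hermOne, rankOne, normSqE]; ring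

lemma hermQ_perp (X w : Fin 4 → ℝ) :
    hermQ X ![w 1, -w 0, -w 3, w 2] = hermPair X (rankOne w) := by
  simp [hermQ, hermPair, rankOne]; ring

lemma hermDet_add_smul_rankOne (X Θ : Fin 4 → ℝ) (c : ℝ) :
    hermDet (X + c • rankOne Θ) = hermDet X + c * hermPair X (rankOne Θ) := by
  simp [hermDet, hermPair, rankOne]; ring

lemma hermDet_sub_smul_hermOne (X : Fin 4 → ℝ) (s : ℝ) :
    hermDet (X - s • hermOne) = hermDet X - s * (X 0 + X 1) + s ^ 2 := by
  simp [hermDet, hermOne]; ring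

lemma hermQ_rankOne_sub_smul (p Θ w : Fin 4 → ℝ) (c : ℝ) :
    hermQ (rankOne (p - c • Θ)) w = hermQ (rankOne p) w + c ^ 2 * hermQ (rankOne Θ) w
      - 2 * c * (dotE p w * dotE Θ w + dotE p (rotJ w) * dotE Θ (rotJ w)) := by
  simp only [hermQ_rankOne, dotE, Pi.sub_apply, Pi.smul_apply, smul_eq_mul]
  ring

lemma hermQ_rankOne_nonneg (p w : Fin 4 → ℝ) : 0 ≤ hermQ (rankOne p) w := by
  rw [hermQ_rankOne]; positivity

lemma hermQ_rankOne_sub_smul_le {p Θ : Fin 4 → ℝ} {P c : ℝ} (hp : normSqE p ≤ P)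
    (hΘ : normSqE Θ ≤ P) (hc : 0 ≤ c) (w : Fin 4 → ℝ) :
    hermQ (rankOne (p - c • Θ)) w ≤ hermQ (rankOne p) w + c ^ 2 * hermQ (rankOne Θ) w
      + c * (2 * P) * normSqE w := by
  rw [hermQ_rankOne_sub_smul]
  have h1 : -(2 * (dotE p w * dotE Θ w + dotE p (rotJ w) * dotE Θ (rotJ w)))
      ≤ hermQ (rankOne p) w + hermQ (rankOne Θ) w := by
    rw [hermQ_rankOne, hermQ_rankOne]
    linarith [sq_nonneg (dotE p w + dotE Θ w), sq_nonneg (dotE p (rotJ w) + dotE Θ (rotJ w))]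
  have h2 : hermQ (rankOne p) w + hermQ (rankOne Θ) w ≤ 2 * P * normSqE w := by
    have h3 := hermQ_rankOne_le p w
    have h4 := hermQ_rankOne_le Θ w
    have h5 := mul_le_mul_of_nonneg_right hp (normSqE_nonneg w)
    have h6 := mul_le_mul_of_nonneg_right hΘ (normSqE_nonneg w)
    linarith
  linarith [mul_le_mul_of_nonneg_left (h1.trans h2) hc]

/-- The gain produced by a strongly convex barrier with gradient `Θ` in the operator
`det (B - p p*)`. -/
lemma hermDet_barrier_lt {X M p Θ : Fin 4 → ℝ} {Λ μ τ T P C C' A κ : ℝ} (hΛ : hermDet M = Λ)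
    (hM : ∀ w, μ * normSqE w ≤ hermQ M w) (hMT : M 0 + M 1 ≤ T) (hμ : 0 < μ)
    (hp : normSqE p ≤ P) (hΘ : normSqE Θ ≤ P) (hτ : τ ≤ normSqE Θ) (hC : 0 ≤ C)
    (hX : ∀ w, hermQ (M + rankOne p) w + κ * (A ^ 2 * hermQ (rankOne Θ) w
      - C * (A + 1) * normSqE w) ≤ hermQ X w)
    (hA0 : 0 ≤ A) (hA : C' + (C + 2 * P) * (A + 1) * T < A ^ 2 * μ * τ / 4)
    (hκ0 : 0 < κ) (hκ1 : κ ≤ 1 / 2) (hκ : κ * ((C + 2 * P) * (A + 1)) ≤ μ / 2) :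
    (∀ w, 0 ≤ hermQ (X - rankOne (p - (κ * A) • Θ)) w) ∧
      Λ + C' * κ < hermDet (X - rankOne (p - (κ * A) • Θ)) := by
  have hP : 0 ≤ P := (normSqE_nonneg p).trans hp
  set s := κ * ((C + 2 * P) * (A + 1)) with hs
  have hs0 : 0 ≤ s := by positivity
  set N := M - s • hermOne with hN
  have hNQ : ∀ w, μ / 2 * normSqE w ≤ hermQ N w := fun w => by
    rw [hN, hermQ_sub, hermQ_smul, hermQ_hermOne]
    nlinarith [hM w, normSqE_nonneg w]
  set Z := N + (κ * (A ^ 2 / 2)) • rankOne Θ with hZ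
  have hZX : ∀ w, hermQ Z w ≤ hermQ (X - rankOne (p - (κ * A) • Θ)) w := by
    intro w
    have h3 := hermQ_rankOne_sub_smul_le hp hΘ (mul_nonneg hκ0.le hA0) w
    have h4 : (κ * A) ^ 2 * hermQ (rankOne Θ) w ≤ κ * (A ^ 2 / 2) * hermQ (rankOne Θ) w := by
      refine mul_le_mul_of_nonneg_right ?_ (hermQ_rankOne_nonneg _ _)
      have := mul_le_mul_of_nonneg_left hκ1 (mul_nonneg hκ0.le (sq_nonneg A))
      linarith
    have h5 : κ * A * (2 * P) * normSqE w ≤ κ * (2 * P * (A + 1)) * normSqE w := by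
      refine mul_le_mul_of_nonneg_right ?_ (normSqE_nonneg _)
      linarith [mul_nonneg hκ0.le hP]
    have h6 := hX w
    rw [hermQ_add] at h6
    rw [hermQ_sub, hZ, hN, hermQ_add, hermQ_sub, hermQ_smul, hermQ_smul, hermQ_hermOne, hs]
    linarith
  have hpairN : μ / 2 * normSqE Θ ≤ hermPair N (rankOne Θ) := by
    have h := hNQ ![Θ 1, -Θ 0, -Θ 3, Θ 2]
    have e1 : normSqE ![Θ 1, -Θ 0, -Θ 3, Θ 2] = normSqE Θ := by simp [normSqE]; ring
    rwa [e1, hermQ_perp] at h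
  have hdetZ : hermDet Z = hermDet N + κ * (A ^ 2 / 2) * hermPair N (rankOne Θ) :=
    hermDet_add_smul_rankOne _ _ _
  have hdetN : Λ - s * T ≤ hermDet N := by
    have : hermDet N = Λ - s * (M 0 + M 1) + s ^ 2 := by
      rw [← hΛ]; exact hermDet_sub_smul_hermOne _ _
    rw [this]
    nlinarith [mul_le_mul_of_nonneg_left hMT hs0]
  have hZ0 : ∀ w, 0 ≤ hermQ Z w := fun w => by
    rw [hZ, hermQ_add, hermQ_smul, hermQ_rankOne]
    have h1 := hNQ w
    have h2 : 0 ≤ μ / 2 * normSqE w := mul_nonneg (by linarith) (normSqE_nonneg w)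
    have h3 : 0 ≤ κ * (A ^ 2 / 2) * (dotE Θ w ^ 2 + dotE Θ (rotJ w) ^ 2) := by positivity
    linarith
  have hent := herm_entries_of_hermQ_nonneg hZ0
  refine ⟨fun w => (hZ0 w).trans (hZX w), ?_⟩
  refine lt_of_lt_of_le ?_ (hermDet_le_of_hermQ_le hZX hent.1 hent.2.1 hent.2.2)
  rw [hdetZ]
  have h1 : μ / 2 * τ ≤ hermPair N (rankOne Θ) :=
    (mul_le_mul_of_nonneg_left hτ (by positivity)).trans hpairN
  have h2 : κ * (A ^ 2 / 2) * (μ / 2 * τ) ≤ κ * (A ^ 2 / 2) * hermPair N (rankOne Θ) :=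
    mul_le_mul_of_nonneg_left h1 (by positivity)
  have h3 := mul_lt_mul_of_pos_left hA hκ0
  have h4 : s * T = κ * ((C + 2 * P) * (A + 1) * T) := by rw [hs]; ring
  nlinarith

lemma three_point_derivative_test {f₁ f₂ f₃ : (Fin 4 → ℝ) → ℝ} {x y m a b c : Fin 4 → ℝ}
    {ψ ψ' : ℝ → ℝ} {ψ₂ : ℝ} (h₁ : ContDiffAt ℝ 2 f₁ x) (h₂ : ContDiffAt ℝ 2 f₂ y)
    (h₃ : ContDiffAt ℝ 2 f₃ m) (hψ : ∀ᶠ t in nhds 0, HasDerivAt ψ (ψ' t) t)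
    (hψ' : HasDerivAt ψ' ψ₂ 0)
    (hmin : IsLocalMin
      (fun t : ℝ => f₁ (x + t • a) + f₂ (y + t • b) - 2 * f₃ (m + t • c) + ψ t) 0) :
    fderiv ℝ f₁ x a + fderiv ℝ f₂ y b - 2 * fderiv ℝ f₃ m c + ψ' 0 = 0 ∧
      0 ≤ hessForm f₁ x a + hessForm f₂ y b - 2 * hessForm f₃ m c + ψ₂ := by
  have key := second_derivative_test hmin
    (g' := fun t => fderiv ℝ f₁ (x + t • a) a + fderiv ℝ f₂ (y + t • b) b
      - 2 * fderiv ℝ f₃ (m + t • c) c + ψ' t)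
    (c := hessForm f₁ x a + hessForm f₂ y b - 2 * hessForm f₃ m c + ψ₂) ?_ ?_
  · simpa using key
  · filter_upwards [h₁.hasDerivAt_line a, h₂.hasDerivAt_line b, h₃.hasDerivAt_line c, hψ]
      with t ht₁ ht₂ ht₃ ht
    exact ((ht₁.add ht₂).sub (ht₃.const_mul 2)).add ht
  · exact (((h₁.hasDerivAt_fderiv_line a).add (h₂.hasDerivAt_fderiv_line b)).sub
      ((h₃.hasDerivAt_fderiv_line c).const_mul 2)).add hψ'

/-- `v` is three times differentiable at `x` and the matrix `v_{ij̄} - v_i v_{j̄}` is positive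
definite there, with determinant `Λ` (up to a normalization). -/
structure IsLogSolAt (v : (Fin 4 → ℝ) → ℝ) (Λ : ℝ) (x : Fin 4 → ℝ) : Prop where
  contDiffAt : ContDiffAt ℝ 3 v x
  pos_zero : 0 < (levi v x - rankOne (gradVec v x)) 0
  pos_one : 0 < (levi v x - rankOne (gradVec v x)) 1
  det_eq : hermDet (levi v x - rankOne (gradVec v x)) = Λ

namespace IsLogSolAt

variable {v : (Fin 4 → ℝ) → ℝ} {Λ : ℝ} {x : Fin 4 → ℝ}

lemma contDiffAt_two (h : IsLogSolAt v Λ x) : ContDiffAt ℝ 2 v x :=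
  h.contDiffAt.of_le (by norm_num)

lemma levi_zero_pos (h : IsLogSolAt v Λ x) : 0 < levi v x 0 := by
  have h0 := h.pos_zero
  have : 0 ≤ rankOne (gradVec v x) 0 := by simp [rankOne]; positivity
  rw [Pi.sub_apply] at h0
  linarith

lemma levi_one_pos (h : IsLogSolAt v Λ x) : 0 < levi v x 1 := by
  have h0 := h.pos_one
  have : 0 ≤ rankOne (gradVec v x) 1 := by simp [rankOne]; positivity
  rw [Pi.sub_apply] at h0
  linarith

lemma le_hermDet_levi (h : IsLogSolAt v Λ x) (hΛ : 0 < Λ) : Λ ≤ hermDet (levi v x) := by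
  have h0 := h.det_eq.symm.le
  refine h0.trans (hermDet_le_of_hermQ_le (fun w => ?_) h.pos_zero.le h.pos_one.le
    (h.det_eq ▸ hΛ.le))
  rw [hermQ_sub]
  linarith [hermQ_rankOne_nonneg (gradVec v x) w]

end IsLogSolAt

lemma gradVec_ext {f g : (Fin 4 → ℝ) → ℝ} {x y : Fin 4 → ℝ}
    (h : ∀ w, fderiv ℝ f x w = fderiv ℝ g y w) : gradVec f x = gradVec g y := by
  ext i
  exact h _

/-- The concavity maximum principle: the midpoint deficit of a solution relative to a strict
subsolution has no interior local minimum. -/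
lemma not_isLocalMin_midpoint {v V : (Fin 4 → ℝ) → ℝ} {Λ : ℝ} {x y : Fin 4 → ℝ} (hΛ : 0 < Λ)
    (hx : IsLogSolAt v Λ x) (hy : IsLogSolAt v Λ y)
    (hV : ContDiffAt ℝ 2 V ((1 / 2 : ℝ) • (x + y)))
    (hpos : ∀ w, 0 ≤ hermQ (levi V ((1 / 2 : ℝ) • (x + y))
      - rankOne (gradVec V ((1 / 2 : ℝ) • (x + y)))) w)
    (hdet : Λ < hermDet (levi V ((1 / 2 : ℝ) • (x + y))
      - rankOne (gradVec V ((1 / 2 : ℝ) • (x + y))))) :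
    ¬ IsLocalMin (fun z : (Fin 4 → ℝ) × (Fin 4 → ℝ) =>
      v z.1 + v z.2 - 2 * V ((1 / 2 : ℝ) • (z.1 + z.2))) (x, y) := by
  intro hmin
  set m := (1 / 2 : ℝ) • (x + y) with hm
  have test : ∀ a b : Fin 4 → ℝ,
      fderiv ℝ v x a + fderiv ℝ v y b - 2 * fderiv ℝ V m ((1 / 2 : ℝ) • (a + b)) = 0 ∧
      0 ≤ hessForm v x a + hessForm v y b - 2 * hessForm V m ((1 / 2 : ℝ) • (a + b)) := by
    intro a b
    have hmin' : IsLocalMin (fun t : ℝ => v (x + t • a) + v (y + t • b)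
        - 2 * V (m + t • ((1 / 2 : ℝ) • (a + b))) + 0) 0 := by
      have hc : Filter.Tendsto (fun t : ℝ => (x + t • a, y + t • b)) (nhds 0) (nhds (x, y)) := by
        have : Continuous fun t : ℝ => (x + t • a, y + t • b) := by fun_prop
        simpa using this.tendsto 0
      filter_upwards [hc.eventually hmin] with t ht
      have e : (1 / 2 : ℝ) • (x + t • a + (y + t • b)) = m + t • ((1 / 2 : ℝ) • (a + b)) := by
        rw [hm]; module
      simp only [e, add_zero, zero_smul] at ht ⊢
      exact ht
    have := three_point_derivative_test hx.contDiffAt_two hy.contDiffAt_two hV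
      (ψ := fun _ => 0) (ψ' := fun _ => 0) (ψ₂ := 0) (.of_forall fun t => hasDerivAt_const t 0)
      (hasDerivAt_const 0 0) hmin'
    simpa using this
  have gx : gradVec v x = gradVec V m := gradVec_ext fun w => by
    have := (test w 0).1
    simp at this
    linarith
  have gy : gradVec v y = gradVec V m := gradVec_ext fun w => by
    have := (test 0 w).1
    simp at this
    linarith
  have hX := hΛ.trans_le (hx.le_hermDet_levi hΛ)
  have hY := hΛ.trans_le (hy.le_hermDet_levi hΛ)
  have hXY := lt_of_lt_of_le (by positivity)
    (hermDet_mean_hermInv_ge hx.levi_zero_pos hx.levi_one_pos hX hy.levi_zero_pos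
      hy.levi_one_pos hY)
  set p := gradVec V m with hp
  have hQ : ∀ w, hermQ (levi V m - rankOne p) w
      ≤ hermQ (harmMean (levi v x) (levi v y) - rankOne p) w := by
    intro w
    have h := hermQ_harmShift hX.ne' hY.ne' hXY.ne' w
    set ζ := harmShift (levi v x) (levi v y) w with hζ
    have h1 := (test (w + ζ) (w - ζ)).2
    have h2 := (test (rotJ (w + ζ)) (rotJ (w - ζ))).2
    have e1 : (1 / 2 : ℝ) • (w + ζ + (w - ζ)) = w := by module
    have e2 : (1 / 2 : ℝ) • (rotJ (w + ζ) + rotJ (w - ζ)) = rotJ w := by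
      rw [rotJ_add, rotJ_sub]; module
    rw [e1] at h1
    rw [e2] at h2
    rw [hermQ_levi hx.contDiffAt_two, hermQ_levi hy.contDiffAt_two] at h
    rw [hermQ_sub, hermQ_sub, hermQ_levi hV]
    linarith
  have hent := herm_entries_of_hermQ_nonneg hpos
  have h1 := hermDet_le_of_hermQ_le hQ hent.1 hent.2.1 hent.2.2
  have h2 := hermDet_harmMean_sub_rankOne_le (p := p) (δ := 0) hΛ hx.levi_zero_pos
    hx.levi_one_pos hX hy.levi_zero_pos hy.levi_one_pos hY
    (by rw [add_zero, ← gx]; exact hx.det_eq) (by rw [sub_zero, ← gy]; exact hy.det_eq)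
  have e : rankOne 0 = 0 := by ext i; fin_cases i <;> simp [rankOne]
  have e' : ∀ X, hermPair X 0 = 0 := fun X => by simp [hermPair]
  rw [e, e', e'] at h2
  simp at h2
  linarith

lemma hasFDerivAt_fderiv {f : (Fin 4 → ℝ) → ℝ} {x : Fin 4 → ℝ} (hf : ContDiffAt ℝ 2 f x) :
    HasFDerivAt (fderiv ℝ f) (fderiv ℝ (fderiv ℝ f) x) x :=
  ((hf.fderiv_right (m := 1) (by norm_num)).differentiableAt (by norm_num)).hasFDerivAt

lemma fderiv_comp_real {f : (Fin 4 → ℝ) → ℝ} {x : Fin 4 → ℝ} (hf : DifferentiableAt ℝ f x)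
    {g : ℝ → ℝ} {g₁ : ℝ} (hg : HasDerivAt g g₁ (f x)) :
    fderiv ℝ (fun y => g (f y)) x = g₁ • fderiv ℝ f x :=
  (hg.comp_hasFDerivAt x hf.hasFDerivAt).fderiv

lemma hessForm_comp_real {f : (Fin 4 → ℝ) → ℝ} {x : Fin 4 → ℝ} (hf : ContDiffAt ℝ 2 f x)
    {g g' : ℝ → ℝ} {g₂ : ℝ} (hg : ∀ t, HasDerivAt g (g' t) t) (hg' : HasDerivAt g' g₂ (f x))
    (w : Fin 4 → ℝ) :
    hessForm (fun y => g (f y)) x w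
      = g₂ * fderiv ℝ f x w ^ 2 + g' (f x) * hessForm f x w := by
  have hev : fderiv ℝ (fun y => g (f y)) =ᶠ[nhds x] fun y => g' (f y) • fderiv ℝ f y := by
    filter_upwards [hf.eventually (by simp)] with y hy
    exact fderiv_comp_real (hy.differentiableAt (by norm_num)) (hg _)
  have h1 : HasFDerivAt (fun y => g' (f y)) (g₂ • fderiv ℝ f x) x :=
    hg'.comp_hasFDerivAt x (hf.differentiableAt (by norm_num)).hasFDerivAt
  have hmul : HasFDerivAt (fun y => g' (f y) • fderiv ℝ f y) _ x := h1.smul (hasFDerivAt_fderiv hf)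
  unfold hessForm
  rw [hev.fderiv_eq, hmul.fderiv]
  simp
  ring

lemma hessForm_add {f g : (Fin 4 → ℝ) → ℝ} {x : Fin 4 → ℝ} (hf : ContDiffAt ℝ 2 f x)
    (hg : ContDiffAt ℝ 2 g x) (w : Fin 4 → ℝ) :
    hessForm (fun y => f y + g y) x w = hessForm f x w + hessForm g x w := by
  have hev : fderiv ℝ (fun y => f y + g y) =ᶠ[nhds x] fun y => fderiv ℝ f y + fderiv ℝ g y := by
    filter_upwards [hf.eventually (by simp), hg.eventually (by simp)] with y hy hy'
    exact fderiv_fun_add (hy.differentiableAt (by norm_num)) (hy'.differentiableAt (by norm_num))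
  have hs : HasFDerivAt (fun y => fderiv ℝ f y + fderiv ℝ g y) _ x :=
    (hasFDerivAt_fderiv hf).add (hasFDerivAt_fderiv hg)
  unfold hessForm
  rw [hev.fderiv_eq, hs.fderiv]
  simp

lemma hessForm_const_mul {f : (Fin 4 → ℝ) → ℝ} {x : Fin 4 → ℝ} (hf : ContDiffAt ℝ 2 f x)
    (c : ℝ) (w : Fin 4 → ℝ) : hessForm (fun y => c * f y) x w = c * hessForm f x w := by
  have := hessForm_comp_real hf (g := fun t => c * t) (g' := fun _ => c) (g₂ := 0)
    (fun t => by simpa using (hasDerivAt_id t).const_mul c) (hasDerivAt_const _ _) w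
  simpa using this

lemma levi_comp_real {f : (Fin 4 → ℝ) → ℝ} {x : Fin 4 → ℝ} (hf : ContDiffAt ℝ 2 f x)
    {g g' : ℝ → ℝ} {g₂ : ℝ} (hg : ∀ t, HasDerivAt g (g' t) t) (hg' : HasDerivAt g' g₂ (f x))
    (hgf : ContDiffAt ℝ 2 (fun y => g (f y)) x) :
    levi (fun y => g (f y)) x = g₂ • rankOne (gradVec f x) + g' (f x) • levi f x := by
  refine hermQ_ext fun w => ?_
  rw [hermQ_levi hgf, hermQ_add, hermQ_smul, hermQ_smul, hermQ_levi hf, hermQ_rankOne,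
    dotE_gradVec, dotE_gradVec, hessForm_comp_real hf hg hg', hessForm_comp_real hf hg hg']
  ring

lemma levi_add {f g : (Fin 4 → ℝ) → ℝ} {x : Fin 4 → ℝ} (hf : ContDiffAt ℝ 2 f x)
    (hg : ContDiffAt ℝ 2 g x) : levi (fun y => f y + g y) x = levi f x + levi g x := by
  refine hermQ_ext fun w => ?_
  rw [hermQ_levi (hf.add hg), hermQ_add, hermQ_levi hf, hermQ_levi hg, hessForm_add hf hg,
    hessForm_add hf hg]
  ring

lemma levi_const_mul {f : (Fin 4 → ℝ) → ℝ} {x : Fin 4 → ℝ} (hf : ContDiffAt ℝ 2 f x) (c : ℝ) :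
    levi (fun y => c * f y) x = c • levi f x := by
  refine hermQ_ext fun w => ?_
  rw [hermQ_levi (contDiffAt_const.mul hf), hermQ_smul, hermQ_levi hf, hessForm_const_mul hf,
    hessForm_const_mul hf]
  ring

lemma contDiff_normSqE {n : WithTop ℕ∞} : ContDiff ℝ n normSqE := by
  unfold normSqE; fun_prop

lemma hasFDerivAt_normSqE_sub (c x : Fin 4 → ℝ) :
    ∃ L : (Fin 4 → ℝ) →L[ℝ] ℝ, HasFDerivAt (fun y => normSqE (y - c)) L x ∧
      ∀ w, L w = 2 * dotE (x - c) w := by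
  have h : ∀ i : Fin 4, HasFDerivAt (fun y : Fin 4 → ℝ => (y i - c i) ^ 2)
      ((2 * (x i - c i)) • ContinuousLinearMap.proj (R := ℝ) (φ := fun _ : Fin 4 => ℝ) i) x := by
    intro i
    have h1 : HasFDerivAt (fun y : Fin 4 → ℝ => y i - c i)
        (ContinuousLinearMap.proj (R := ℝ) (φ := fun _ : Fin 4 => ℝ) i) x :=
      (ContinuousLinearMap.proj (R := ℝ) (φ := fun _ : Fin 4 => ℝ) i).hasFDerivAt.sub_const _
    exact (h1.pow 2).congr_fderiv (by ext w; simp)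
  refine ⟨_, (((h 0).add (h 1)).add (h 2)).add (h 3), fun w => ?_⟩
  simp [dotE]
  ring

lemma fderiv_normSqE_sub (c x w : Fin 4 → ℝ) :
    fderiv ℝ (fun y => normSqE (y - c)) x w = 2 * dotE (x - c) w := by
  obtain ⟨L, hL, h⟩ := hasFDerivAt_normSqE_sub c x
  rw [hL.fderiv, h]

lemma gradVec_normSqE_sub (c x : Fin 4 → ℝ) :
    gradVec (fun y => normSqE (y - c)) x = (2 : ℝ) • (x - c) := by
  ext i
  unfold gradVec pd
  rw [fderiv_normSqE_sub]
  fin_cases i <;> simp [dotE]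

lemma contDiffAt_normSqE_sub (c x : Fin 4 → ℝ) {n : WithTop ℕ∞} :
    ContDiffAt ℝ n (fun y => normSqE (y - c)) x :=
  (contDiff_normSqE.comp (contDiff_id.sub contDiff_const)).contDiffAt

lemma hessForm_normSqE_sub (c x w : Fin 4 → ℝ) :
    hessForm (fun y => normSqE (y - c)) x w = 2 * normSqE w := by
  have h1 := (contDiffAt_normSqE_sub c x (n := 2)).hasDerivAt_fderiv_line w
  have h2 : HasDerivAt (fun t : ℝ => 2 * dotE (x - c) w + t * (2 * normSqE w))
      (2 * normSqE w) 0 := by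
    simpa using ((hasDerivAt_id (0 : ℝ)).mul_const (2 * normSqE w)).const_add
      (2 * dotE (x - c) w)
  refine h1.unique (h2.congr_of_eventuallyEq (Filter.Eventually.of_forall fun t => ?_))
  simp only [fderiv_normSqE_sub]
  simp [dotE, normSqE]
  ring

lemma levi_normSqE_sub (c x : Fin 4 → ℝ) :
    levi (fun y => normSqE (y - c)) x = (4 : ℝ) • hermOne := by
  refine hermQ_ext fun w => ?_
  rw [hermQ_levi (contDiffAt_normSqE_sub c x), hessForm_normSqE_sub, hessForm_normSqE_sub,
    hermQ_smul, hermQ_hermOne, normSqE_rotJ]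
  ring

lemma isLogSolAt_negLog {u : (Fin 4 → ℝ) → ℝ} {Λ : ℝ} {x : Fin 4 → ℝ} (hΛ : 0 < Λ)
    (hu : ContDiffAt ℝ 3 u x) (hneg : u x < 0) (h0 : 0 ≤ levi u x 0) (h1 : 0 ≤ levi u x 1)
    (hdet : hermDet (levi u x) = Λ * u x ^ 2) :
    IsLogSolAt (fun y => -Real.log (-(u y) / 4)) Λ x := by
  have h2 : ContDiffAt ℝ 2 u x := hu.of_le (by norm_num)
  have hux : 0 < -u x := by linarith
  have hdet0 : 0 < levi u x 0 * levi u x 1 := by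
    have : 0 < Λ * u x ^ 2 := mul_pos hΛ (sq_pos_of_neg hneg)
    rw [← hdet] at this
    unfold hermDet at this
    nlinarith [sq_nonneg (levi u x 2), sq_nonneg (levi u x 3)]
  have h0' : 0 < levi u x 0 := by
    refine lt_of_le_of_ne h0 fun h => ?_
    rw [← h, zero_mul] at hdet0
    exact hdet0.false
  have h1' : 0 < levi u x 1 := by
    refine lt_of_le_of_ne h1 fun h => ?_
    rw [← h, mul_zero] at hdet0
    exact hdet0.false
  refine ⟨contDiffAt_negLog hu hneg, ?_, ?_, ?_⟩
  · rw [levi_negLog h2 hneg]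
    exact mul_pos (inv_pos.2 hux) h0'
  · rw [levi_negLog h2 hneg]
    exact mul_pos (inv_pos.2 hux) h1'
  · rw [levi_negLog h2 hneg, hermDet_smul, hdet]
    field_simp
    exact div_self hneg.ne

lemma not_isLocalMax_mul_exp {u V : (Fin 4 → ℝ) → ℝ} {Λ : ℝ} {x y : Fin 4 → ℝ} (hΛ : 0 < Λ)
    (hx : IsLogSolAt (fun y => -Real.log (-(u y) / 4)) Λ x)
    (hy : IsLogSolAt (fun y => -Real.log (-(u y) / 4)) Λ y)
    (hux : ∀ᶠ z in nhds x, u z < 0) (huy : ∀ᶠ z in nhds y, u z < 0)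
    (hV : ContDiffAt ℝ 2 V ((1 / 2 : ℝ) • (x + y)))
    (hpos : ∀ w, 0 ≤ hermQ (levi V ((1 / 2 : ℝ) • (x + y))
      - rankOne (gradVec V ((1 / 2 : ℝ) • (x + y)))) w)
    (hdet : Λ < hermDet (levi V ((1 / 2 : ℝ) • (x + y))
      - rankOne (gradVec V ((1 / 2 : ℝ) • (x + y))))) :
    ¬ IsLocalMax (fun z : (Fin 4 → ℝ) × (Fin 4 → ℝ) =>
      u z.1 * u z.2 * Real.exp (2 * V ((1 / 2 : ℝ) • (z.1 + z.2)))) (x, y) := by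
  intro hmax
  refine not_isLocalMin_midpoint hΛ hx hy hV hpos hdet ?_
  have e : ∀ a b m : ℝ, a < 0 → b < 0 →
      -Real.log (-a / 4) + -Real.log (-b / 4) - 2 * m
        = Real.log 16 - Real.log (a * b * Real.exp (2 * m)) := by
    intro a b m ha hb
    have hab : 0 < a * b := mul_pos_of_neg_of_neg ha hb
    have h16 : a * b = 16 * ((-a / 4) * (-b / 4)) := by ring
    rw [Real.log_mul hab.ne' (Real.exp_pos _).ne', Real.log_exp, h16,
      Real.log_mul (by norm_num) (by nlinarith), Real.log_mul (by linarith) (by linarith)]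
    ring
  have h1 : ∀ᶠ z : (Fin 4 → ℝ) × (Fin 4 → ℝ) in nhds (x, y), u z.1 < 0 :=
    (continuous_fst.tendsto (x, y)).eventually hux
  have h2 : ∀ᶠ z : (Fin 4 → ℝ) × (Fin 4 → ℝ) in nhds (x, y), u z.2 < 0 :=
    (continuous_snd.tendsto (x, y)).eventually huy
  filter_upwards [hmax, h1, h2] with z hz hz1 hz2
  rw [e _ _ _ hux.self_of_nhds huy.self_of_nhds, e _ _ _ hz1 hz2]
  have hp : 0 < u z.1 * u z.2 * Real.exp (2 * V ((1 / 2 : ℝ) • (z.1 + z.2))) :=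
    mul_pos (mul_pos_of_neg_of_neg hz1 hz2) (Real.exp_pos _)
  linarith [Real.log_le_log hp hz]

lemma nonpos_of_mem_closure {Ω : Set (Fin 4 → ℝ)} {u : (Fin 4 → ℝ) → ℝ} (hopen : IsOpen Ω)
    (hneg : ∀ x ∈ Ω, u x < 0) (hbdry : ∀ x ∈ frontier Ω, u x = 0) {x : Fin 4 → ℝ}
    (hx : x ∈ closure Ω) : u x ≤ 0 ∧ (u x < 0 → x ∈ Ω) := by
  by_cases h : x ∈ Ω
  · exact ⟨(hneg x h).le, fun _ => h⟩
  · have := hbdry x (by rw [hopen.frontier_eq]; exact ⟨hx, h⟩)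
    exact ⟨this.le, fun h' => absurd this h'.ne⟩

lemma exists_max_pair {Ω : Set (Fin 4 → ℝ)} (hopen : IsOpen Ω) (hbd : Bornology.IsBounded Ω)
    {u V : (Fin 4 → ℝ) → ℝ} (hcont : ContinuousOn u (closure Ω)) (hneg : ∀ x ∈ Ω, u x < 0)
    (hbdry : ∀ x ∈ frontier Ω, u x = 0) {W : Set (Fin 4 → ℝ)} (hW : IsClosed W)
    (hV : ContinuousOn V W) {x₀ y₀ : Fin 4 → ℝ} (hx₀ : x₀ ∈ Ω) (hy₀ : y₀ ∈ Ω)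
    (hm₀ : (1 / 2 : ℝ) • (x₀ + y₀) ∈ W) :
    ∃ x ∈ Ω, ∃ y ∈ Ω, (1 / 2 : ℝ) • (x + y) ∈ W ∧
      ∀ x' ∈ Ω, ∀ y' ∈ Ω, (1 / 2 : ℝ) • (x' + y') ∈ W →
        u x' * u y' * Real.exp (2 * V ((1 / 2 : ℝ) • (x' + y')))
          ≤ u x * u y * Real.exp (2 * V ((1 / 2 : ℝ) • (x + y))) := by
  have hmid : Continuous fun z : (Fin 4 → ℝ) × (Fin 4 → ℝ) => (1 / 2 : ℝ) • (z.1 + z.2) := by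
    fun_prop
  set S : Set ((Fin 4 → ℝ) × (Fin 4 → ℝ)) :=
    (closure Ω ×ˢ closure Ω) ∩ (fun z => (1 / 2 : ℝ) • (z.1 + z.2)) ⁻¹' W with hS
  have hSc : IsCompact S :=
    (hbd.isCompact_closure.prod hbd.isCompact_closure).inter_right (hW.preimage hmid)
  have hF : ContinuousOn (fun z : (Fin 4 → ℝ) × (Fin 4 → ℝ) =>
      u z.1 * u z.2 * Real.exp (2 * V ((1 / 2 : ℝ) • (z.1 + z.2)))) S := by
    refine ((hcont.comp continuous_fst.continuousOn fun z hz => hz.1.1).mul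
      (hcont.comp continuous_snd.continuousOn fun z hz => hz.1.2)).mul ?_
    exact Real.continuous_exp.comp_continuousOn
      (continuousOn_const.mul (hV.comp hmid.continuousOn fun z hz => hz.2))
  obtain ⟨⟨x, y⟩, ⟨⟨hx, hy⟩, hm⟩, hmax⟩ := hSc.exists_isMaxOn
    ⟨(x₀, y₀), ⟨subset_closure hx₀, subset_closure hy₀⟩, hm₀⟩ hF
  have hmax' : ∀ x' ∈ Ω, ∀ y' ∈ Ω, (1 / 2 : ℝ) • (x' + y') ∈ W →
      u x' * u y' * Real.exp (2 * V ((1 / 2 : ℝ) • (x' + y')))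
        ≤ u x * u y * Real.exp (2 * V ((1 / 2 : ℝ) • (x + y))) := fun x' hx' y' hy' hm' =>
    hmax (show (x', y') ∈ S from ⟨⟨subset_closure hx', subset_closure hy'⟩, hm'⟩)
  have hpos : 0 < u x * u y := by
    have h1 := hmax' x₀ hx₀ y₀ hy₀ hm₀
    have h2 : 0 < u x₀ * u y₀ := mul_pos_of_neg_of_neg (hneg _ hx₀) (hneg _ hy₀)
    exact pos_of_mul_pos_left (lt_of_lt_of_le (by positivity) h1) (Real.exp_pos _).le
  obtain ⟨hx1, hx2⟩ := nonpos_of_mem_closure hopen hneg hbdry hx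
  obtain ⟨hy1, hy2⟩ := nonpos_of_mem_closure hopen hneg hbdry hy
  refine ⟨x, hx2 ?_, y, hy2 ?_, hm, hmax'⟩
  · exact lt_of_le_of_ne hx1 fun h => by simp [h] at hpos
  · exact lt_of_le_of_ne hy1 fun h => by simp [h] at hpos

/-- A boundary barrier makes `u - ε ψ` a strict subsolution of the equation for `-log`. -/
lemma negLog_sub_barrier {u ψ : (Fin 4 → ℝ) → ℝ} {Λ ε : ℝ} {m Y : Fin 4 → ℝ} (hΛ : 0 < Λ)
    (hu : ContDiffAt ℝ 2 u m) (hneg : u m < 0) (h0 : 0 ≤ levi u m 0) (h1 : 0 ≤ levi u m 1)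
    (hdet : hermDet (levi u m) = Λ * u m ^ 2) (hψ : ContDiffAt ℝ 2 ψ m) (hψ0 : 0 ≤ ψ m)
    (hψ1 : ψ m ≤ 1) (hY0 : 0 ≤ Y 0) (hY1 : 0 ≤ Y 1) (hY : 2 * Λ ≤ hermDet Y)
    (hYψ : ∀ w, hermQ Y w ≤ -hermQ (levi ψ m) w) (hε : 0 < ε) :
    ContDiffAt ℝ 2 (fun y => -Real.log (-(u y + -ε * ψ y) / 4)) m ∧
    (∀ w, 0 ≤ hermQ (levi (fun y => -Real.log (-(u y + -ε * ψ y) / 4)) m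
      - rankOne (gradVec (fun y => -Real.log (-(u y + -ε * ψ y) / 4)) m)) w) ∧
    Λ < hermDet (levi (fun y => -Real.log (-(u y + -ε * ψ y) / 4)) m
      - rankOne (gradVec (fun y => -Real.log (-(u y + -ε * ψ y) / 4)) m)) := by
  have hψ' : ContDiffAt ℝ 2 (fun y => -ε * ψ y) m := contDiffAt_const.mul hψ
  have hU : ContDiffAt ℝ 2 (fun y => u y + -ε * ψ y) m := hu.add hψ'
  have hUneg : u m + -ε * ψ m < 0 := by nlinarith
  have hlevi : levi (fun y => u y + -ε * ψ y) m = levi u m + -ε • levi ψ m := by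
    rw [levi_add hu hψ', levi_const_mul hψ]
  set D := -(u m + -ε * ψ m) with hD
  have hDpos : 0 < D := by linarith
  have hQ : ∀ w, hermQ (levi u m + ε • Y) w ≤ hermQ (levi u m + -ε • levi ψ m) w := by
    intro w
    rw [hermQ_add, hermQ_add, hermQ_smul, hermQ_smul]
    nlinarith [hYψ w]
  have hY' : 0 ≤ hermDet Y := by linarith
  have hdet0 : 0 ≤ hermDet (levi u m) := by rw [hdet]; positivity
  have hZ0 : 0 ≤ (levi u m + ε • Y) 0 := by simp; positivity
  have hZ1 : 0 ≤ (levi u m + ε • Y) 1 := by simp; positivity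
  have hpair : 2 * Λ * -u m ≤ hermPair (levi u m) Y := by
    have h := two_mul_le_hermPair (X := levi u m) (Y := (-u m) • Y) (k := Λ * u m ^ 2)
      (by positivity) h0 h1 hdet.ge (mul_nonneg (by linarith) hY0) (mul_nonneg (by linarith) hY1)
      (by rw [hermDet_smul]; nlinarith [sq_nonneg (u m)])
    have e : hermPair (levi u m) ((-u m) • Y) = -u m * hermPair (levi u m) Y := by
      simp [hermPair]; ring
    rw [e] at h
    refine le_of_mul_le_mul_left ?_ (show 0 < -u m by linarith)
    linarith
  have hZdet : Λ * (-u m + ε) ^ 2 + Λ * ε ^ 2 ≤ hermDet (levi u m + ε • Y) := by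
    have e : hermPair (levi u m) (ε • Y) = ε * hermPair (levi u m) Y := by
      simp [hermPair]; ring
    rw [hermDet_add, hermDet_smul, e, hdet]
    nlinarith [mul_le_mul_of_nonneg_left hpair hε.le,
      mul_le_mul_of_nonneg_left hY (sq_nonneg ε)]
  have hZdet0 : 0 ≤ hermDet (levi u m + ε • Y) := le_trans (by positivity) hZdet
  refine ⟨contDiffAt_negLog hU hUneg, fun w => ?_, ?_⟩
  · rw [levi_negLog hU hUneg, hermQ_smul, hlevi]
    exact mul_nonneg (inv_nonneg.2 hDpos.le)
      ((hermQ_nonneg hZ0 hZ1 hZdet0 w).trans (hQ w))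
  · rw [levi_negLog hU hUneg, hermDet_smul, hlevi]
    have h2 := hermDet_le_of_hermQ_le hQ hZ0 hZ1 hZdet0
    have hD2 : D ^ 2 ≤ (-u m + ε) ^ 2 := by
      have : D ≤ -u m + ε := by rw [hD]; nlinarith
      exact pow_le_pow_left₀ hDpos.le this 2
    rw [inv_pow, inv_mul_eq_div, lt_div_iff₀ (pow_pos hDpos 2)]
    have : 0 < Λ * ε ^ 2 := by positivity
    nlinarith [mul_le_mul_of_nonneg_left hD2 hΛ.le]

lemma abs_hessForm_le (f : (Fin 4 → ℝ) → ℝ) (x w : Fin 4 → ℝ) :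
    |hessForm f x w| ≤ ‖fderiv ℝ (fderiv ℝ f) x‖ * normSqE w := by
  have h := (fderiv ℝ (fderiv ℝ f) x).le_opNorm₂ w w
  rw [Real.norm_eq_abs] at h
  refine h.trans ?_
  rw [mul_assoc, ← sq]
  gcongr
  exact norm_sq_le_normSqE w

lemma abs_hermQ_levi_le {f : (Fin 4 → ℝ) → ℝ} {x : Fin 4 → ℝ} (hf : ContDiffAt ℝ 2 f x)
    (w : Fin 4 → ℝ) :
    |hermQ (levi f x) w| ≤ 2 * ‖fderiv ℝ (fderiv ℝ f) x‖ * normSqE w := by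
  rw [hermQ_levi hf]
  have h1 := abs_hessForm_le f x w
  have h2 := abs_hessForm_le f x (rotJ w)
  rw [normSqE_rotJ] at h2
  linarith [abs_add_le (hessForm f x w) (hessForm f x (rotJ w))]

lemma continuous_gradVec {f : (Fin 4 → ℝ) → ℝ} (hf : ContDiff ℝ 1 f) :
    Continuous (gradVec f) :=
  continuous_pi fun _ => (hf.continuous_fderiv (by norm_num)).clm_apply continuous_const

lemma gradVec_ne_zero {f : (Fin 4 → ℝ) → ℝ} {x : Fin 4 → ℝ} (h : fderiv ℝ f x ≠ 0) :
    gradVec f x ≠ 0 := by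
  intro h0
  apply h
  ext w
  rw [← dotE_gradVec, h0]
  simp [dotE]

/-- A strictly plurisuperharmonic function in a thin boundary layer. -/
lemma exists_boundary_barrier {Ω : Set (Fin 4 → ℝ)} (hbd : Bornology.IsBounded Ω)
    (hne : Ω.Nonempty) {ρ : (Fin 4 → ℝ) → ℝ} (hρ : ContDiff ℝ 2 ρ) (hΩρ : Ω = {x | ρ x < 0})
    (hρgrad : ∀ x ∈ frontier Ω, fderiv ℝ ρ x ≠ 0) {Λ : ℝ} (hΛ : 0 < Λ) :
    ∃ (t : ℝ) (ψ : (Fin 4 → ℝ) → ℝ), 0 < t ∧ ContDiff ℝ 2 ψ ∧ (∃ x ∈ Ω, ρ x ≤ -t) ∧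
      ∀ m ∈ closure Ω, -t ≤ ρ m → 0 < ψ m ∧ ψ m ≤ 1 ∧ ∃ Y : Fin 4 → ℝ, 0 ≤ Y 0 ∧ 0 ≤ Y 1 ∧
        2 * Λ ≤ hermDet Y ∧ ∀ w, hermQ Y w ≤ -hermQ (levi ψ m) w := by
  obtain ⟨x₀, hx₀⟩ := hne
  have hx₀' : ρ x₀ < 0 := by rw [hΩρ] at hx₀; exact hx₀
  have hK := hbd.isCompact_closure
  have hKne : (closure Ω).Nonempty := ⟨x₀, subset_closure hx₀⟩
  have hρle : ∀ m ∈ closure Ω, ρ m ≤ 0 := fun m hm => by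
    have hcl : closure Ω ⊆ {x | ρ x ≤ 0} := by
      refine closure_minimal ?_ (isClosed_le hρ.continuous continuous_const)
      rw [hΩρ]
      exact fun x (hx : ρ x < 0) => hx.le
    exact hcl hm
  have hgc : Continuous fun m => normSqE (gradVec ρ m) :=
    continuous_normSqE.comp (continuous_gradVec (hρ.of_le (by norm_num)))
  obtain ⟨m₁, hm₁, hmin⟩ := hK.exists_isMinOn hKne
    (f := fun m => normSqE (gradVec ρ m) + -ρ m) (hgc.add hρ.continuous.neg).continuousOn
  set c := normSqE (gradVec ρ m₁) + -ρ m₁ with hc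
  have hc0 : 0 < c := by
    by_cases h : m₁ ∈ Ω
    · have h' : ρ m₁ < 0 := by rw [hΩρ] at h; exact h
      linarith [normSqE_nonneg (gradVec ρ m₁)]
    · have hfr : m₁ ∈ frontier Ω := ⟨hm₁, fun hi => h (interior_subset hi)⟩
      linarith [normSqE_pos (gradVec_ne_zero (hρgrad _ hfr)), hρle _ hm₁]
  obtain ⟨Q, hQ⟩ := hK.exists_bound_of_continuousOn continuous_normSqE.continuousOn
  have hD2 : Continuous fun m => fderiv ℝ (fderiv ℝ ρ) m :=
    (hρ.fderiv_right (m := 1) (by norm_num)).continuous_fderiv (by norm_num)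
  obtain ⟨L, hL⟩ := hK.exists_bound_of_continuousOn (f := fun m => fderiv ℝ (fderiv ℝ ρ) m)
    hD2.continuousOn
  have hQ0 : 0 ≤ Q := (norm_nonneg _).trans (hQ _ hm₁)
  have hL0 : 0 ≤ L := (norm_nonneg _).trans (hL _ hm₁)
  set τ : ℝ := 1 / (4 * (Q + 1)) with hτ
  have hτ0 : 0 < τ := by positivity
  have hτQ : τ * Q ≤ 1 / 4 := by
    rw [hτ, div_mul_eq_mul_div, div_le_iff₀ (by positivity)]; linarith
  set N : ℝ := Λ / (τ * c) with hN
  have hN0 : 0 < N := by positivity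
  have hNc : N * τ * c = Λ := by rw [hN]; field_simp
  set t : ℝ := min (min (c / 2) 1) (min (min (1 / (4 * N)) (τ / (2 * N * (L + 1)))) (-ρ x₀)) with ht
  have ht0 : 0 < t := by
    have : 0 < -ρ x₀ := by linarith
    rw [ht]; positivity
  have ht1 : t ≤ c / 2 := (min_le_left _ _).trans (min_le_left _ _)
  have ht2 : t ≤ 1 := (min_le_left _ _).trans (min_le_right _ _)
  have ht3 : t * (4 * N) ≤ 1 := (le_div_iff₀ (by positivity)).1
    ((min_le_right _ _).trans ((min_le_left _ _).trans (min_le_left _ _)))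
  have ht4 : t * (2 * N * (L + 1)) ≤ τ := (le_div_iff₀ (by positivity)).1
    ((min_le_right _ _).trans ((min_le_left _ _).trans (min_le_right _ _)))
  have ht5 : t ≤ -ρ x₀ := (min_le_right _ _).trans (min_le_right _ _)
  have hg2 : ContDiff ℝ 2 fun y => 1 + -N * ρ y ^ 2 :=
    contDiff_const.add (contDiff_const.mul (hρ.pow 2))
  have hq2 : ContDiff ℝ 2 fun y => -τ * normSqE (y - 0) :=
    contDiff_const.mul (contDiff_normSqE.comp (contDiff_id.sub contDiff_const))
  refine ⟨t, fun y => (1 + -N * ρ y ^ 2) + -τ * normSqE (y - 0), ht0, hg2.add hq2,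
    ⟨x₀, hx₀, by linarith⟩, fun m hm hρm => ?_⟩
  have hρm0 := hρle m hm
  have hqm := hQ m hm
  rw [Real.norm_eq_abs, abs_of_nonneg (normSqE_nonneg m)] at hqm
  have hq0 := normSqE_nonneg m
  have hρsq : ρ m ^ 2 ≤ t := by nlinarith
  have hlevi : levi (fun y => (1 + -N * ρ y ^ 2) + -τ * normSqE (y - 0)) m
      = ((-(2 * N)) • rankOne (gradVec ρ m) + (-(2 * N * ρ m)) • levi ρ m)
        + -τ • (4 : ℝ) • hermOne := by
    rw [levi_add hg2.contDiffAt hq2.contDiffAt, levi_const_mul (contDiffAt_normSqE_sub 0 m),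
      levi_normSqE_sub, levi_comp_real hρ.contDiffAt (g := fun s => 1 + -N * s ^ 2)
        (g' := fun s => -(2 * N * s)) (g₂ := -(2 * N)) ?_ ?_ hg2.contDiffAt]
    · intro s
      have := (((hasDerivAt_id s).pow 2).const_mul (-N)).const_add 1
      exact this.congr_deriv (by simp; ring)
    · have := ((hasDerivAt_id (ρ m)).const_mul (2 * N)).neg
      exact this.congr_deriv (by simp)
  refine ⟨?_, ?_, (2 * τ) • hermOne + (2 * N) • rankOne (gradVec ρ m), ?_, ?_, ?_, fun w => ?_⟩
  · simp only [sub_zero]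
    nlinarith [mul_le_mul_of_nonneg_left hρsq hN0.le, mul_le_mul_of_nonneg_left hqm hτ0.le]
  · simp only [sub_zero]
    nlinarith [mul_nonneg hN0.le (sq_nonneg (ρ m)), mul_nonneg hτ0.le hq0]
  · simp [hermOne, rankOne]; positivity
  · simp [hermOne, rankOne]; positivity
  · have e1 : hermDet ((2 * τ) • hermOne) = 4 * τ ^ 2 := by
      simp [hermDet, hermOne]; ring
    have e2 : hermPair ((2 * τ) • hermOne) (rankOne (gradVec ρ m))
        = 2 * τ * normSqE (gradVec ρ m) := by
      simp [hermPair, rankOne, hermOne, normSqE]; ring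
    rw [hermDet_add_smul_rankOne, e1, e2]
    have hcm : c ≤ normSqE (gradVec ρ m) + -ρ m := hmin hm
    have hcm' : c / 2 ≤ normSqE (gradVec ρ m) := by linarith
    have := mul_le_mul_of_nonneg_left hcm' (mul_nonneg hN0.le hτ0.le)
    nlinarith [sq_nonneg τ]
  · have hr := abs_hermQ_levi_le hρ.contDiffAt (x := m) w
    have hn := normSqE_nonneg w
    have hr' : |hermQ (levi ρ m) w| ≤ 2 * L * normSqE w :=
      hr.trans (mul_le_mul_of_nonneg_right (by linarith [hL m hm]) hn)
    have h1 : |2 * N * ρ m * hermQ (levi ρ m) w| ≤ 2 * τ * normSqE w := by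
      rw [abs_mul, abs_of_nonpos (by nlinarith : 2 * N * ρ m ≤ 0)]
      calc -(2 * N * ρ m) * |hermQ (levi ρ m) w| ≤ (2 * N * t) * (2 * L * normSqE w) :=
            mul_le_mul (by nlinarith) hr' (abs_nonneg _) (by positivity)
        _ = 2 * ((2 * N * t * L) * normSqE w) := by ring
        _ ≤ 2 * (τ * normSqE w) := by
            have : 2 * N * t * L ≤ τ := by nlinarith [mul_pos hN0 ht0]
            linarith [mul_le_mul_of_nonneg_right this hn]
        _ = 2 * τ * normSqE w := by ring
    have h2 := neg_abs_le (2 * N * ρ m * hermQ (levi ρ m) w)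
    rw [hlevi]
    simp only [hermQ_add, hermQ_smul, hermQ_hermOne]
    linarith

/-- A negative plurisubharmonic solution of the Monge–Ampère eigenvalue equation with zero boundary
values. -/
structure IsEigenfunction (Ω : Set (Fin 4 → ℝ)) (u : (Fin 4 → ℝ) → ℝ) (Λ : ℝ) : Prop where
  contDiffAt : ∀ x ∈ Ω, ContDiffAt ℝ 3 u x
  neg : ∀ x ∈ Ω, u x < 0
  levi_zero : ∀ x ∈ Ω, 0 ≤ levi u x 0
  levi_one : ∀ x ∈ Ω, 0 ≤ levi u x 1
  det_eq : ∀ x ∈ Ω, hermDet (levi u x) = Λ * u x ^ 2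
  continuousOn : ContinuousOn u (closure Ω)
  boundary : ∀ x ∈ frontier Ω, u x = 0

namespace IsEigenfunction

variable {Ω : Set (Fin 4 → ℝ)} {u : (Fin 4 → ℝ) → ℝ} {Λ : ℝ}

lemma isLogSolAt (hu : IsEigenfunction Ω u Λ) (hΛ : 0 < Λ) {x : Fin 4 → ℝ} (hx : x ∈ Ω) :
    IsLogSolAt (fun y => -Real.log (-(u y) / 4)) Λ x :=
  isLogSolAt_negLog hΛ (hu.contDiffAt x hx) (hu.neg x hx) (hu.levi_zero x hx) (hu.levi_one x hx)
    (hu.det_eq x hx)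

lemma eventually_neg (hu : IsEigenfunction Ω u Λ) (hopen : IsOpen Ω) {x : Fin 4 → ℝ} (hx : x ∈ Ω) :
    ∀ᶠ z in nhds x, u z < 0 :=
  Filter.mem_of_superset (hopen.mem_nhds hx) hu.neg

end IsEigenfunction

lemma exp_two_mul_negLog {a : ℝ} (ha : a < 0) : Real.exp (2 * -Real.log (-a / 4)) = 16 / a ^ 2 := by
  have h : 0 < -a / 4 := by linarith
  rw [mul_neg, Real.exp_neg, two_mul, Real.exp_add, Real.exp_log h]
  field_simp
  norm_num

lemma Convex.half_smul_add_mem {Ω : Set (Fin 4 → ℝ)} (hconv : Convex ℝ Ω) {x y : Fin 4 → ℝ}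
    (hx : x ∈ Ω) (hy : y ∈ Ω) : (1 / 2 : ℝ) • (x + y) ∈ Ω := by
  rw [smul_add]
  exact hconv hx hy (by norm_num) (by norm_num) (by norm_num)

/-- The two-point quotient `u(x) u(y) / u((x + y) / 2)²` attains its maximum in the interior. -/
lemma exists_max_quotient {Ω : Set (Fin 4 → ℝ)} (hopen : IsOpen Ω) (hbd : Bornology.IsBounded Ω)
    (hconv : Convex ℝ Ω) (hne : Ω.Nonempty) {ρ : (Fin 4 → ℝ) → ℝ} (hρ : ContDiff ℝ 2 ρ)
    (hΩρ : Ω = {x | ρ x < 0}) (hρgrad : ∀ x ∈ frontier Ω, fderiv ℝ ρ x ≠ 0)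
    {u : (Fin 4 → ℝ) → ℝ} {Λ : ℝ} (hΛ : 0 < Λ) (hu : IsEigenfunction Ω u Λ) :
    ∃ k : ℝ, (∃ x ∈ Ω, ∃ y ∈ Ω, u x * u y = k * u ((1 / 2 : ℝ) • (x + y)) ^ 2) ∧
      ∀ x ∈ Ω, ∀ y ∈ Ω, u x * u y ≤ k * u ((1 / 2 : ℝ) • (x + y)) ^ 2 := by
  obtain ⟨t, ψ, ht, hψ, ⟨x₀, hx₀, hx₀t⟩, hlayer⟩ :=
    exists_boundary_barrier hbd hne hρ hΩρ hρgrad hΛ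
  set v : (Fin 4 → ℝ) → ℝ := fun y => -Real.log (-(u y) / 4) with hv
  have hmidΩ : ∀ x ∈ Ω, ∀ y ∈ Ω, (1 / 2 : ℝ) • (x + y) ∈ Ω := fun x hx y hy =>
    hconv.half_smul_add_mem hx hy
  have hWΩ : {m | ρ m ≤ -t} ⊆ Ω := by
    intro m (hm : ρ m ≤ -t)
    rw [hΩρ]
    exact lt_of_le_of_lt hm (by linarith)
  have hx₀' : (1 / 2 : ℝ) • (x₀ + x₀) = x₀ := by module
  obtain ⟨x₁, hx₁, y₁, hy₁, -, hmax₁⟩ := exists_max_pair (V := v) hopen hbd hu.continuousOn hu.neg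
    hu.boundary (isClosed_le hρ.continuous continuous_const : IsClosed {m | ρ m ≤ -t})
    (fun m hm => (hu.isLogSolAt hΛ (hWΩ hm)).contDiffAt.continuousAt.continuousWithinAt)
    hx₀ hx₀ (by rw [hx₀']; exact hx₀t)
  have hm₁ := hu.neg _ (hmidΩ _ hx₁ _ hy₁)
  set k := u x₁ * u y₁ / u ((1 / 2 : ℝ) • (x₁ + y₁)) ^ 2 with hk
  have hk0 : 0 < k := div_pos (mul_pos_of_neg_of_neg (hu.neg _ hx₁) (hu.neg _ hy₁))
    (sq_pos_of_neg hm₁)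
  have hkin : ∀ x ∈ Ω, ∀ y ∈ Ω, ρ ((1 / 2 : ℝ) • (x + y)) ≤ -t →
      u x * u y ≤ k * u ((1 / 2 : ℝ) • (x + y)) ^ 2 := by
    intro x hx y hy hxy
    have h := hmax₁ x hx y hy hxy
    have hm := hu.neg _ (hmidΩ _ hx _ hy)
    rw [hv] at h
    simp only at h
    rw [exp_two_mul_negLog hm, exp_two_mul_negLog hm₁] at h
    have e : u x₁ * u y₁ * (16 / u ((1 / 2 : ℝ) • (x₁ + y₁)) ^ 2) = 16 * k := by rw [hk]; ring
    rw [e, mul_div_assoc', div_le_iff₀ (sq_pos_of_neg hm)] at h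
    linarith
  refine ⟨k, ⟨x₁, hx₁, y₁, hy₁, ?_⟩, fun x hx y hy => ?_⟩
  · rw [hk, div_mul_cancel₀ _ (sq_pos_of_neg hm₁).ne']
  by_contra! hlt
  have hlim : ∀ᶠ ε : ℝ in nhdsWithin 0 (Set.Ioi 0),
      k * (u ((1 / 2 : ℝ) • (x + y)) + -ε * ψ ((1 / 2 : ℝ) • (x + y))) ^ 2 < u x * u y := by
    have hc : Continuous fun ε : ℝ =>
        k * (u ((1 / 2 : ℝ) • (x + y)) + -ε * ψ ((1 / 2 : ℝ) • (x + y))) ^ 2 := by fun_prop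
    exact nhdsWithin_le_nhds ((hc.tendsto 0).eventually (gt_mem_nhds (by simpa using hlt)))
  obtain ⟨ε, hε, hε0⟩ := (hlim.and self_mem_nhdsWithin).exists
  have hε0 : 0 < ε := hε0
  set V : (Fin 4 → ℝ) → ℝ := fun y => -Real.log (-(u y + -ε * ψ y) / 4) with hV
  set W : Set (Fin 4 → ℝ) := closure Ω ∩ {m | -t ≤ ρ m} with hW
  have hUneg : ∀ m ∈ W, u m + -ε * ψ m < 0 := fun m hm => by
    have h1 := (nonpos_of_mem_closure hopen hu.neg hu.boundary hm.1).1
    have h2 := mul_pos hε0 (hlayer m hm.1 hm.2).1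
    linarith
  have hVc : ContinuousOn V W := by
    refine (ContinuousOn.log ?_ fun m hm => ?_).neg
    · exact (((hu.continuousOn.mono Set.inter_subset_left).add
        (continuousOn_const.mul hψ.continuous.continuousOn)).neg).div_const _
    · linarith [hUneg m hm]
  have hm := hmidΩ _ hx _ hy
  have hmρ : -t ≤ ρ ((1 / 2 : ℝ) • (x + y)) := by
    by_contra! h
    exact absurd (hkin x hx y hy h.le) (not_le.2 hlt)
  obtain ⟨x₂, hx₂, y₂, hy₂, hm₂W, hmax₂⟩ := exists_max_pair (V := V) hopen hbd hu.continuousOn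
    hu.neg hu.boundary (isClosed_closure.inter (isClosed_le continuous_const hρ.continuous))
    hVc hx hy ⟨subset_closure hm, hmρ⟩
  have hm₂ := hmidΩ _ hx₂ _ hy₂
  have hbig : k * (u ((1 / 2 : ℝ) • (x₂ + y₂)) + -ε * ψ ((1 / 2 : ℝ) • (x₂ + y₂))) ^ 2
      < u x₂ * u y₂ := by
    have h := hmax₂ x hx y hy ⟨subset_closure hm, hmρ⟩
    rw [hV] at h
    simp only at h
    have hU := hUneg _ hm₂W
    have hU' := hUneg _ ⟨subset_closure hm, hmρ⟩
    rw [exp_two_mul_negLog hU, exp_two_mul_negLog hU', mul_div_assoc', mul_div_assoc',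
      le_div_iff₀ (sq_pos_of_neg hU)] at h
    have h3 : 16 * k < u x * u y * 16 / (u ((1 / 2 : ℝ) • (x + y))
        + -ε * ψ ((1 / 2 : ℝ) • (x + y))) ^ 2 := by
      rw [lt_div_iff₀ (sq_pos_of_neg hU')]
      linarith
    have h4 := mul_lt_mul_of_pos_right h3 (sq_pos_of_neg hU)
    linarith
  have hψ₂ := hlayer _ hm₂W.1 hm₂W.2
  have hρ₂ : -t < ρ ((1 / 2 : ℝ) • (x₂ + y₂)) := by
    by_contra! h
    have h1 := hkin x₂ hx₂ y₂ hy₂ h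
    have h2 := hu.neg _ hm₂
    have h3 := mul_pos hε0 hψ₂.1
    have h4 : u ((1 / 2 : ℝ) • (x₂ + y₂)) ^ 2
        ≤ (u ((1 / 2 : ℝ) • (x₂ + y₂)) + -ε * ψ ((1 / 2 : ℝ) • (x₂ + y₂))) ^ 2 := by
      nlinarith
    nlinarith
  obtain ⟨hψpos, hψ1, Y, hY0, hY1, hYdet, hYψ⟩ := hψ₂
  obtain ⟨hV2, hVpos, hVdet⟩ := negLog_sub_barrier hΛ
    ((hu.contDiffAt _ hm₂).of_le (by norm_num)) (hu.neg _ hm₂) (hu.levi_zero _ hm₂)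
    (hu.levi_one _ hm₂) (hu.det_eq _ hm₂) hψ.contDiffAt hψpos.le hψ1 hY0 hY1 hYdet hYψ hε0
  refine not_isLocalMax_mul_exp hΛ (hu.isLogSolAt hΛ hx₂) (hu.isLogSolAt hΛ hy₂)
    (hu.eventually_neg hopen hx₂) (hu.eventually_neg hopen hy₂) hV2 hVpos hVdet ?_
  have hmid : Continuous fun z : (Fin 4 → ℝ) × (Fin 4 → ℝ) =>
      ρ ((1 / 2 : ℝ) • (z.1 + z.2)) := hρ.continuous.comp (by fun_prop)
  filter_upwards [(hmid.tendsto (x₂, y₂)).eventually (lt_mem_nhds hρ₂),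
    (continuous_fst.tendsto (x₂, y₂)).eventually (hopen.mem_nhds hx₂),
    (continuous_snd.tendsto (x₂, y₂)).eventually (hopen.mem_nhds hy₂)] with z hz h1 h2
  exact hmax₂ _ h1 _ h2 ⟨subset_closure (hmidΩ _ h1 _ h2), le_of_lt hz⟩

lemma ContDiffAt.pd {f : (Fin 4 → ℝ) → ℝ} {x : Fin 4 → ℝ} {m n : WithTop ℕ∞}
    (hf : ContDiffAt ℝ n f x) (hmn : m + 1 ≤ n) (i : Fin 4) :
    ContDiffAt ℝ m (fun y => _root_.pd f i y) x :=
  (hf.fderiv_right hmn).clm_apply contDiffAt_const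

lemma contDiffAt_gradVec {f : (Fin 4 → ℝ) → ℝ} {x : Fin 4 → ℝ} (hf : ContDiffAt ℝ 3 f x) :
    ContDiffAt ℝ 1 (gradVec f) x :=
  contDiffAt_pi.2 fun i => hf.pd (by norm_num) i

lemma contDiffAt_levi {f : (Fin 4 → ℝ) → ℝ} {x : Fin 4 → ℝ} (hf : ContDiffAt ℝ 3 f x) :
    ContDiffAt ℝ 1 (levi f) x := by
  have h : ∀ i j, ContDiffAt ℝ 1 (fun y => pd2 f i j y) x := fun i j =>
    (hf.pd (m := 2) (by norm_num) i).pd (by norm_num) j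
  refine contDiffAt_pi.2 fun i => ?_
  fin_cases i
  · exact (h 0 0).add (h 2 2)
  · exact (h 1 1).add (h 3 3)
  · exact (h 0 1).add (h 2 3)
  · exact (h 0 3).sub (h 2 1)

lemma normSqE_add_add_normSqE_sub (a b : Fin 4 → ℝ) :
    normSqE (a + b) + normSqE (a - b) = 2 * normSqE a + 2 * normSqE b := by
  simp [normSqE]; ring

lemma norm_le_of_normSqE_le {w : Fin 4 → ℝ} {r : ℝ} (hr : 0 ≤ r) (h : normSqE w ≤ r ^ 2) :
    ‖w‖ ≤ r :=
  abs_le_of_sq_le_sq' ((norm_sq_le_normSqE w).trans h) hr |>.2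

/-- Sliding a ball along a segment until it touches a relatively closed set. -/
lemma exists_touching_ball {Ω T : Set (Fin 4 → ℝ)} (hopen : IsOpen Ω) (hconv : Convex ℝ Ω)
    (hTΩ : T ⊆ Ω) (hT : ∀ K, IsCompact K → K ⊆ Ω → IsCompact (T ∩ K)) {m₁ z : Fin 4 → ℝ}
    (hm₁ : m₁ ∈ T) (hz : z ∈ Ω) {δ : ℝ} (hδ : 0 < δ) (hzT : ∀ m ∈ T, δ ≤ dist m z) :
    ∃ m₂ ∈ T, ∃ c, m₂ ≠ c ∧ ∀ m ∈ T, normSqE (m - c) ≤ normSqE (m₂ - c) → m = m₂ := by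
  set γ : ℝ → Fin 4 → ℝ := fun s => z + s • (m₁ - z) with hγ
  have hγc : Continuous γ := by fun_prop
  set S := γ '' Set.Icc 0 1 with hS
  have hSc : IsCompact S := isCompact_Icc.image hγc
  have hSΩ : S ⊆ Ω := by
    rintro _ ⟨s, hs, rfl⟩
    exact hconv.add_smul_sub_mem hz (hTΩ hm₁) hs
  obtain ⟨η, hη, hηΩ⟩ := hSc.exists_cthickening_subset_open hopen hSΩ
  set K := Metric.cthickening η S with hK
  have hKc : IsCompact K := hSc.cthickening
  set r := min η (δ / 2) with hr
  have hr0 : 0 < r := by positivity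
  have hrη : r ≤ η := min_le_left _ _
  have hrδ : r < δ := (min_le_right _ _).trans_lt (by linarith)
  have hball : ∀ s ∈ Set.Icc (0 : ℝ) 1, ∀ m, normSqE (m - γ s) ≤ r ^ 2 → m ∈ K := by
    intro s hs m hm
    refine Metric.mem_cthickening_of_dist_le m (γ s) η S ⟨s, hs, rfl⟩ ?_
    rw [dist_eq_norm]
    exact (norm_le_of_normSqE_le hr0.le hm).trans hrη
  set C : Set (ℝ × (Fin 4 → ℝ)) :=
    (Set.Icc 0 1 ×ˢ (T ∩ K)) ∩ {z | normSqE (z.2 - γ z.1) ≤ r ^ 2} with hC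
  have hCc : IsCompact C := by
    refine (isCompact_Icc.prod (hT K hKc hηΩ)).inter_right
      (isClosed_le (continuous_normSqE.comp ?_) continuous_const)
    exact continuous_snd.sub (hγc.comp continuous_fst)
  have hγ1 : γ 1 = m₁ := by rw [hγ]; simp
  have h01 : (1 : ℝ) ∈ Set.Icc (0 : ℝ) 1 := ⟨zero_le_one, le_rfl⟩
  have hne : (1, m₁) ∈ C := by
    have h : normSqE (m₁ - γ 1) ≤ r ^ 2 := by
      rw [hγ1, sub_self]
      simp [normSqE]
      positivity
    exact ⟨⟨h01, hm₁, hball 1 h01 m₁ h⟩, h⟩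
  obtain ⟨⟨s, m₂⟩, ⟨⟨hs, hm₂T, hm₂K⟩, hm₂r⟩, hmin⟩ :=
    hCc.exists_isMinOn ⟨_, hne⟩ continuous_fst.continuousOn
  have hm₂r : normSqE (m₂ - γ s) ≤ r ^ 2 := hm₂r
  have hs : s ∈ Set.Icc (0 : ℝ) 1 := hs
  have hfree : ∀ m ∈ T, r ^ 2 ≤ normSqE (m - γ s) := by
    intro m hm
    by_contra! hlt
    have hs0 : 0 < s := by
      refine lt_of_le_of_ne hs.1 fun h => ?_
      have h1 := hzT m hm
      have h2 : γ s = z := by rw [← h, hγ]; simp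
      rw [h2] at hlt
      rw [dist_eq_norm] at h1
      linarith [norm_le_of_normSqE_le hr0.le hlt.le]
    have hcs : Continuous fun s' => normSqE (m - γ s') :=
      continuous_normSqE.comp (continuous_const.sub hγc)
    have h1 : ∀ᶠ s' in nhdsWithin s (Set.Iio s), normSqE (m - γ s') < r ^ 2 :=
      nhdsWithin_le_nhds ((hcs.tendsto s).eventually (gt_mem_nhds hlt))
    have h2 : ∀ᶠ s' in nhdsWithin s (Set.Iio s), 0 < s' :=
      nhdsWithin_le_nhds (lt_mem_nhds hs0)
    obtain ⟨s', ⟨h3, h4⟩, h5⟩ := ((h1.and h2).and self_mem_nhdsWithin).exists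
    have h5 : s' < s := h5
    have hs' : s' ∈ Set.Icc (0 : ℝ) 1 := ⟨h4.le, h5.le.trans hs.2⟩
    have : s ≤ s' := hmin (show (s', m) ∈ C from ⟨⟨hs', hm, hball s' hs' m h3.le⟩, h3.le⟩)
    linarith
  have hm₂eq : normSqE (m₂ - γ s) = r ^ 2 := le_antisymm hm₂r (hfree m₂ hm₂T)
  refine ⟨m₂, hm₂T, (1 / 2 : ℝ) • (γ s + m₂), fun h => ?_, fun m hm hle => ?_⟩
  · have h0 : m₂ - γ s = 0 := by
      have : (2 : ℝ) • m₂ = γ s + m₂ := by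
        conv_lhs => rw [h]
        module
      rw [two_smul] at this
      rw [sub_eq_zero]
      exact add_right_cancel this
    rw [h0] at hm₂eq
    simp [normSqE] at hm₂eq
    exact (pow_pos hr0 2).ne hm₂eq
  · by_contra hne
    have h1 := normSqE_add_add_normSqE_sub (m - (1 / 2 : ℝ) • (γ s + m₂))
      (m₂ - (1 / 2 : ℝ) • (γ s + m₂))
    have e1 : m - (1 / 2 : ℝ) • (γ s + m₂) + (m₂ - (1 / 2 : ℝ) • (γ s + m₂)) = m - γ s := by
      module
    have e2 : m - (1 / 2 : ℝ) • (γ s + m₂) - (m₂ - (1 / 2 : ℝ) • (γ s + m₂)) = m - m₂ := by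
      module
    have e3 : m₂ - (1 / 2 : ℝ) • (γ s + m₂) = (1 / 2 : ℝ) • (m₂ - γ s) := by module
    rw [e1, e2] at h1
    rw [e3, normSqE_smul, hm₂eq] at h1 hle
    linarith [hfree m hm, normSqE_pos (sub_ne_zero.2 hne)]

lemma exists_max_normSqE {Ω : Set (Fin 4 → ℝ)} (hopen : IsOpen Ω) (hbd : Bornology.IsBounded Ω)
    (hne : Ω.Nonempty) :
    ∃ x ∈ frontier Ω, ∀ m ∈ closure Ω, normSqE m ≤ normSqE x := by
  obtain ⟨x, hx, hmax⟩ := hbd.isCompact_closure.exists_isMaxOn hne.closure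
    continuous_normSqE.continuousOn
  refine ⟨x, ?_, fun m hm => hmax hm⟩
  rw [hopen.frontier_eq]
  refine ⟨hx, fun hxΩ => ?_⟩
  set e : Fin 4 → ℝ := Pi.single 0 1 with he
  have hev : ∀ s : ℝ, ∀ᶠ t : ℝ in nhdsWithin 0 (Set.Ioi 0), x + t • s • e ∈ Ω := by
    intro s
    have hc : Continuous fun t : ℝ => x + t • s • e := by fun_prop
    exact nhdsWithin_le_nhds ((hc.tendsto 0).eventually (hopen.mem_nhds (by simpa using hxΩ)))
  obtain ⟨t, ⟨h1, h2⟩, h3⟩ := (((hev 1).and (hev (-1))).and self_mem_nhdsWithin).exists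
  have h3 : 0 < t := h3
  have h4 : normSqE (x + t • (1 : ℝ) • e) ≤ normSqE x := hmax (subset_closure h1)
  have h5 : normSqE (x + t • (-1 : ℝ) • e) ≤ normSqE x := hmax (subset_closure h2)
  have e1 : x + t • (-1 : ℝ) • e = x - t • (1 : ℝ) • e := by module
  have h6 := normSqE_add_add_normSqE_sub x (t • (1 : ℝ) • e)
  have h7 : 0 < normSqE (t • (1 : ℝ) • e) := normSqE_pos (by simp [h3.ne', he])
  rw [e1] at h5
  linarith

lemma exists_bounds_of_isLogSolAt {v : (Fin 4 → ℝ) → ℝ} {Λ : ℝ} (hΛ : 0 < Λ)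
    {W : Set (Fin 4 → ℝ)} (hW : IsCompact W) (hv : ∀ m ∈ W, IsLogSolAt v Λ m) :
    ∃ T > 0, ∀ m ∈ W, normSqE (gradVec v m) ≤ T ∧
      (levi v m - rankOne (gradVec v m)) 0 + (levi v m - rankOne (gradVec v m)) 1 ≤ T ∧
      ∀ w, Λ / T * normSqE w ≤ hermQ (levi v m - rankOne (gradVec v m)) w := by
  have hg : ContinuousOn (gradVec v) W := fun m hm =>
    (contDiffAt_gradVec (hv m hm).contDiffAt).continuousAt.continuousWithinAt
  have hl : ContinuousOn (levi v) W := fun m hm =>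
    (contDiffAt_levi (hv m hm).contDiffAt).continuousAt.continuousWithinAt
  obtain ⟨T₁, hT₁⟩ := hW.exists_bound_of_continuousOn (continuous_normSqE.comp_continuousOn hg)
  obtain ⟨T₂, hT₂⟩ := hW.exists_bound_of_continuousOn hl
  have hl2 : ∀ m ∈ W, ∀ i, levi v m i ≤ |T₂| := fun m hm i =>
    (le_abs_self _).trans ((norm_le_pi_norm (levi v m) i).trans ((hT₂ m hm).trans (le_abs_self _)))
  refine ⟨|T₁| + 2 * |T₂| + 1, by positivity, fun m hm => ?_⟩
  have h1 := (le_abs_self _).trans ((hT₁ m hm).trans (le_abs_self _))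
  simp only [Function.comp] at h1
  have h0 : 0 ≤ rankOne (gradVec v m) 0 := by simp [rankOne]; positivity
  have h0' : 0 ≤ rankOne (gradVec v m) 1 := by simp [rankOne]; positivity
  have hle : (levi v m - rankOne (gradVec v m)) 0 + (levi v m - rankOne (gradVec v m)) 1
      ≤ |T₁| + 2 * |T₂| + 1 := by
    simp only [Pi.sub_apply]
    linarith [hl2 m hm 0, hl2 m hm 1, abs_nonneg T₁]
  refine ⟨by linarith [abs_nonneg T₂], hle, fun w => ?_⟩
  exact le_hermQ (hv m hm).pos_zero (hv m hm).pos_one hΛ (hv m hm).det_eq.ge hle w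

/-- The barrier `exp (-a |y - c|²)`. -/
lemma exists_exp_barrier {v : (Fin 4 → ℝ) → ℝ} {Λ : ℝ} (hΛ : 0 < Λ)
    {W : Set (Fin 4 → ℝ)} (hW : IsCompact W) (hv : ∀ m ∈ W, IsLogSolAt v Λ m) {c : Fin 4 → ℝ}
    {τ : ℝ} (hτ : 0 < τ) (hc : ∀ m ∈ W, τ ≤ normSqE (m - c)) :
    ∃ a > 0, ∃ ε₀ > 0, ∀ ε, 0 < ε → ε ≤ ε₀ → ∀ R, ∀ m ∈ W, ∀ V : (Fin 4 → ℝ) → ℝ,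
      (V = fun y => v y + ε * (Real.exp (-a * normSqE (y - c)) - Real.exp (-a * R))) →
      ContDiffAt ℝ 2 V m ∧ (∀ w, 0 ≤ hermQ (levi V m - rankOne (gradVec V m)) w) ∧
        Λ < hermDet (levi V m - rankOne (gradVec V m)) := by
  obtain ⟨T, hT, hb⟩ := exists_bounds_of_isLogSolAt hΛ hW hv
  obtain ⟨Q, hQ⟩ := hW.exists_bound_of_continuousOn
    (continuous_normSqE.comp (continuous_id.sub continuous_const) :
      Continuous fun m => normSqE (m - c)).continuousOn
  set P := T + 4 * |Q| with hP
  have hP0 : 0 ≤ P := by positivity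
  set μ := Λ / T with hμ
  have hμ0 : 0 < μ := by positivity
  set a := 1 + 8 * (4 + 2 * P) * T / (μ * (4 * τ)) with ha
  have ha1 : 1 ≤ a := by
    have : 0 ≤ 8 * (4 + 2 * P) * T / (μ * (4 * τ)) := by positivity
    linarith
  have haτ : 8 * (4 + 2 * P) * T < a * (μ * (4 * τ)) := by
    rw [ha, add_mul, div_mul_cancel₀ _ (by positivity)]
    have : 0 < μ * (4 * τ) := by positivity
    linarith
  have hD : 0 < (4 + 2 * P) * (a + 1) := by positivity
  refine ⟨a, by linarith, min (1 / 2) (μ / 2 / ((4 + 2 * P) * (a + 1))), by positivity,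
    fun ε hε hε₀ R m hm V hVdef => ?_⟩
  have hε1 : ε ≤ 1 / 2 := hε₀.trans (min_le_left _ _)
  have hε2 : ε * ((4 + 2 * P) * (a + 1)) ≤ μ / 2 :=
    (le_div_iff₀ hD).1 (hε₀.trans (min_le_right _ _))
  obtain ⟨hb1, hb2, hb3⟩ := hb m hm
  have hvm := hv m hm
  set κ := ε * Real.exp (-a * normSqE (m - c)) with hκ
  have hκ0 : 0 < κ := by positivity
  have hκε : κ ≤ ε := by
    have : Real.exp (-a * normSqE (m - c)) ≤ 1 := Real.exp_le_one_iff.2 (by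
      nlinarith [normSqE_nonneg (m - c)])
    nlinarith
  set g : ℝ → ℝ := fun t => ε * (Real.exp (-a * t) - Real.exp (-a * R)) with hg
  have hexp : ∀ t : ℝ, HasDerivAt (fun t => Real.exp (-a * t)) (-a * Real.exp (-a * t)) t := by
    intro t
    have := ((hasDerivAt_id t).const_mul (-a)).exp
    exact this.congr_deriv (by simp; ring)
  have hg' : ∀ t, HasDerivAt g (-(ε * a) * Real.exp (-a * t)) t := fun t =>
    (((hexp t).sub_const _).const_mul ε).congr_deriv (by ring)
  have hg'' : HasDerivAt (fun t => -(ε * a) * Real.exp (-a * t)) (κ * a ^ 2)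
      (normSqE (m - c)) :=
    ((hexp _).const_mul _).congr_deriv (by rw [hκ]; ring)
  have hθ := contDiffAt_normSqE_sub c m (n := 2)
  have hgθ : ContDiffAt ℝ 2 (fun y => g (normSqE (y - c))) m :=
    contDiffAt_const.mul (((contDiffAt_const.mul hθ).exp).sub contDiffAt_const)
  have hV : V = fun y => v y + g (normSqE (y - c)) := hVdef
  have hV2 : ContDiffAt ℝ 2 V m := by rw [hV]; exact hvm.contDiffAt_two.add hgθ
  have hlevi : levi V m = levi v m + ((κ * a ^ 2) • rankOne (gradVec (fun y => normSqE (y - c)) m)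
      + (-(κ * a)) • (4 : ℝ) • hermOne) := by
    rw [hV, levi_add hvm.contDiffAt_two hgθ, levi_comp_real hθ hg' hg'' hgθ, levi_normSqE_sub]
    congr 3
    rw [hκ]; ring
  have hgrad : gradVec V m = gradVec v m - (κ * a) • gradVec (fun y => normSqE (y - c)) m := by
    ext i
    have h1 : DifferentiableAt ℝ (fun y => normSqE (y - c)) m := hθ.differentiableAt (by norm_num)
    have h2 : fderiv ℝ V m = fderiv ℝ v m + fderiv ℝ (fun y => g (normSqE (y - c))) m := by
      rw [hV]
      exact fderiv_fun_add (hvm.contDiffAt_two.differentiableAt (by norm_num))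
        (hgθ.differentiableAt (by norm_num))
    simp only [gradVec, pd, h2, fderiv_comp_real h1 (hg' _), Pi.sub_apply, Pi.smul_apply,
      smul_eq_mul, add_apply, smul_apply]
    rw [hκ]; ring
  have hΘ : normSqE (gradVec (fun y => normSqE (y - c)) m) = 4 * normSqE (m - c) := by
    rw [gradVec_normSqE_sub, normSqE_smul]; norm_num
  have hQm : normSqE (m - c) ≤ |Q| := (le_abs_self _).trans ((hQ m hm).trans (le_abs_self _))
  have key := hermDet_barrier_lt (X := levi V m) (M := levi v m - rankOne (gradVec v m))
    (p := gradVec v m) (Θ := gradVec (fun y => normSqE (y - c)) m) (C := 4) (C' := 0) (A := a)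
    (κ := κ) (μ := μ) (τ := 4 * τ) (T := T) (P := P) hvm.det_eq hb3 hb2 hμ0
    (by linarith [abs_nonneg Q]) (by rw [hΘ]; linarith) (by rw [hΘ]; linarith [hc m hm])
    (by norm_num) (fun w => ?_) (by linarith) ?_ hκ0 (by linarith)
    ((mul_le_mul_of_nonneg_right hκε hD.le).trans hε2)
  · rw [hgrad]
    exact ⟨hV2, key.1, by simpa using key.2⟩
  · rw [hlevi, sub_add_cancel]
    simp only [hermQ_add, hermQ_smul, hermQ_hermOne]
    have := mul_nonneg hκ0.le (normSqE_nonneg w)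
    nlinarith
  · have h1 : (4 + 2 * P) * (a + 1) * T ≤ (4 + 2 * P) * (2 * a) * T := by gcongr; linarith
    nlinarith [mul_lt_mul_of_pos_left haτ (show 0 < a / 4 by linarith)]

/-- Midpoints of the pairs of points at which the quotient `u(x) u(y) / u((x + y) / 2)²` equals
`k`. -/
def pairMidpoints (Ω : Set (Fin 4 → ℝ)) (u : (Fin 4 → ℝ) → ℝ) (k : ℝ) : Set (Fin 4 → ℝ) :=
  {m | m ∈ Ω ∧ ∃ x ∈ Ω, ∃ y ∈ Ω, (1 / 2 : ℝ) • (x + y) = m ∧ u x * u y = k * u m ^ 2}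

section PairMidpoints

variable {Ω : Set (Fin 4 → ℝ)} {u : (Fin 4 → ℝ) → ℝ} {k : ℝ}

lemma isCompact_pairMidpoints_inter (hopen : IsOpen Ω) (hbd : Bornology.IsBounded Ω)
    (hcont : ContinuousOn u (closure Ω)) (hneg : ∀ x ∈ Ω, u x < 0)
    (hbdry : ∀ x ∈ frontier Ω, u x = 0) (hk : 0 < k) {K : Set (Fin 4 → ℝ)} (hK : IsCompact K)
    (hKΩ : K ⊆ Ω) : IsCompact (pairMidpoints Ω u k ∩ K) := by
  have hmid : Continuous fun z : (Fin 4 → ℝ) × (Fin 4 → ℝ) => (1 / 2 : ℝ) • (z.1 + z.2) := by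
    fun_prop
  set S : Set ((Fin 4 → ℝ) × (Fin 4 → ℝ)) :=
    (closure Ω ×ˢ closure Ω) ∩ (fun z => (1 / 2 : ℝ) • (z.1 + z.2)) ⁻¹' K with hS
  have hSc : IsCompact S :=
    (hbd.isCompact_closure.prod hbd.isCompact_closure).inter_right (hK.isClosed.preimage hmid)
  have hf : ContinuousOn (fun z : (Fin 4 → ℝ) × (Fin 4 → ℝ) =>
      u z.1 * u z.2 - k * u ((1 / 2 : ℝ) • (z.1 + z.2)) ^ 2) S := by
    refine ((hcont.comp continuous_fst.continuousOn fun z hz => hz.1.1).mul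
      (hcont.comp continuous_snd.continuousOn fun z hz => hz.1.2)).sub
      (continuousOn_const.mul ((hcont.comp hmid.continuousOn fun z hz => ?_).pow 2))
    exact subset_closure (hKΩ hz.2)
  have hc := hf.preimage_isClosed_of_isClosed hSc.isClosed (isClosed_singleton (x := (0 : ℝ)))
  have hcc : IsCompact (S ∩ (fun z : (Fin 4 → ℝ) × (Fin 4 → ℝ) =>
      u z.1 * u z.2 - k * u ((1 / 2 : ℝ) • (z.1 + z.2)) ^ 2) ⁻¹' {0}) :=
    hSc.of_isClosed_subset hc Set.inter_subset_left
  convert hcc.image hmid using 1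
  ext m
  constructor
  · rintro ⟨⟨hm, x, hx, y, hy, rfl, h⟩, hmK⟩
    exact ⟨(x, y), ⟨⟨⟨subset_closure hx, subset_closure hy⟩, hmK⟩, sub_eq_zero.2 h⟩, rfl⟩
  · rintro ⟨⟨x, y⟩, ⟨⟨⟨hx, hy⟩, hmK⟩, h⟩, rfl⟩
    have hx : x ∈ closure Ω := hx
    have hy : y ∈ closure Ω := hy
    have hmK : (1 / 2 : ℝ) • (x + y) ∈ K := hmK
    have h : u x * u y = k * u ((1 / 2 : ℝ) • (x + y)) ^ 2 := sub_eq_zero.1 h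
    have h1 := nonpos_of_mem_closure hopen hneg hbdry hx
    have h2 := nonpos_of_mem_closure hopen hneg hbdry hy
    have hpos : 0 < u x * u y := by
      rw [h]; exact mul_pos hk (sq_pos_of_neg (hneg _ (hKΩ hmK)))
    have hx0 : u x < 0 := lt_of_le_of_ne h1.1 fun h0 => by simp [h0] at hpos
    have hy0 : u y < 0 := lt_of_le_of_ne h2.1 fun h0 => by simp [h0] at hpos
    exact ⟨⟨hKΩ hmK, x, h1.2 hx0, y, h2.2 hy0, rfl, h⟩, hmK⟩

/-- If the quotient is smaller than `k` near a boundary point that is furthest from the origin, then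
the midpoints stay away from that point. -/
lemma exists_dist_le_pairMidpoints {x₀ : Fin 4 → ℝ} (hmax : ∀ m ∈ closure Ω, normSqE m ≤ normSqE x₀)
    (hloc : ∃ r > 0, ∀ x ∈ Ω, ∀ y ∈ Ω, dist x x₀ < r → dist y x₀ < r →
      u x * u y < k * u ((1 / 2 : ℝ) • (x + y)) ^ 2) :
    ∃ δ > 0, ∀ m ∈ pairMidpoints Ω u k, δ ≤ dist m x₀ := by
  obtain ⟨r, hr, hloc⟩ := hloc
  have hev : ∀ᶠ m in nhds x₀, normSqE x₀ - normSqE m < (r / 2) ^ 2 := by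
    have hc : Continuous fun m => normSqE x₀ - normSqE m :=
      continuous_const.sub continuous_normSqE
    exact (hc.tendsto x₀).eventually (gt_mem_nhds (by simp; positivity))
  obtain ⟨δ, hδ, hball⟩ := Metric.eventually_nhds_iff.1 hev
  refine ⟨min δ (r / 2), by positivity, fun m ⟨hm, x, hx, y, hy, hxy, h⟩ => ?_⟩
  by_contra! hlt
  have h1 := hball (hlt.trans_le (min_le_left _ _))
  have h2 : dist m x₀ < r / 2 := hlt.trans_le (min_le_right _ _)
  have ex : m + (x - m) = x := by module
  have ey : m - (x - m) = y := by rw [← hxy]; module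
  have h3 := normSqE_add_add_normSqE_sub m (x - m)
  rw [ex, ey] at h3
  have h4 : normSqE (x - m) ≤ (r / 2) ^ 2 := by
    linarith [hmax x (subset_closure hx), hmax y (subset_closure hy)]
  have h5 := norm_le_of_normSqE_le (by positivity) h4
  have h6 : dist x m ≤ r / 2 := by rw [dist_eq_norm]; exact h5
  have h7 : dist y m ≤ r / 2 := by
    rw [dist_eq_norm, ← ey, sub_sub_cancel_left, norm_neg]; exact h5
  have h8 := hloc x hx y hy (by linarith [dist_triangle x m x₀]) (by linarith [dist_triangle y m x₀])
  rw [hxy] at h8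
  exact absurd h h8.ne

end PairMidpoints

namespace IsEigenfunction

variable {Ω : Set (Fin 4 → ℝ)} {u : (Fin 4 → ℝ) → ℝ} {Λ k : ℝ}

lemma exists_quotient_lt (hu : IsEigenfunction Ω u Λ) (hopen : IsOpen Ω)
    (hbd : Bornology.IsBounded Ω) (hk : 0 < k)
    (hmax : ∀ x ∈ Ω, ∀ y ∈ Ω, u x * u y ≤ k * u ((1 / 2 : ℝ) • (x + y)) ^ 2)
    {S : Set (Fin 4 → ℝ)} (hS : IsClosed S) (hSΩ : S ⊆ Ω) (hST : ∀ m ∈ S, m ∉ pairMidpoints Ω u k) :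
    ∃ k' < k, ∀ x ∈ Ω, ∀ y ∈ Ω, (1 / 2 : ℝ) • (x + y) ∈ S →
      u x * u y ≤ k' * u ((1 / 2 : ℝ) • (x + y)) ^ 2 := by
  by_cases hne : S.Nonempty
  · obtain ⟨m₀, hm₀⟩ := hne
    have hm₀' : (1 / 2 : ℝ) • (m₀ + m₀) = m₀ := by module
    have hVc : ContinuousOn (fun y => -Real.log (-(u y))) S := by
      refine (ContinuousOn.log ?_ fun m hm => ?_).neg
      · exact (hu.continuousOn.mono (hSΩ.trans subset_closure)).neg
      · linarith [hu.neg m (hSΩ hm)]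
    have hexp : ∀ m ∈ Ω, Real.exp (2 * -Real.log (-(u m))) = 1 / u m ^ 2 := fun m hm => by
      have h : 0 < -u m := by linarith [hu.neg m hm]
      rw [mul_neg, Real.exp_neg, two_mul, Real.exp_add, Real.exp_log h]
      field_simp
    obtain ⟨x, hx, y, hy, hm, h⟩ := exists_max_pair hopen hbd hu.continuousOn hu.neg hu.boundary hS
      hVc (hSΩ hm₀) (hSΩ hm₀) (by rw [hm₀']; exact hm₀)
    have hlt : u x * u y < k * u ((1 / 2 : ℝ) • (x + y)) ^ 2 :=
      lt_of_le_of_ne (hmax x hx y hy) fun h => hST _ hm ⟨hSΩ hm, x, hx, y, hy, rfl, h⟩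
    refine ⟨u x * u y / u ((1 / 2 : ℝ) • (x + y)) ^ 2, ?_, fun x' hx' y' hy' hm' => ?_⟩
    · rwa [div_lt_iff₀ (sq_pos_of_neg (hu.neg _ (hSΩ hm)))]
    · have h1 := h x' hx' y' hy' hm'
      rw [hexp _ (hSΩ hm), hexp _ (hSΩ hm'), mul_one_div, mul_one_div,
        div_le_iff₀ (sq_pos_of_neg (hu.neg _ (hSΩ hm')))] at h1
      exact h1
  · rw [Set.not_nonempty_iff_eq_empty] at hne
    exact ⟨0, hk, fun x _ y _ h => by simp [hne] at h⟩

/-- The logarithm of an eigenfunction is midpoint concave. -/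
theorem mul_le_sq_midpoint (hu : IsEigenfunction Ω u Λ) (hopen : IsOpen Ω)
    (hbd : Bornology.IsBounded Ω) (hconv : Convex ℝ Ω)
    {ρ : (Fin 4 → ℝ) → ℝ} (hρ : ContDiff ℝ 2 ρ)
    (hΩρ : Ω = {x | ρ x < 0}) (hρgrad : ∀ x ∈ frontier Ω, fderiv ℝ ρ x ≠ 0) (hΛ : 0 < Λ)
    (hgrad : ContinuousOn (fun x => fderivWithin ℝ u (closure Ω) x) (closure Ω)) {x y : Fin 4 → ℝ}
    (hx : x ∈ Ω) (hy : y ∈ Ω) : u x * u y ≤ u ((1 / 2 : ℝ) • (x + y)) ^ 2 := by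
  obtain ⟨k, ⟨x₁, hx₁, y₁, hy₁, hk₁⟩, hmax⟩ :=
    exists_max_quotient hopen hbd hconv ⟨x, hx⟩ hρ hΩρ hρgrad hΛ hu
  rcases le_or_gt k 1 with hk | hk
  · nlinarith [hmax x hx y hy, sq_nonneg (u ((1 / 2 : ℝ) • (x + y)))]
  exfalso
  have hk0 : 0 < k := by linarith
  have hmidΩ : ∀ x ∈ Ω, ∀ y ∈ Ω, (1 / 2 : ℝ) • (x + y) ∈ Ω := fun x hx y hy =>
    hconv.half_smul_add_mem hx hy
  have hsub : ∀ x ∈ Ω, 0 ≤ ∑ i, hessForm u x (Pi.single i 1) := fun x hx => by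
    have h2 : ContDiffAt ℝ 2 u x := (hu.contDiffAt x hx).of_le (by norm_num)
    have h := add_nonneg (hu.levi_zero x hx) (hu.levi_one x hx)
    have h' : ∀ i, hessForm u x (Pi.single i 1) = pd2 u i i x := fun i => by
      rw [pd2_eq h2]; rfl
    simp only [h', Fin.sum_univ_four]
    simp [levi] at h
    linarith
  obtain ⟨x₀, hx₀, hx₀max⟩ := exists_max_normSqE hopen hbd ⟨x, hx⟩
  obtain ⟨δ, hδ, hgap⟩ := exists_dist_le_pairMidpoints hx₀max
    (exists_mul_lt_sq_midpoint hopen hconv hρ hΩρ hρgrad hu.continuousOn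
      (fun x hx => (hu.contDiffAt x hx).of_le (by norm_num)) hgrad hsub hu.neg hu.boundary hx₀ hk)
  obtain ⟨z, hz, hzx⟩ := Metric.mem_closure_iff.1 (frontier_subset_closure hx₀) (δ / 2)
    (by positivity)
  obtain ⟨m₂, hm₂, c, hmc, htouch⟩ := exists_touching_ball (T := pairMidpoints Ω u k) hopen hconv
    (fun m hm => hm.1)
    (fun K hK hKΩ => isCompact_pairMidpoints_inter hopen hbd hu.continuousOn hu.neg hu.boundary hk0
      hK hKΩ) ⟨hmidΩ x₁ hx₁ y₁ hy₁, x₁, hx₁, y₁, hy₁, rfl, hk₁⟩ hz (half_pos hδ)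
    (fun m hm => by linarith [hgap m hm, dist_triangle_right m x₀ z, dist_comm z x₀])
  obtain ⟨hm₂Ω, x₂, hx₂, y₂, hy₂, hxy₂, hk₂⟩ := hm₂
  have hR : 0 < normSqE (m₂ - c) := normSqE_pos (sub_ne_zero.2 hmc)
  set R := normSqE (m₂ - c) with hRdef
  have hθc : Continuous fun m => normSqE (m - c) :=
    continuous_normSqE.comp (continuous_id.sub continuous_const)
  obtain ⟨s, hs, hW⟩ := Metric.nhds_basis_closedBall.mem_iff.1 (Filter.inter_mem
    (hopen.mem_nhds hm₂Ω) ((hθc.tendsto m₂).eventually (lt_mem_nhds (half_lt_self hR))))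
  set W := Metric.closedBall m₂ s with hWdef
  have hWΩ : W ⊆ Ω := fun m hm => (hW hm).1
  obtain ⟨a, ha, ε₀, hε₀, hbar⟩ := exists_exp_barrier hΛ (isCompact_closedBall m₂ s)
    (fun m hm => hu.isLogSolAt hΛ (hWΩ hm)) (half_pos hR) (fun m hm => (hW hm).2.le)
  obtain ⟨k', hk', hS⟩ := hu.exists_quotient_lt hopen hbd hk0 hmax
    (S := Metric.sphere m₂ s ∩ {m | normSqE (m - c) ≤ R})
    (Metric.isClosed_sphere.inter (isClosed_le hθc continuous_const))
    (fun m hm => hWΩ (Metric.sphere_subset_closedBall hm.1))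
    (fun m hm hmT => by
      have h1 := htouch m hmT hm.2
      have h2 := hm.1
      rw [h1, Metric.mem_sphere, dist_self] at h2
      exact hs.ne h2)
  obtain ⟨ε, ⟨hε1, hε2⟩, hε0⟩ : ∃ ε : ℝ, (k' * Real.exp (2 * ε) < k ∧ ε < ε₀) ∧ 0 < ε := by
    have hc : Continuous fun ε : ℝ => k' * Real.exp (2 * ε) := by fun_prop
    have h1 : ∀ᶠ ε : ℝ in nhdsWithin 0 (Set.Ioi 0), k' * Real.exp (2 * ε) < k :=
      nhdsWithin_le_nhds ((hc.tendsto 0).eventually (gt_mem_nhds (by simpa using hk')))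
    have h2 : ∀ᶠ ε : ℝ in nhdsWithin 0 (Set.Ioi 0), ε < ε₀ :=
      nhdsWithin_le_nhds (gt_mem_nhds hε₀)
    exact ((h1.and h2).and self_mem_nhdsWithin).exists
  set b : (Fin 4 → ℝ) → ℝ := fun m => Real.exp (-a * normSqE (m - c)) - Real.exp (-a * R) with hb
  set V : (Fin 4 → ℝ) → ℝ := fun m => -Real.log (-(u m) / 4) + ε * b m with hV
  have hVbar : ∀ m ∈ W, _ := fun m hm => hbar ε hε0 hε2.le R m hm V rfl
  have hexpV : ∀ m ∈ Ω, Real.exp (2 * V m) = 16 / u m ^ 2 * Real.exp (2 * (ε * b m)) :=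
    fun m hm => by rw [hV]; simp only; rw [mul_add, Real.exp_add, exp_two_mul_negLog (hu.neg m hm)]
  obtain ⟨x₃, hx₃, y₃, hy₃, hm₃, hmax₃⟩ := exists_max_pair (V := V) hopen hbd hu.continuousOn
    hu.neg hu.boundary Metric.isClosed_closedBall
    (fun m hm => (hVbar m hm).1.continuousAt.continuousWithinAt) hx₂ hy₂
    (by rw [hxy₂]; exact Metric.mem_closedBall_self hs.le)
  have hm₃Ω := hmidΩ x₃ hx₃ y₃ hy₃
  have hval := hmax₃ x₂ hx₂ y₂ hy₂ (by rw [hxy₂]; exact Metric.mem_closedBall_self hs.le)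
  rw [hxy₂, hexpV _ hm₂Ω, hexpV _ hm₃Ω, hk₂] at hval
  have hb₂ : b m₂ = 0 := sub_self _
  have hu₂ := sq_pos_of_neg (hu.neg _ hm₂Ω)
  have hu₃ := sq_pos_of_neg (hu.neg _ hm₃Ω)
  have hq := hmax x₃ hx₃ y₃ hy₃
  have hq0 := mul_pos_of_neg_of_neg (hu.neg _ hx₃) (hu.neg _ hy₃)
  have hS₃ := hS x₃ hx₃ y₃ hy₃
  have hmid : Continuous fun z : (Fin 4 → ℝ) × (Fin 4 → ℝ) => (1 / 2 : ℝ) • (z.1 + z.2) := by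
    fun_prop
  have hnhds := hmid.tendsto (x₃, y₃)
  have hb3 := hVbar _ hm₃
  have hlocal : (1 / 2 : ℝ) • (x₃ + y₃) ∈ Metric.ball m₂ s → False := fun h => by
    refine not_isLocalMax_mul_exp hΛ (hu.isLogSolAt hΛ hx₃) (hu.isLogSolAt hΛ hy₃)
      (hu.eventually_neg hopen hx₃) (hu.eventually_neg hopen hy₃) hb3.1 hb3.2.1 hb3.2.2 ?_
    filter_upwards [hnhds.eventually (Metric.isOpen_ball.mem_nhds h),
      (continuous_fst.tendsto (x₃, y₃)).eventually (hopen.mem_nhds hx₃),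
      (continuous_snd.tendsto (x₃, y₃)).eventually (hopen.mem_nhds hy₃)] with z hz h1 h2
    exact hmax₃ _ h1 _ h2 (Metric.ball_subset_closedBall hz)
  generalize (1 / 2 : ℝ) • (x₃ + y₃) = m₃ at *
  set Q := u x₃ * u y₃ / u m₃ ^ 2 with hQ
  have hQ0 : 0 < Q := div_pos hq0 hu₃
  have hQk : Q ≤ k := by rwa [hQ, div_le_iff₀ hu₃]
  have hval' : k ≤ Q * Real.exp (2 * (ε * b m₃)) := by
    rw [hb₂] at hval
    have e1 : k * u m₂ ^ 2 * (16 / u m₂ ^ 2 * Real.exp (2 * (ε * 0))) = 16 * k := by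
      rw [mul_zero, mul_zero, Real.exp_zero, mul_one, mul_assoc, mul_div_cancel₀ _ hu₂.ne', mul_comm]
    have e2 : u x₃ * u y₃ * (16 / u m₃ ^ 2 * Real.exp (2 * (ε * b m₃)))
        = 16 * (Q * Real.exp (2 * (ε * b m₃))) := by rw [hQ]; ring
    linarith
  rcases (Metric.mem_closedBall.1 hm₃).lt_or_eq with h | h
  · exact hlocal h
  rcases le_or_gt (normSqE (m₃ - c)) R with hθ | hθ
  · have h1 : Q ≤ k' := by rw [hQ, div_le_iff₀ hu₃]; exact hS₃ ⟨h, hθ⟩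
    have hb1 : b m₃ ≤ 1 := by
      have h2 : Real.exp (-a * normSqE (m₃ - c)) ≤ 1 := Real.exp_le_one_iff.2 (by
        nlinarith [normSqE_nonneg (m₃ - c)])
      have h3 := Real.exp_pos (-a * R)
      rw [hb]; simp only; linarith
    have h4 : Real.exp (2 * (ε * b m₃)) ≤ Real.exp (2 * ε) := Real.exp_le_exp.2 (by nlinarith)
    have h5 := mul_le_mul h1 h4 (Real.exp_pos _).le (hQ0.le.trans h1)
    linarith
  · have hb1 : b m₃ < 0 := by
      have : Real.exp (-a * normSqE (m₃ - c)) < Real.exp (-a * R) := Real.exp_lt_exp.2 (by nlinarith)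
      rw [hb]; simp only; linarith
    have h4 : Real.exp (2 * (ε * b m₃)) < 1 := by
      rw [Real.exp_lt_one_iff]; nlinarith
    nlinarith

end IsEigenfunction

lemma normSqE_add_smul (e ζ : Fin 4 → ℝ) (t : ℝ) :
    normSqE (e + t • ζ) = normSqE e + 2 * t * dotE e ζ + t ^ 2 * normSqE ζ := by
  simp [normSqE, dotE]; ring

/-- First and second order conditions at a minimum of the second difference of `v`, corrected by
`φ(m) |e|² - K |e|⁴`. -/
lemma second_difference_derivative_test {v φ : (Fin 4 → ℝ) → ℝ} {m e : Fin 4 → ℝ} {K : ℝ}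
    (hx : ContDiffAt ℝ 2 v (m + e)) (hy : ContDiffAt ℝ 2 v (m - e)) (hm : ContDiffAt ℝ 2 v m)
    (hφ : ContDiffAt ℝ 2 φ m)
    (hmin : IsLocalMin (fun z : (Fin 4 → ℝ) × (Fin 4 → ℝ) =>
      v (z.1 + z.2) + v (z.1 - z.2) - 2 * v z.1
        + (-φ z.1 * normSqE z.2 + K * normSqE z.2 ^ 2)) (m, e)) (ξ ζ : Fin 4 → ℝ) :
    fderiv ℝ v (m + e) (ξ + ζ) + fderiv ℝ v (m - e) (ξ - ζ) - 2 * fderiv ℝ v m ξ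
      = fderiv ℝ φ m ξ * normSqE e + 2 * (φ m - 2 * K * normSqE e) * dotE e ζ ∧
    hessForm φ m ξ * normSqE e + 4 * fderiv ℝ φ m ξ * dotE e ζ + 2 * φ m * normSqE ζ
      - K * (4 * normSqE e * normSqE ζ + 8 * dotE e ζ ^ 2)
      ≤ hessForm v (m + e) (ξ + ζ) + hessForm v (m - e) (ξ - ζ) - 2 * hessForm v m ξ := by
  set q : ℝ → ℝ := fun t => normSqE e + 2 * t * dotE e ζ + t ^ 2 * normSqE ζ with hq
  set q' : ℝ → ℝ := fun t => 2 * dotE e ζ + 2 * t * normSqE ζ with hq'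
  have hqd : ∀ t, HasDerivAt q (q' t) t := fun t => by
    have h1 := (((hasDerivAt_id t).const_mul 2).mul_const (dotE e ζ)).const_add (normSqE e)
    exact (h1.add (((hasDerivAt_id t).pow 2).mul_const (normSqE ζ))).congr_deriv (by simp [hq'])
  have hq'd : HasDerivAt q' (2 * normSqE ζ) 0 := by
    have h1 := (((hasDerivAt_id (0 : ℝ)).const_mul 2).mul_const (normSqE ζ)).const_add
      (2 * dotE e ζ)
    exact h1.congr_deriv (by simp)
  set ψ : ℝ → ℝ := fun t => -φ (m + t • ξ) * q t + K * q t ^ 2 with hψ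
  set ψ' : ℝ → ℝ := fun t => -fderiv ℝ φ (m + t • ξ) ξ * q t + -φ (m + t • ξ) * q' t
    + K * (2 * q t * q' t) with hψ'
  have hψd : ∀ᶠ t in nhds 0, HasDerivAt ψ (ψ' t) t := by
    filter_upwards [hφ.hasDerivAt_line ξ] with t ht
    exact ((ht.neg.mul (hqd t)).add (((hqd t).pow 2).const_mul K)).congr_deriv (by
      simp [hψ'])
  have hφ0 : HasDerivAt (fun t : ℝ => φ (m + t • ξ)) (fderiv ℝ φ (m + (0 : ℝ) • ξ) ξ) 0 :=
    (hφ.hasDerivAt_line ξ).self_of_nhds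
  have hψ'd : HasDerivAt ψ' (-(hessForm φ m ξ * normSqE e + 4 * fderiv ℝ φ m ξ * dotE e ζ
      + 2 * φ m * normSqE ζ - K * (4 * normSqE e * normSqE ζ + 8 * dotE e ζ ^ 2))) 0 := by
    refine ((((hφ.hasDerivAt_fderiv_line ξ).neg.mul (hqd 0)).add (hφ0.neg.mul hq'd)).add
      ((((hqd 0).const_mul 2).mul hq'd).const_mul K)).congr_deriv ?_
    simp [hq, hq']
    ring
  have hmin' : IsLocalMin (fun t : ℝ => v (m + e + t • (ξ + ζ)) + v (m - e + t • (ξ - ζ))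
      - 2 * v (m + t • ξ) + ψ t) 0 := by
    have hc : Continuous fun t : ℝ => (m + t • ξ, e + t • ζ) := by fun_prop
    have hc0 : Filter.Tendsto (fun t : ℝ => (m + t • ξ, e + t • ζ)) (nhds 0) (nhds (m, e)) := by
      simpa using hc.tendsto 0
    filter_upwards [hc0.eventually hmin] with t ht
    have e1 : m + t • ξ + (e + t • ζ) = m + e + t • (ξ + ζ) := by module
    have e2 : m + t • ξ - (e + t • ζ) = m - e + t • (ξ - ζ) := by module
    simp only [normSqE_add_smul, e1, e2] at ht
    simpa [hψ, hq] using ht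
  obtain ⟨h1, h2⟩ := three_point_derivative_test hx hy hm hψd hψ'd hmin'
  refine ⟨?_, by linarith⟩
  simp [hψ', hq, hq'] at h1
  rw [map_add, map_sub]
  linarith

lemma normSqE_hermMul_le (B w : Fin 4 → ℝ) :
    normSqE (hermMul B w) ≤ 12 * ‖B‖ ^ 2 * normSqE w := by
  have hB : ∀ i, B i ^ 2 ≤ ‖B‖ ^ 2 := fun i => by
    rw [← sq_abs]
    exact pow_le_pow_left₀ (abs_nonneg _) (norm_le_pi_norm B i) 2
  have key : ∀ i j k x y z : ℝ, i ^ 2 ≤ ‖B‖ ^ 2 → j ^ 2 ≤ ‖B‖ ^ 2 → k ^ 2 ≤ ‖B‖ ^ 2 →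
      (i * x + j * y + k * z) ^ 2 ≤ 3 * ‖B‖ ^ 2 * (x ^ 2 + y ^ 2 + z ^ 2) := by
    intro i j k x y z hi hj hk
    have h1 := mul_le_mul_of_nonneg_right hi (add_nonneg (add_nonneg (sq_nonneg x) (sq_nonneg y))
      (sq_nonneg z))
    have h2 := mul_le_mul_of_nonneg_right hj (add_nonneg (add_nonneg (sq_nonneg x) (sq_nonneg y))
      (sq_nonneg z))
    have h3 := mul_le_mul_of_nonneg_right hk (add_nonneg (add_nonneg (sq_nonneg x) (sq_nonneg y))
      (sq_nonneg z))
    nlinarith [sq_nonneg (i * y - j * x), sq_nonneg (i * z - k * x), sq_nonneg (j * z - k * y)]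
  have hm : ∀ j, (-B j) ^ 2 ≤ ‖B‖ ^ 2 := fun j => by rw [neg_sq]; exact hB j
  have h0 := key _ _ _ (w 0) (w 1) (w 3) (hB 0) (hB 2) (hB 3)
  have h1 := key _ _ _ (w 0) (w 2) (w 1) (hB 2) (hm 3) (hB 1)
  have h2 := key _ _ _ (w 2) (w 3) (w 1) (hB 0) (hB 2) (hm 3)
  have h3 := key _ _ _ (w 2) (w 0) (w 3) (hB 2) (hB 3) (hB 1)
  have hq : ∀ i, w i ^ 2 ≤ normSqE w := fun i => by
    unfold normSqE
    fin_cases i <;> simp <;> nlinarith [sq_nonneg (w 0), sq_nonneg (w 1), sq_nonneg (w 2),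
      sq_nonneg (w 3)]
  have hN : normSqE (hermMul B w) = (B 0 * w 0 + B 2 * w 1 + B 3 * w 3) ^ 2
      + (B 2 * w 0 + -B 3 * w 2 + B 1 * w 1) ^ 2 + (B 0 * w 2 + B 2 * w 3 + -B 3 * w 1) ^ 2
      + (B 2 * w 2 + B 3 * w 0 + B 1 * w 3) ^ 2 := by
    simp [normSqE, hermMul]; ring
  have hp : 0 ≤ ‖B‖ ^ 2 := by positivity
  have e : normSqE w = w 0 ^ 2 + w 1 ^ 2 + w 2 ^ 2 + w 3 ^ 2 := rfl
  rw [hN, e]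
  nlinarith [mul_nonneg hp (sq_nonneg (w 0)), mul_nonneg hp (sq_nonneg (w 1)),
    mul_nonneg hp (sq_nonneg (w 2)), mul_nonneg hp (sq_nonneg (w 3))]

lemma hermQ_le_norm (B w : Fin 4 → ℝ) : hermQ B w ≤ 4 * ‖B‖ * normSqE w := by
  have hB : ∀ i, |B i| ≤ ‖B‖ := fun i => norm_le_pi_norm B i
  have h : ∀ (i : Fin 4) (s t : ℝ), |s| ≤ t → B i * s ≤ ‖B‖ * t := fun i s t hst =>
    (le_abs_self _).trans ((abs_mul _ _).trans_le
      (mul_le_mul (hB i) hst (abs_nonneg _) (norm_nonneg _)))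
  have h0 := h 0 (w 0 ^ 2 + w 2 ^ 2) (normSqE w) (by
    rw [abs_of_nonneg (by positivity)]; unfold normSqE; nlinarith [sq_nonneg (w 1), sq_nonneg (w 3)])
  have h1 := h 1 (w 1 ^ 2 + w 3 ^ 2) (normSqE w) (by
    rw [abs_of_nonneg (by positivity)]; unfold normSqE; nlinarith [sq_nonneg (w 0), sq_nonneg (w 2)])
  have h2 := h 2 (2 * (w 0 * w 1 + w 2 * w 3)) (normSqE w) (by
    rw [abs_le]; unfold normSqE
    constructor <;> nlinarith [sq_nonneg (w 0 + w 1), sq_nonneg (w 2 + w 3), sq_nonneg (w 0 - w 1),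
      sq_nonneg (w 2 - w 3)])
  have h3 := h 3 (2 * (w 0 * w 3 - w 1 * w 2)) (normSqE w) (by
    rw [abs_le]; unfold normSqE
    constructor <;> nlinarith [sq_nonneg (w 0 + w 3), sq_nonneg (w 2 + w 1), sq_nonneg (w 0 - w 3),
      sq_nonneg (w 2 - w 1)])
  unfold hermQ
  linarith

lemma hermDet_le_norm_sq (B : Fin 4 → ℝ) : hermDet B ≤ ‖B‖ ^ 2 := by
  have h : B 0 * B 1 ≤ ‖B‖ * ‖B‖ := (le_abs_self _).trans (by
    rw [abs_mul]
    exact mul_le_mul (norm_le_pi_norm B 0) (norm_le_pi_norm B 1) (abs_nonneg _) (norm_nonneg _))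
  unfold hermDet
  nlinarith [sq_nonneg (B 2), sq_nonneg (B 3)]

lemma norm_hermAdj_le (B : Fin 4 → ℝ) : ‖hermAdj B‖ ≤ ‖B‖ := by
  refine (pi_norm_le_iff_of_nonneg (norm_nonneg _)).2 fun i => ?_
  fin_cases i <;> simp only [hermAdj, Fin.isValue, Fin.zero_eta, Fin.mk_one, Fin.reduceFinMk,
    Matrix.cons_val, norm_neg] <;> exact norm_le_pi_norm B _

lemma contDiffAt_hermInv {B : Fin 4 → ℝ} {n : WithTop ℕ∞} (hB : hermDet B ≠ 0) :
    ContDiffAt ℝ n hermInv B := by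
  have h1 : ContDiff ℝ n hermDet := by unfold hermDet; fun_prop
  have h2 : ContDiff ℝ n hermAdj := by
    refine contDiff_pi.2 fun i => ?_
    fin_cases i <;> simp [hermAdj] <;> fun_prop
  exact (h1.contDiffAt.inv hB).smul h2.contDiffAt

lemma hermPair_rankOne_le (p δ : Fin 4 → ℝ) :
    hermPair (rankOne p) (rankOne δ) ≤ normSqE p * normSqE δ := by
  rw [← hermQ_perp]
  refine (hermQ_rankOne_le _ _).trans_eq ?_
  congr 1
  simp [normSqE]; ring

lemma hermPair_rankOne_le_norm (B δ : Fin 4 → ℝ) :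
    hermPair B (rankOne δ) ≤ 4 * ‖B‖ * normSqE δ := by
  rw [← hermQ_perp]
  refine (hermQ_le_norm _ _).trans_eq ?_
  congr 1
  simp [normSqE]; ring

lemma norm_harmMean_le {X Y : Fin 4 → ℝ} {N M : ℝ} (hX0 : 0 < X 0) (hX1 : 0 < X 1)
    (hX : 0 < hermDet X) (hY0 : 0 < Y 0) (hY1 : 0 < Y 1) (hY : 0 < hermDet Y) (hN : ‖X‖ ≤ N)
    (hMX : ‖hermInv X‖ ≤ M) (hMY : ‖hermInv Y‖ ≤ M) : ‖harmMean X Y‖ ≤ 4 * N ^ 2 * M := by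
  have hG := hermDet_mean_hermInv_ge hX0 hX1 hX hY0 hY1 hY
  have hdN : hermDet X ≤ N ^ 2 :=
    (hermDet_le_norm_sq X).trans (pow_le_pow_left₀ (norm_nonneg _) hN 2)
  have hGpos : 0 < hermDet ((1 / 2 : ℝ) • (hermInv X + hermInv Y)) :=
    lt_of_lt_of_le (by positivity) hG
  have h1 : (hermDet ((1 / 2 : ℝ) • (hermInv X + hermInv Y)))⁻¹ ≤ 4 * N ^ 2 := by
    refine (inv_anti₀ (by positivity) hG).trans ?_
    rw [inv_div, div_inv_eq_mul]
    linarith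
  have h2 : ‖(1 / 2 : ℝ) • (hermInv X + hermInv Y)‖ ≤ M := by
    rw [norm_smul]
    have := norm_add_le (hermInv X) (hermInv Y)
    norm_num
    linarith
  rw [harmMean, hermInv, norm_smul, Real.norm_of_nonneg (by positivity)]
  exact mul_le_mul h1 ((norm_hermAdj_le _).trans h2) (norm_nonneg _) (by positivity)

lemma normSqE_harmShift_le (X Y w : Fin 4 → ℝ) :
    normSqE (harmShift X Y w)
      ≤ 36 * ‖hermInv X - hermInv Y‖ ^ 2 * ‖harmMean X Y‖ ^ 2 * normSqE w := by
  rw [harmShift, normSqE_smul]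
  have h1 := normSqE_hermMul_le (hermInv X - hermInv Y) (hermMul (harmMean X Y) w)
  have h2 := mul_le_mul_of_nonneg_left (normSqE_hermMul_le (harmMean X Y) w)
    (show 0 ≤ 12 * ‖hermInv X - hermInv Y‖ ^ 2 by positivity)
  linarith

namespace IsLogSolAt

variable {v : (Fin 4 → ℝ) → ℝ} {Λ : ℝ} {x y : Fin 4 → ℝ}

lemma hermDet_levi_pos (h : IsLogSolAt v Λ x) (hΛ : 0 < Λ) : 0 < hermDet (levi v x) :=
  hΛ.trans_le (h.le_hermDet_levi hΛ)

lemma hermQ_levi_add_harmShift (hx : IsLogSolAt v Λ x) (hy : IsLogSolAt v Λ y) (hΛ : 0 < Λ)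
    (w : Fin 4 → ℝ) :
    hermQ (levi v x) (w + harmShift (levi v x) (levi v y) w)
      + hermQ (levi v y) (w - harmShift (levi v x) (levi v y) w)
      = 2 * hermQ (harmMean (levi v x) (levi v y)) w := by
  have h1 := hx.hermDet_levi_pos hΛ
  have h2 := hermDet_mean_hermInv_ge hx.levi_zero_pos hx.levi_one_pos h1 hy.levi_zero_pos
    hy.levi_one_pos (hy.hermDet_levi_pos hΛ)
  exact hermQ_harmShift h1.ne' (hy.hermDet_levi_pos hΛ).ne'
    (lt_of_lt_of_le (by positivity) h2).ne' w

end IsLogSolAt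

lemma exists_pair_bounds {v : (Fin 4 → ℝ) → ℝ} {Λ : ℝ} (hΛ : 0 < Λ) {Ω E : Set (Fin 4 → ℝ)}
    (hopen : IsOpen Ω) (hv : ∀ x ∈ Ω, IsLogSolAt v Λ x) (hE : IsCompact E) (hEΩ : E ⊆ Ω) :
    ∃ r > 0, ∃ C ≥ 0, ∀ m ∈ E, ∀ e, ‖e‖ ≤ r → m + e ∈ Ω ∧ m - e ∈ Ω ∧
      (∀ w, normSqE (harmShift (levi v (m + e)) (levi v (m - e)) w)
        ≤ C * normSqE e * normSqE w) ∧
      hermDet (harmMean (levi v (m + e)) (levi v (m - e))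
        - rankOne ((1 / 2 : ℝ) • (gradVec v (m + e) + gradVec v (m - e))))
        ≤ Λ + C * normSqE ((1 / 2 : ℝ) • (gradVec v (m + e) - gradVec v (m - e))) := by
  obtain ⟨r, hr, hrΩ⟩ := hE.exists_cthickening_subset_open hopen hEΩ
  set W := Metric.cthickening r E with hW
  have hWc : IsCompact W := hE.cthickening
  have hI : ∀ x ∈ Ω, ContDiffAt ℝ 1 (fun y => hermInv (levi v y)) x := fun x hx =>
    (contDiffAt_hermInv ((hv x hx).hermDet_levi_pos hΛ).ne').comp x
      (contDiffAt_levi (hv x hx).contDiffAt)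
  obtain ⟨N, hN⟩ := hWc.exists_bound_of_continuousOn (f := levi v) fun x hx =>
    (contDiffAt_levi (hv x (hrΩ hx)).contDiffAt).continuousAt.continuousWithinAt
  obtain ⟨M, hM⟩ := hWc.exists_bound_of_continuousOn (f := fun y => hermInv (levi v y))
    fun x hx => (hI x (hrΩ hx)).continuousAt.continuousWithinAt
  obtain ⟨L, hL⟩ := hWc.exists_bound_of_continuousOn
    (f := fderiv ℝ fun y => hermInv (levi v y)) fun x hx =>
    ((hI x (hrΩ hx)).fderiv_right (m := 0) (by norm_num)).continuousAt.continuousWithinAt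
  obtain ⟨P, hP, hb⟩ := exists_bounds_of_isLogSolAt hΛ hWc fun x hx => hv x (hrΩ hx)
  set D := 4 * N ^ 2 * M with hD
  have hball : ∀ m ∈ E, Metric.closedBall m r ⊆ W := fun m hm =>
    Metric.closedBall_subset_cthickening hm r
  refine ⟨r, hr, 144 * L ^ 2 * D ^ 2 + (4 * |D| + D ^ 2 * P / Λ), by positivity,
    fun m hm e he => ?_⟩
  have hxb : m + e ∈ Metric.closedBall m r := by simpa [Metric.mem_closedBall, dist_eq_norm] using he
  have hyb : m - e ∈ Metric.closedBall m r := by simpa [Metric.mem_closedBall, dist_eq_norm] using he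
  have hxW := hball m hm hxb
  have hyW := hball m hm hyb
  have hx := hv _ (hrΩ hxW)
  have hy := hv _ (hrΩ hyW)
  have hHn : ‖harmMean (levi v (m + e)) (levi v (m - e))‖ ≤ D :=
    norm_harmMean_le hx.levi_zero_pos hx.levi_one_pos (hx.hermDet_levi_pos hΛ) hy.levi_zero_pos
      hy.levi_one_pos (hy.hermDet_levi_pos hΛ) (hN _ hxW) (hM _ hxW) (hM _ hyW)
  have hHn2 := pow_le_pow_left₀ (norm_nonneg _) hHn 2
  refine ⟨hrΩ hxW, hrΩ hyW, fun w => ?_, ?_⟩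
  · have h1 := (convex_closedBall m r).norm_image_sub_le_of_norm_fderiv_le (𝕜 := ℝ)
      (fun z hz => (hI z (hrΩ (hball m hm hz))).differentiableAt (by norm_num))
      (fun z hz => hL z (hball m hm hz)) hyb hxb
    have e1 : m + e - (m - e) = (2 : ℝ) • e := by module
    rw [e1, norm_smul, Real.norm_ofNat] at h1
    have h2 := pow_le_pow_left₀ (norm_nonneg _) h1 2
    have h3 := normSqE_harmShift_le (levi v (m + e)) (levi v (m - e)) w
    have hw := normSqE_nonneg w
    have he' := normSqE_nonneg e
    have h4 : ‖hermInv (levi v (m + e)) - hermInv (levi v (m - e))‖ ^ 2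
        ≤ 4 * L ^ 2 * normSqE e := by
      have := mul_le_mul_of_nonneg_left (norm_sq_le_normSqE e) (show 0 ≤ 4 * L ^ 2 by positivity)
      linarith
    have h5 := mul_le_mul_of_nonneg_right (mul_le_mul h4 hHn2 (by positivity) (by positivity)) hw
    have h6 : 0 ≤ (4 * |D| + D ^ 2 * P / Λ) * normSqE e * normSqE w := by positivity
    linarith
  · set δ := (1 / 2 : ℝ) • (gradVec v (m + e) - gradVec v (m - e)) with hδ
    set p := (1 / 2 : ℝ) • (gradVec v (m + e) + gradVec v (m - e)) with hp
    have hpx : p + δ = gradVec v (m + e) := by rw [hp, hδ]; module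
    have hpy : p - δ = gradVec v (m - e) := by rw [hp, hδ]; module
    have h1 := hermDet_harmMean_sub_rankOne_le (p := p) (δ := δ) hΛ hx.levi_zero_pos
      hx.levi_one_pos (hx.hermDet_levi_pos hΛ) hy.levi_zero_pos hy.levi_one_pos
      (hy.hermDet_levi_pos hΛ) (by rw [hpx]; exact hx.det_eq) (by rw [hpy]; exact hy.det_eq)
    have hδ0 := normSqE_nonneg δ
    have hpP : normSqE p ≤ P := by
      have h2 := normSqE_add_add_normSqE_sub p δ
      rw [hpx, hpy] at h2
      linarith [(hb _ hxW).1, (hb _ hyW).1]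
    have h2 := hermPair_rankOne_le_norm (harmMean (levi v (m + e)) (levi v (m - e))) δ
    have h3 : 4 * ‖harmMean (levi v (m + e)) (levi v (m - e))‖ * normSqE δ
        ≤ 4 * |D| * normSqE δ := by
      have := hHn.trans (le_abs_self D)
      gcongr
    have h4 : hermPair (rankOne p) (rankOne δ) ≤ P * normSqE δ :=
      (hermPair_rankOne_le p δ).trans (mul_le_mul_of_nonneg_right hpP hδ0)
    have h5 : 0 ≤ hermPair (rankOne p) (rankOne δ) := by
      rw [← hermQ_perp]; exact hermQ_rankOne_nonneg _ _
    have h6 : hermDet (harmMean (levi v (m + e)) (levi v (m - e)))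
        * hermPair (rankOne p) (rankOne δ) ≤ D ^ 2 * (P * normSqE δ) :=
      mul_le_mul ((hermDet_le_norm_sq _).trans hHn2) h4 h5 (by positivity)
    have h7 := div_le_div_of_nonneg_right h6 hΛ.le
    have h8 : 0 ≤ 144 * L ^ 2 * D ^ 2 * normSqE δ := by positivity
    have h9 : D ^ 2 * (P * normSqE δ) / Λ = D ^ 2 * P / Λ * normSqE δ := by ring
    linarith

lemma hermQ_le_trace {B : Fin 4 → ℝ} (hB : ∀ w, 0 ≤ hermQ B w) (w : Fin 4 → ℝ) :
    hermQ B w ≤ (B 0 + B 1) * normSqE w := by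
  have h := hB ![-w 1, w 0, w 3, -w 2]
  simp [hermQ] at h
  unfold hermQ normSqE
  linarith

lemma fderiv_exp_barrier {θ : (Fin 4 → ℝ) → ℝ} {m : Fin 4 → ℝ} (hθ : ContDiffAt ℝ 2 θ m)
    (ε a b : ℝ) (w : Fin 4 → ℝ) :
    fderiv ℝ (fun y => ε * (Real.exp (-a * θ y) - b)) m w
      = -(ε * Real.exp (-a * θ m) * a) * fderiv ℝ θ m w ∧
    hessForm (fun y => ε * (Real.exp (-a * θ y) - b)) m w
      = ε * Real.exp (-a * θ m) * (a ^ 2 * fderiv ℝ θ m w ^ 2 - a * hessForm θ m w) := by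
  have hexp : ∀ t : ℝ, HasDerivAt (fun t => Real.exp (-a * t)) (-a * Real.exp (-a * t)) t := by
    intro t
    have := ((hasDerivAt_id t).const_mul (-a)).exp
    exact this.congr_deriv (by simp; ring)
  have hg : ∀ t, HasDerivAt (fun t => ε * (Real.exp (-a * t) - b))
      (-(ε * a) * Real.exp (-a * t)) t := fun t =>
    (((hexp t).sub_const _).const_mul ε).congr_deriv (by ring)
  have hg' : HasDerivAt (fun t => -(ε * a) * Real.exp (-a * t))
      (ε * a ^ 2 * Real.exp (-a * θ m)) (θ m) :=
    ((hexp _).const_mul _).congr_deriv (by ring)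
  constructor
  · rw [fderiv_comp_real (hθ.differentiableAt (by norm_num)) (hg _), smul_apply, smul_eq_mul]
    ring
  · rw [hessForm_comp_real hθ hg hg']
    ring

/-- The barrier-corrected second difference of a solution has no interior minimum at which the
correction is effective. -/
lemma not_isLocalMin_second_difference {v θ : (Fin 4 → ℝ) → ℝ} {Λ : ℝ} {m e : Fin 4 → ℝ}
    {ε a b K μ τ T P C : ℝ} (hΛ : 0 < Λ) (hm : IsLogSolAt v Λ m) (hx : IsLogSolAt v Λ (m + e))
    (hy : IsLogSolAt v Λ (m - e)) (hθ : ContDiffAt ℝ 2 θ m)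
    (hθv : ∀ w, hessForm θ m w = hessForm v m w)
    (hM : ∀ w, μ * normSqE w ≤ hermQ (levi v m - rankOne (gradVec v m)) w)
    (hMT : (levi v m - rankOne (gradVec v m)) 0 + (levi v m - rankOne (gradVec v m)) 1 ≤ T)
    (hμ : 0 < μ) (hp : normSqE (gradVec v m) ≤ P) (hΘ : normSqE (gradVec θ m) ≤ P)
    (hτ : τ ≤ normSqE (gradVec θ m)) (hC : 0 ≤ C)
    (hshift : ∀ w, normSqE (harmShift (levi v (m + e)) (levi v (m - e)) w)
      ≤ C * normSqE e * normSqE w)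
    (hdet : hermDet (harmMean (levi v (m + e)) (levi v (m - e))
        - rankOne ((1 / 2 : ℝ) • (gradVec v (m + e) + gradVec v (m - e))))
        ≤ Λ + C * normSqE ((1 / 2 : ℝ) • (gradVec v (m + e) - gradVec v (m - e))))
    (ha : 0 ≤ a) (haτ : C + (T + 5 * P + 16 * C + 2 * P) * (a / 2 + 1) * T
      < (a / 2) ^ 2 * μ * τ / 4)
    (hε : 0 < ε) (hb : 0 ≤ b) (he : 0 < normSqE e) (hK : 0 ≤ K)
    (hKφ : K * normSqE e ≤ ε * (Real.exp (-a * θ m) - b))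
    (hφ1 : ε * (Real.exp (-a * θ m) - b) ≤ 1)
    (hκ1 : ε * Real.exp (-a * θ m) * normSqE e ≤ 1 / 2)
    (hκ : ε * Real.exp (-a * θ m) * normSqE e * ((T + 5 * P + 16 * C + 2 * P) * (a / 2 + 1))
      ≤ μ / 2) :
    ¬ IsLocalMin (fun z : (Fin 4 → ℝ) × (Fin 4 → ℝ) => v (z.1 + z.2) + v (z.1 - z.2) - 2 * v z.1
        + (-(ε * (Real.exp (-a * θ z.1) - b)) * normSqE z.2 + K * normSqE z.2 ^ 2)) (m, e) := by
  intro hmin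
  set φ : (Fin 4 → ℝ) → ℝ := fun y => ε * (Real.exp (-a * θ y) - b) with hφdef
  have hφ : ContDiffAt ℝ 2 φ m :=
    contDiffAt_const.mul (((contDiffAt_const.mul hθ).exp).sub contDiffAt_const)
  have htest := second_difference_derivative_test hx.contDiffAt_two hy.contDiffAt_two
    hm.contDiffAt_two hφ hmin
  set F := ε * Real.exp (-a * θ m) with hF
  have hF0 : 0 < F := by positivity
  set κ := F * normSqE e with hκdef
  have hκ0 : 0 < κ := by positivity
  have hφm : K * normSqE e ≤ φ m := hKφ
  have hφm1 : φ m ≤ 1 := hφ1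
  have hφF : φ m ≤ F := by
    have : φ m = F - ε * b := by rw [hF]; simp only [hφdef]; ring
    nlinarith [mul_nonneg hε.le hb]
  have hKe : 0 ≤ K * normSqE e := by positivity
  set p := gradVec v m with hpdef
  set Θ := gradVec θ m with hΘdef
  have hsum : (1 / 2 : ℝ) • (gradVec v (m + e) + gradVec v (m - e)) = p - (κ * (a / 2)) • Θ := by
    ext i
    have h := (htest (Pi.single i 1) 0).1
    rw [(fderiv_exp_barrier hθ ε a b _).1, ← hF] at h
    simp [dotE] at h
    simp only [Pi.smul_apply, Pi.add_apply, Pi.sub_apply, smul_eq_mul, hpdef, hΘdef, gradVec, pd,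
      hκdef]
    linarith
  have hdiff : (1 / 2 : ℝ) • (gradVec v (m + e) - gradVec v (m - e))
      = (φ m - 2 * (K * normSqE e)) • e := by
    ext i
    have h := (htest 0 (Pi.single i 1)).1
    have h1 : dotE e (Pi.single i 1) = e i := by fin_cases i <;> simp [dotE]
    rw [h1] at h
    simp at h
    simp only [Pi.smul_apply, Pi.sub_apply, smul_eq_mul, gradVec, pd]
    linarith
  have hδ : normSqE ((1 / 2 : ℝ) • (gradVec v (m + e) - gradVec v (m - e))) ≤ κ := by
    rw [hdiff, normSqE_smul]
    have : (φ m - 2 * (K * normSqE e)) ^ 2 ≤ F := by nlinarith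
    exact mul_le_mul_of_nonneg_right this he.le
  set X := levi v (m + e) with hX
  set Y := levi v (m - e) with hY
  have hcross : ∀ ξ, fderiv ℝ θ m ξ * dotE e (harmShift X Y ξ)
      ≤ (P + C) / 2 * (normSqE e * normSqE ξ) := by
    intro ξ
    have h1 := dotE_sq_le Θ ξ
    rw [dotE_gradVec] at h1
    have h2 := mul_le_mul_of_nonneg_right hΘ (normSqE_nonneg ξ)
    have h3 := dotE_sq_le e (harmShift X Y ξ)
    have h4 := mul_le_mul_of_nonneg_left (hshift ξ) he.le
    have h5 := mul_le_mul_of_nonneg_left (h1.trans h2) (sq_nonneg (normSqE e))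
    have h6 := sq_nonneg (normSqE e * fderiv ℝ θ m ξ - dotE e (harmShift X Y ξ))
    refine le_of_mul_le_mul_left ?_ he
    linarith
  have hsecond : ∀ ξ, 2 * hessForm v m ξ + κ * (a ^ 2 * fderiv ℝ θ m ξ ^ 2 - a * hessForm v m ξ
      - (2 * a * (P + C) + 12 * C) * normSqE ξ)
      ≤ hessForm v (m + e) (ξ + harmShift X Y ξ) + hessForm v (m - e) (ξ - harmShift X Y ξ) := by
    intro ξ
    have h := (htest ξ (harmShift X Y ξ)).2
    rw [(fderiv_exp_barrier hθ ε a b _).1, (fderiv_exp_barrier hθ ε a b _).2, ← hF, hθv] at h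
    have h1 := mul_le_mul_of_nonneg_left (hcross ξ) (show 0 ≤ 4 * (F * a) by positivity)
    have h2 := dotE_sq_le e (harmShift X Y ξ)
    have h3 := mul_le_mul_of_nonneg_left h2 (show 0 ≤ 8 * K by positivity)
    have h4 := mul_le_mul_of_nonneg_right (hφm.trans hφF) (normSqE_nonneg (harmShift X Y ξ))
    have h5 := mul_le_mul_of_nonneg_left (hshift ξ) hF0.le
    have h6 := mul_nonneg (hKe.trans hφm) (normSqE_nonneg (harmShift X Y ξ))
    rw [hκdef]
    linarith
  have hMp : levi v m = (levi v m - rankOne p) + rankOne p := by abel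
  have hup : ∀ w, hermQ (levi v m) w ≤ (T + P) * normSqE w := by
    intro w
    have h1 := hermQ_le_trace (fun w => (mul_nonneg hμ.le (normSqE_nonneg w)).trans (hM w)) w
    have h2 := mul_le_mul_of_nonneg_right hMT (normSqE_nonneg w)
    have h3 := hermQ_rankOne_le p w
    have h4 := mul_le_mul_of_nonneg_right hp (normSqE_nonneg w)
    rw [hMp, hermQ_add]
    linarith
  have hP : 0 ≤ P := (normSqE_nonneg p).trans hp
  have hT : 0 ≤ T := by
    have := hM ![1, 0, 0, 0]
    have h' := hM ![0, 1, 0, 0]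
    simp only [hermQ, normSqE] at this h'
    simp at this h' hMT
    linarith
  have hH : ∀ w, hermQ (levi v m - rankOne p + rankOne p) w + κ * ((a / 2) ^ 2
      * hermQ (rankOne Θ) w - (T + 5 * P + 16 * C) * (a / 2 + 1) * normSqE w)
      ≤ hermQ (harmMean X Y) w := by
    intro w
    have h1 := hsecond w
    have h2 := hsecond (rotJ w)
    rw [harmShift_rotJ, ← rotJ_add, ← rotJ_sub, normSqE_rotJ] at h2
    have h3 := hx.hermQ_levi_add_harmShift hy hΛ w
    rw [hermQ_levi hx.contDiffAt_two, hermQ_levi hy.contDiffAt_two] at h3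
    have h4 := hermQ_levi hm.contDiffAt_two w
    have h5 := hermQ_rankOne Θ w
    rw [dotE_gradVec, dotE_gradVec] at h5
    have h6 := mul_le_mul_of_nonneg_left (hup w) (show 0 ≤ κ * a by positivity)
    have h7 := mul_nonneg hκ0.le (mul_nonneg (sq_nonneg a) (hermQ_rankOne_nonneg Θ w))
    have h8 : 0 ≤ κ * ((T + 5 * P + 4 * C) * normSqE w) := by
      have := normSqE_nonneg w
      positivity
    have h9 : 0 ≤ κ * (a * (12 * C) * normSqE w) := by
      have := normSqE_nonneg w
      positivity
    rw [← hMp, h5]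
    rw [h5] at h7
    rw [h4] at h6 ⊢
    simp only [hX, hY] at h3 ⊢
    linarith
  have key := (hermDet_barrier_lt (M := levi v m - rankOne p) (C' := C) hm.det_eq hM hMT hμ hp hΘ
    hτ (by positivity) hH (by positivity) haτ hκ0 hκ1 hκ).2
  rw [hsum] at hdet
  have := mul_le_mul_of_nonneg_left hδ hC
  linarith

lemma add_fderiv_add_le {f : (Fin 4 → ℝ) → ℝ} {x w : Fin 4 → ℝ} {c : ℝ}
    (hf : ∀ t ∈ Set.Icc (0 : ℝ) 1, ContDiffAt ℝ 2 f (x + t • w))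
    (hc : ∀ t ∈ Set.Icc (0 : ℝ) 1, 2 * c ≤ hessForm f (x + t • w) w) :
    f x + fderiv ℝ f x w + c ≤ f (x + w) := by
  have hshift : ∀ t s : ℝ, x + t • w + (s - t) • w = x + s • w := fun t s => by module
  have h1 : ∀ t ∈ Set.Icc (0 : ℝ) 1, HasDerivAt (fun s : ℝ => f (x + s • w))
      (fderiv ℝ f (x + t • w) w) t := by
    intro t ht
    have h : HasDerivAt (fun s : ℝ => f (x + t • w + s • w)) (fderiv ℝ f (x + t • w) w) (t - t) := by
      simpa using ((hf t ht).hasDerivAt_line w).self_of_nhds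
    simpa [hshift] using h.comp_sub_const t t
  have h2 : ∀ t ∈ Set.Icc (0 : ℝ) 1, HasDerivAt (fun s : ℝ => fderiv ℝ f (x + s • w) w)
      (hessForm f (x + t • w) w) t := by
    intro t ht
    have h : HasDerivAt (fun s : ℝ => fderiv ℝ f (x + t • w + s • w) w)
        (hessForm f (x + t • w) w) (t - t) := by
      simpa using (hf t ht).hasDerivAt_fderiv_line w
    simpa [hshift] using h.comp_sub_const t t
  set g' : ℝ → ℝ := fun t => fderiv ℝ f (x + t • w) w - (2 * c) * t - fderiv ℝ f x w with hg'
  have hg'd : ∀ t ∈ Set.Icc (0 : ℝ) 1, HasDerivAt g' (hessForm f (x + t • w) w - 2 * c) t :=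
    fun t ht => (((h2 t ht).sub ((hasDerivAt_id t).const_mul (2 * c))).sub_const _).congr_deriv
      (by simp)
  have hmono' : MonotoneOn g' (Set.Icc 0 1) := by
    refine monotoneOn_of_deriv_nonneg (convex_Icc 0 1)
      (fun t ht => (hg'd t ht).continuousAt.continuousWithinAt)
      (fun t ht => (hg'd t (interior_subset ht)).differentiableAt.differentiableWithinAt)
      fun t ht => ?_
    rw [(hg'd t (interior_subset ht)).deriv]
    linarith [hc t (interior_subset ht)]
  set g : ℝ → ℝ := fun t => f (x + t • w) - c * t ^ 2 - t * fderiv ℝ f x w with hg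
  have hgd : ∀ t ∈ Set.Icc (0 : ℝ) 1, HasDerivAt g (g' t) t := fun t ht =>
    (((h1 t ht).sub (((hasDerivAt_id t).pow 2).const_mul c)).sub
      ((hasDerivAt_id t).mul_const _)).congr_deriv (by simp [hg']; ring)
  have hmono : MonotoneOn g (Set.Icc 0 1) := by
    refine monotoneOn_of_deriv_nonneg (convex_Icc 0 1)
      (fun t ht => (hgd t ht).continuousAt.continuousWithinAt)
      (fun t ht => (hgd t (interior_subset ht)).differentiableAt.differentiableWithinAt)
      fun t ht => ?_
    have ht' := interior_subset ht
    rw [(hgd t ht').deriv]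
    have := hmono' (Set.left_mem_Icc.2 zero_le_one) ht' ht'.1
    simpa [hg'] using this
  have := hmono (Set.left_mem_Icc.2 zero_le_one) (Set.right_mem_Icc.2 zero_le_one) zero_le_one
  simp [hg] at this
  linarith

lemma hessForm_nonneg_of_midpoint_convex {v : (Fin 4 → ℝ) → ℝ} {x : Fin 4 → ℝ}
    (hv : ContDiffAt ℝ 2 v x)
    (hmid : ∀ᶠ z : (Fin 4 → ℝ) × (Fin 4 → ℝ) in nhds (x, 0),
      2 * v z.1 ≤ v (z.1 + z.2) + v (z.1 - z.2)) (w : Fin 4 → ℝ) : 0 ≤ hessForm v x w := by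
  have h := (second_difference_derivative_test (v := v) (φ := fun _ => 0) (m := x) (e := 0) (K := 0)
    (by simpa using hv) (by simpa using hv) hv contDiffAt_const (by
      filter_upwards [hmid] with z hz
      simp
      linarith) 0 w).2
  simp [hessForm, dotE] at h
  simpa [hessForm] using h

namespace IsEigenfunction

variable {Ω : Set (Fin 4 → ℝ)} {u : (Fin 4 → ℝ) → ℝ} {Λ : ℝ}

lemma exists_quadratic_min (hu : IsEigenfunction Ω u Λ) (hopen : IsOpen Ω)
    (hbd : Bornology.IsBounded Ω) (hne : Ω.Nonempty) :
    ∃ x₁ ∈ Ω, ∃ L : (Fin 4 → ℝ) →L[ℝ] ℝ, ∀ x ∈ Ω,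
      -Real.log (-(u x₁) / 4) - L x₁ + normSqE (x - x₁) ≤ -Real.log (-(u x) / 4) - L x := by
  obtain ⟨x₀, hx₀⟩ := hne
  obtain ⟨x₁, hx₁, hmax⟩ := hbd.isCompact_closure.exists_isMaxOn ⟨x₀, subset_closure hx₀⟩
    (f := fun x => -u x * Real.exp (normSqE x))
    (hu.continuousOn.neg.mul (continuous_normSqE.rexp.continuousOn))
  have hmax' : ∀ x ∈ Ω, -u x * Real.exp (normSqE x) ≤ -u x₁ * Real.exp (normSqE x₁) :=
    fun x hx => hmax (subset_closure hx)
  have hneg : u x₁ < 0 := by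
    have h1 := hmax' x₀ hx₀
    have h2 := mul_pos (neg_pos.2 (hu.neg x₀ hx₀)) (Real.exp_pos (normSqE x₀))
    have := pos_of_mul_pos_left (h2.trans_le h1) (Real.exp_pos _).le
    linarith
  refine ⟨x₁, (nonpos_of_mem_closure hopen hu.neg hu.boundary hx₁).2 hneg,
    fderiv ℝ (fun y => normSqE (y - 0)) x₁, fun x hx => ?_⟩
  have h1 := Real.log_le_log (mul_pos (neg_pos.2 (hu.neg x hx)) (Real.exp_pos (normSqE x)))
    (hmax' x hx)
  rw [Real.log_mul (neg_pos.2 (hu.neg x hx)).ne' (Real.exp_pos _).ne', Real.log_exp,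
    Real.log_mul (neg_pos.2 hneg).ne' (Real.exp_pos _).ne', Real.log_exp] at h1
  rw [Real.log_div (neg_pos.2 (hu.neg x hx)).ne' (by norm_num),
    Real.log_div (neg_pos.2 hneg).ne' (by norm_num), fderiv_normSqE_sub, fderiv_normSqE_sub]
  simp only [normSqE, dotE, Pi.sub_apply, Pi.zero_apply] at h1 ⊢
  linarith

lemma isCompact_sublevel (hu : IsEigenfunction Ω u Λ) (hopen : IsOpen Ω)
    (hbd : Bornology.IsBounded Ω) (L : (Fin 4 → ℝ) →L[ℝ] ℝ) (t : ℝ) :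
    IsCompact {x | x ∈ Ω ∧ -Real.log (-(u x) / 4) - L x ≤ t} := by
  have h : {x | x ∈ Ω ∧ -Real.log (-(u x) / 4) - L x ≤ t}
      = closure Ω ∩ (fun x => 4 * Real.exp (-t - L x) + u x) ⁻¹' Set.Iic 0 := by
    ext x
    simp only [Set.mem_ofPred_eq, Set.mem_inter_iff, Set.mem_preimage, Set.mem_Iic]
    have key : u x < 0 → (-Real.log (-(u x) / 4) - L x ≤ t ↔ 4 * Real.exp (-t - L x) + u x ≤ 0) :=
      fun hx => by
        have h1 := Real.le_log_iff_exp_le (x := -t - L x) (show 0 < -u x / 4 by linarith)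
        constructor
        · intro h2
          have := h1.1 (by linarith)
          linarith
        · intro h2
          have := h1.2 (by linarith)
          linarith
    constructor
    · rintro ⟨hx, h2⟩
      exact ⟨subset_closure hx, (key (hu.neg x hx)).1 h2⟩
    · rintro ⟨hx, h2⟩
      have hneg : u x < 0 := by linarith [Real.exp_pos (-t - L x)]
      exact ⟨(nonpos_of_mem_closure hopen hu.neg hu.boundary hx).2 hneg, (key hneg).2 h2⟩
  rw [h]
  refine hbd.isCompact_closure.of_isClosed_subset ?_ Set.inter_subset_left
  exact ContinuousOn.preimage_isClosed_of_isClosed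
    ((continuous_const.mul (continuous_const.sub L.continuous).rexp).continuousOn.add
      hu.continuousOn) isClosed_closure isClosed_Iic

end IsEigenfunction

lemma ContinuousAt.eventually_norm_sub_lt {X F : Type*} [TopologicalSpace X]
    [SeminormedAddCommGroup F] {f : X → F} {x : X} (hf : ContinuousAt f x) {ε : ℝ} (hε : 0 < ε) :
    ∀ᶠ z in nhds x, ‖f z - f x‖ < ε :=
  (hf.sub continuousAt_const).norm.tendsto.eventually (gt_mem_nhds (by simpa))

section AffinePerturbation

variable {v : (Fin 4 → ℝ) → ℝ} {x x₁ : Fin 4 → ℝ} (L : (Fin 4 → ℝ) →L[ℝ] ℝ)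

lemma ContDiffAt.sub_clm {n : WithTop ℕ∞} (hv : ContDiffAt ℝ n v x) :
    ContDiffAt ℝ n (fun y => v y - L y) x :=
  hv.sub L.contDiff.contDiffAt

lemma hessForm_sub_clm (hv : ContDiffAt ℝ 2 v x) (w : Fin 4 → ℝ) :
    hessForm (fun y => v y - L y) x w = hessForm v x w := by
  have h := hessForm_add hv (-L).contDiff.contDiffAt w
  have h0 : hessForm (fun y => (-L) y) x w = 0 := by
    have : fderiv ℝ (fun y => (-L) y) = fun _ => -L := by
      ext1 y
      exact (-L).fderiv
    unfold hessForm
    rw [this]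
    simp
  have e : (fun y => v y + (-L) y) = fun y => v y - L y := by
    ext y
    simp [sub_eq_add_neg]
  rw [e] at h
  rw [h, h0, add_zero]

variable {L}

/-- Near a point of quadratic growth, second differences are bounded below. -/
lemma exists_normSqE_le_second_difference {Ω : Set (Fin 4 → ℝ)} (hopen : IsOpen Ω)
    (hv : ∀ x ∈ Ω, ContDiffAt ℝ 2 v x) (hx₁ : x₁ ∈ Ω)
    (hmin : ∀ x ∈ Ω, v x₁ - L x₁ + normSqE (x - x₁) ≤ v x - L x) :
    ∃ ρ > 0, ∀ m e, ‖m - x₁‖ < ρ → ‖e‖ ≤ ρ →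
      normSqE e ≤ v (m + e) + v (m - e) - 2 * v m := by
  have hhess : ∀ w, 2 * normSqE w ≤ hessForm v x₁ w := by
    intro w
    have hθ := (hv x₁ hx₁).sub_clm L
    have h1 : ∀ᶠ t in nhds (0 : ℝ), HasDerivAt
        (fun t : ℝ => (v (x₁ + t • w) - L (x₁ + t • w)) - normSqE w * t ^ 2)
        (fderiv ℝ (fun y => v y - L y) (x₁ + t • w) w - normSqE w * (2 * t)) t := by
      filter_upwards [hθ.hasDerivAt_line w] with t ht
      exact (ht.sub (((hasDerivAt_id t).pow 2).const_mul (normSqE w))).congr_deriv (by simp)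
    have h2 : HasDerivAt
        (fun t : ℝ => fderiv ℝ (fun y => v y - L y) (x₁ + t • w) w - normSqE w * (2 * t))
        (hessForm v x₁ w - normSqE w * 2) 0 := by
      rw [← hessForm_sub_clm L (hv x₁ hx₁)]
      exact ((hθ.hasDerivAt_fderiv_line w).sub
        (((hasDerivAt_id (0 : ℝ)).const_mul 2).const_mul (normSqE w))).congr_deriv (by simp)
    have hmin' : IsLocalMin
        (fun t : ℝ => (v (x₁ + t • w) - L (x₁ + t • w)) - normSqE w * t ^ 2) 0 := by
      have hc : Continuous fun t : ℝ => x₁ + t • w := by fun_prop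
      have hΩ : Ω ∈ nhds (x₁ + (0 : ℝ) • w) := by simpa using hopen.mem_nhds hx₁
      filter_upwards [(hc.tendsto 0).eventually hΩ] with t ht
      have h := hmin _ ht
      rw [add_sub_cancel_left, normSqE_smul] at h
      simp only [zero_smul, add_zero]
      linarith
    linarith [(second_derivative_test hmin' h1 h2).2]
  have hcont : ContinuousAt (fderiv ℝ (fderiv ℝ v)) x₁ :=
    (((hv x₁ hx₁).fderiv_right (m := 1) (by norm_num)).fderiv_right (m := 0)
      (by norm_num)).continuousAt
  have hΩ₁ : ∀ᶠ z in nhds x₁, z ∈ Ω := hopen.mem_nhds hx₁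
  have hd₁ : ∀ᶠ z in nhds x₁, ‖fderiv ℝ (fderiv ℝ v) z - fderiv ℝ (fderiv ℝ v) x₁‖ < 1 :=
    ContinuousAt.eventually_norm_sub_lt (F := (Fin 4 → ℝ) →L[ℝ] (Fin 4 → ℝ) →L[ℝ] ℝ) hcont one_pos
  obtain ⟨ρ, hρ, hball⟩ := Metric.eventually_nhds_iff_ball.1 (hΩ₁.and hd₁)
  have hlow : ∀ z ∈ Metric.ball x₁ ρ, ∀ w, normSqE w ≤ hessForm v z w := by
    intro z hz w
    have h1 := (hball z hz).2
    have h2 : |hessForm v z w - hessForm v x₁ w|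
        ≤ ‖fderiv ℝ (fderiv ℝ v) z - fderiv ℝ (fderiv ℝ v) x₁‖ * normSqE w := by
      have h3 := (fderiv ℝ (fderiv ℝ v) z - fderiv ℝ (fderiv ℝ v) x₁).le_opNorm₂ w w
      have h4 := mul_le_mul_of_nonneg_left (norm_sq_le_normSqE w)
        (norm_nonneg (fderiv ℝ (fderiv ℝ v) z - fderiv ℝ (fderiv ℝ v) x₁))
      simp only [sub_apply, Real.norm_eq_abs] at h3
      unfold hessForm
      refine h3.trans ?_
      linarith
    have h5 := mul_le_mul_of_nonneg_right h1.le (normSqE_nonneg w)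
    linarith [(abs_le.1 h2).1, hhess w]
  refine ⟨ρ / 2, by positivity, fun m e hm he => ?_⟩
  have hseg : ∀ f : Fin 4 → ℝ, ‖f‖ ≤ ρ / 2 → v m + fderiv ℝ v m f + normSqE f / 2 ≤ v (m + f) := by
    intro f hf
    have hz : ∀ t ∈ Set.Icc (0 : ℝ) 1, m + t • f ∈ Metric.ball x₁ ρ := by
      intro t ht
      rw [Metric.mem_ball, dist_eq_norm]
      have e1 : m + t • f - x₁ = (m - x₁) + t • f := by abel
      rw [e1]
      refine (norm_add_le _ _).trans_lt ?_
      rw [norm_smul, Real.norm_of_nonneg ht.1]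
      have := mul_le_mul_of_nonneg_right ht.2 (norm_nonneg f)
      linarith
    refine add_fderiv_add_le (fun t ht => hv _ (hball _ (hz t ht)).1) fun t ht => ?_
    linarith [hlow _ (hz t ht) f]
  have h1 := hseg e he
  have h2 := hseg (-e) (by rwa [norm_neg])
  have h3 : normSqE (-e) = normSqE e := by simp [normSqE]
  have h4 : m + -e = m - e := (sub_eq_add_neg m e).symm
  rw [map_neg, h3, h4] at h2
  linarith

lemma normSqE_sub_le_normSqE_gradVec {Ω : Set (Fin 4 → ℝ)} (hconv : Convex ℝ Ω)
    (hv : ∀ x ∈ Ω, ContDiffAt ℝ 2 v x) (hhess : ∀ x ∈ Ω, ∀ w, 0 ≤ hessForm v x w) (hx₁ : x₁ ∈ Ω)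
    (hmin : ∀ x ∈ Ω, v x₁ - L x₁ + normSqE (x - x₁) ≤ v x - L x) (hx : x ∈ Ω) :
    normSqE (x - x₁) ≤ normSqE (gradVec (fun y => v y - L y) x) := by
  have hseg : ∀ t ∈ Set.Icc (0 : ℝ) 1, x + t • (x₁ - x) ∈ Ω := fun t ht =>
    hconv.add_smul_sub_mem hx hx₁ ht
  have h := add_fderiv_add_le (f := fun y => v y - L y) (w := x₁ - x) (c := 0)
    (fun t ht => (hv _ (hseg t ht)).sub_clm L) fun t ht => by
      rw [hessForm_sub_clm L (hv _ (hseg t ht))]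
      simpa using hhess _ (hseg t ht) _
  rw [add_sub_cancel, ← dotE_gradVec] at h
  have h1 := dotE_sq_le (gradVec (fun y => v y - L y) x) (x₁ - x)
  have h2 : normSqE (x₁ - x) = normSqE (x - x₁) := by simp [normSqE]; ring
  have h3 := hmin x hx
  have h0 := normSqE_nonneg (x - x₁)
  rw [h2] at h1
  by_contra! hlt
  have h4 : normSqE (x - x₁) ≤ -dotE (gradVec (fun y => v y - L y) x) (x₁ - x) := by linarith
  have h5 := normSqE_nonneg (gradVec (fun y => v y - L y) x)
  nlinarith

end AffinePerturbation

lemma exists_barrier_exponent {μτ : ℝ} (hμτ : 0 < μτ) {C D : ℝ} (hC : 0 ≤ C) (hD : 0 ≤ D) :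
    ∃ a > 0, C + D * (a / 2 + 1) < (a / 2) ^ 2 * μτ / 4 := by
  set A := 1 + 4 * (C + 2 * D) / μτ with hA
  have h0 : 0 ≤ 4 * (C + 2 * D) / μτ := by positivity
  have h1 : 4 * (C + 2 * D) < A * μτ := by
    rw [hA, add_mul, div_mul_cancel₀ _ hμτ.ne']
    linarith
  have hA1 : 1 ≤ A := by linarith
  refine ⟨2 * A, by linarith, ?_⟩
  have h2 : C ≤ C * A := le_mul_of_one_le_right hC hA1
  have h3 : D ≤ D * A := le_mul_of_one_le_right hD hA1
  have h4 := mul_lt_mul_of_pos_left h1 (show 0 < A by linarith)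
  have e : 2 * A / 2 = A := by ring
  rw [e]
  linarith

set_option maxHeartbeats 1000000 in
/-- A convex solution of the logarithmic equation that grows quadratically above an affine function
and has compact sublevel sets has positive definite Hessian. -/
theorem hessForm_pos_of_convex {Ω : Set (Fin 4 → ℝ)} {v : (Fin 4 → ℝ) → ℝ} {Λ : ℝ} (hΛ : 0 < Λ)
    (hopen : IsOpen Ω) (hconv : Convex ℝ Ω) (hv : ∀ x ∈ Ω, IsLogSolAt v Λ x)
    (hmid : ∀ m e, m + e ∈ Ω → m - e ∈ Ω → 2 * v m ≤ v (m + e) + v (m - e)) {x₁ : Fin 4 → ℝ}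
    (hx₁ : x₁ ∈ Ω) {L : (Fin 4 → ℝ) →L[ℝ] ℝ}
    (hmin : ∀ x ∈ Ω, v x₁ - L x₁ + normSqE (x - x₁) ≤ v x - L x)
    (hcpt : ∀ t, IsCompact {x | x ∈ Ω ∧ v x - L x ≤ t}) {x₀ : Fin 4 → ℝ} (hx₀ : x₀ ∈ Ω)
    {w : Fin 4 → ℝ} (hw : w ≠ 0) : 0 < hessForm v x₀ w := by
  have hv2 : ∀ x ∈ Ω, ContDiffAt ℝ 2 v x := fun x hx => (hv x hx).contDiffAt_two
  have hhess : ∀ x ∈ Ω, ∀ w, 0 ≤ hessForm v x w := by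
    intro x hx
    refine hessForm_nonneg_of_midpoint_convex (hv2 x hx) ?_
    have hc1 : Continuous fun z : (Fin 4 → ℝ) × (Fin 4 → ℝ) => z.1 + z.2 := by fun_prop
    have hc2 : Continuous fun z : (Fin 4 → ℝ) × (Fin 4 → ℝ) => z.1 - z.2 := by fun_prop
    filter_upwards [(hc1.tendsto (x, 0)).eventually (hopen.mem_nhds (by simpa using hx)),
      (hc2.tendsto (x, 0)).eventually (hopen.mem_nhds (by simpa using hx))] with z h1 h2
    exact hmid _ _ h1 h2
  obtain ⟨ρ, hρ, hnear⟩ := exists_normSqE_le_second_difference hopen hv2 hx₁ hmin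
  set θ : (Fin 4 → ℝ) → ℝ := fun y => v y - L y with hθ
  have hθ2 : ∀ x ∈ Ω, ContDiffAt ℝ 2 θ x := fun x hx => (hv2 x hx).sub_clm L
  set t := θ x₀ + 1 with ht
  set E : Set (Fin 4 → ℝ) := {x | x ∈ Ω ∧ θ x ≤ t} with hE
  have hEc : IsCompact E := hcpt t
  have hEΩ : E ⊆ Ω := fun x hx => hx.1
  obtain ⟨r₀, hr₀, C, hC, hpair⟩ := exists_pair_bounds hΛ hopen hv hEc hEΩ
  obtain ⟨T, hT, hb⟩ := exists_bounds_of_isLogSolAt hΛ hEc fun m hm => hv m hm.1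
  obtain ⟨Q, hQ⟩ := hEc.exists_bound_of_continuousOn (f := fun m => normSqE (gradVec θ m))
    fun m hm => (continuous_normSqE.continuousAt.comp (contDiffAt_gradVec
      ((hv m hm.1).contDiffAt.sub_clm L)).continuousAt).continuousWithinAt
  set P := T + |Q| with hP
  have hP0 : 0 ≤ P := by positivity
  set μ := Λ / T with hμ
  have hμ0 : 0 < μ := by positivity
  obtain ⟨a, ha, haτ⟩ := exists_barrier_exponent (show 0 < μ * ρ ^ 2 by positivity) hC
    (show 0 ≤ (T + 5 * P + 16 * C + 2 * P) * T by positivity)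
  set D := (T + 5 * P + 16 * C + 2 * P) * (a / 2 + 1) with hD
  have hD0 : 0 < D := by positivity
  set r := min r₀ (min ρ 1) with hr
  have hr0 : 0 < r := by positivity
  have hrr₀ : r ≤ r₀ := min_le_left _ _
  have hrρ : r ≤ ρ := (min_le_right _ _).trans (min_le_left _ _)
  have hr1 : r ≤ 1 := (min_le_right _ _).trans (min_le_right _ _)
  set η := min (1 / 2) (μ / 2 / D) with hη
  have hη0 : 0 < η := by positivity
  have hη1 : η ≤ 1 / 2 := min_le_left _ _
  have hη2 : η * D ≤ μ / 2 := (le_div_iff₀ hD0).1 (min_le_right _ _)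
  set ε := η / Real.exp (-a * θ x₁) with hε
  have hε0 : 0 < ε := by positivity
  have hεη : ∀ x ∈ Ω, ε * Real.exp (-a * θ x) ≤ η := by
    intro x hx
    have h1 : θ x₁ ≤ θ x := by linarith [hmin x hx, normSqE_nonneg (x - x₁)]
    have h2 : Real.exp (-a * θ x) ≤ Real.exp (-a * θ x₁) := Real.exp_le_exp.2 (by nlinarith)
    rw [hε, div_mul_eq_mul_div, div_le_iff₀ (Real.exp_pos _)]
    exact mul_le_mul_of_nonneg_left h2 hη0.le
  set b := Real.exp (-a * t) with hb'
  have hb0 : 0 < b := Real.exp_pos _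
  set φ : (Fin 4 → ℝ) → ℝ := fun y => ε * (Real.exp (-a * θ y) - b) with hφ
  have hφη : ∀ x ∈ Ω, φ x < η := fun x hx => by
    have h1 := hεη x hx
    have h2 : φ x = ε * Real.exp (-a * θ x) - ε * b := by simp only [hφ]; ring
    have := mul_pos hε0 hb0
    linarith
  have hφpos : ∀ x, 0 < φ x → θ x < t := by
    intro x hx
    have h1 : b < Real.exp (-a * θ x) := by
      have := (mul_pos_iff_of_pos_left hε0).1 hx
      linarith
    have := Real.exp_lt_exp.1 h1
    nlinarith
  set K := η / r ^ 2 with hK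
  have hK0 : 0 < K := by positivity
  set c : (Fin 4 → ℝ) × (Fin 4 → ℝ) → ℝ := fun z => v (z.1 + z.2) + v (z.1 - z.2) - 2 * v z.1
    + (-φ z.1 * normSqE z.2 + K * normSqE z.2 ^ 2) with hc
  set S : Set ((Fin 4 → ℝ) × (Fin 4 → ℝ)) := E ×ˢ {e | normSqE e ≤ r ^ 2} with hS
  have hSc : IsCompact S := by
    refine hEc.prod ((isCompact_closedBall (0 : Fin 4 → ℝ) r).of_isClosed_subset
      (isClosed_le continuous_normSqE continuous_const) fun e he => ?_)
    rw [mem_closedBall_zero_iff]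
    exact norm_le_of_normSqE_le hr0.le he
  have hSbd : ∀ z ∈ S, z.1 ∈ E ∧ normSqE z.2 ≤ r ^ 2 ∧ ‖z.2‖ ≤ r := fun z hz =>
    ⟨hz.1, hz.2, norm_le_of_normSqE_le hr0.le hz.2⟩
  have hccont : ContinuousOn c S := by
    intro z hz
    obtain ⟨h1, h2, h3⟩ := hSbd z hz
    obtain ⟨h4, h5, -⟩ := hpair z.1 h1 z.2 (h3.trans hrr₀)
    have c1 : ContinuousAt (fun z : (Fin 4 → ℝ) × (Fin 4 → ℝ) => v (z.1 + z.2)) z :=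
      ContinuousAt.comp (f := fun z : (Fin 4 → ℝ) × (Fin 4 → ℝ) => z.1 + z.2)
        (hv2 _ h4).continuousAt (by fun_prop)
    have c2 : ContinuousAt (fun z : (Fin 4 → ℝ) × (Fin 4 → ℝ) => v (z.1 - z.2)) z :=
      ContinuousAt.comp (f := fun z : (Fin 4 → ℝ) × (Fin 4 → ℝ) => z.1 - z.2)
        (hv2 _ h5).continuousAt (by fun_prop)
    have c3 : ContinuousAt (fun z : (Fin 4 → ℝ) × (Fin 4 → ℝ) => v z.1) z :=
      ContinuousAt.comp (hv2 _ h1.1).continuousAt continuousAt_fst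
    have c4 : ContinuousAt (fun z : (Fin 4 → ℝ) × (Fin 4 → ℝ) => φ z.1) z :=
      ContinuousAt.comp (g := φ) (continuousAt_const.mul (((continuousAt_const.mul
        (hθ2 _ h1.1).continuousAt).rexp).sub continuousAt_const)) continuousAt_fst
    have c5 : ContinuousAt (fun z : (Fin 4 → ℝ) × (Fin 4 → ℝ) => normSqE z.2) z :=
      continuous_normSqE.continuousAt.comp continuousAt_snd
    exact (((c1.add c2).sub (c3.const_mul 2)).add
      ((c4.neg.mul c5).add ((c5.pow 2).const_mul K))).continuousWithinAt
  have hSnhds : ∀ z : (Fin 4 → ℝ) × (Fin 4 → ℝ), z.1 ∈ Ω → θ z.1 < t → normSqE z.2 < r ^ 2 →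
      S ∈ nhds z := by
    intro z h1 h2 h3
    rw [hS]
    refine prod_mem_nhds ?_ ?_
    · filter_upwards [hopen.mem_nhds h1,
        ((hθ2 _ h1).continuousAt.tendsto).eventually (gt_mem_nhds h2)] with y hy hy'
      exact ⟨hy, hy'.le⟩
    · filter_upwards [(continuous_normSqE.tendsto z.2).eventually (gt_mem_nhds h3)] with y hy
      exact hy.le
  have hq0 : normSqE (0 : Fin 4 → ℝ) = 0 := by simp [normSqE]
  have hcz : ∀ m, c (m, 0) = 0 := by
    intro m
    simp only [hc, add_zero, sub_zero, hq0]
    ring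
  have hx₀S : S ∈ nhds (x₀, (0 : Fin 4 → ℝ)) :=
    hSnhds (x₀, 0) hx₀ (by simp only [ht]; linarith) (by simp only [hq0]; positivity)
  obtain ⟨⟨m, e⟩, hme, hmin₀⟩ := hSc.exists_isMinOn ⟨_, mem_of_mem_nhds hx₀S⟩ hccont
  have hc0 : 0 ≤ c (m, e) := by
    by_contra! hlt
    obtain ⟨hmE, her, hen⟩ : m ∈ E ∧ normSqE e ≤ r ^ 2 ∧ ‖e‖ ≤ r := hSbd _ hme
    obtain ⟨hxΩ, hyΩ, hshift, hdet⟩ := hpair m hmE e (hen.trans hrr₀)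
    have he0 : e ≠ 0 := by
      rintro rfl
      exact absurd (hcz m) hlt.ne
    have he := normSqE_pos he0
    have hcdef : c (m, e) = v (m + e) + v (m - e) - 2 * v m
      + (-φ m * normSqE e + K * normSqE e ^ 2) := rfl
    have hKφ : K * normSqE e < φ m := by
      have := hmid m e hxΩ hyΩ
      nlinarith
    have hφm := hφη m hmE.1
    have hφ0 : 0 < φ m := lt_trans (by positivity) hKφ
    have hqr : normSqE e < r ^ 2 := by
      have h1 := hKφ.trans hφm
      rw [hK, div_mul_eq_mul_div, div_lt_iff₀ (by positivity)] at h1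
      exact lt_of_mul_lt_mul_left h1 hη0.le
    have hfar : ρ ≤ ‖m - x₁‖ := by
      by_contra! h
      have h1 := hnear m e h (hen.trans hrρ)
      have h2 : 0 ≤ K * normSqE e ^ 2 := by positivity
      have h3 : φ m * normSqE e ≤ 1 * normSqE e :=
        mul_le_mul_of_nonneg_right (by linarith) he.le
      linarith
    have hτ : ρ ^ 2 ≤ normSqE (gradVec θ m) :=
      (pow_le_pow_left₀ hρ.le hfar 2).trans ((norm_sq_le_normSqE _).trans
        (normSqE_sub_le_normSqE_gradVec hconv hv2 hhess hx₁ hmin hmE.1))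
    obtain ⟨hb1, hb2, hb3⟩ := hb m hmE
    have hκη : ε * Real.exp (-a * θ m) * normSqE e ≤ η := by
      have h1 := hεη m hmE.1
      have h2 : normSqE e ≤ 1 := hqr.le.trans (pow_le_one₀ hr0.le hr1)
      exact (mul_le_mul h1 h2 he.le hη0.le).trans_eq (mul_one _)
    refine not_isLocalMin_second_difference (K := K) (b := b) hΛ (hv m hmE.1) (hv _ hxΩ) (hv _ hyΩ)
      (hθ2 m hmE.1) (fun w => hessForm_sub_clm L (hv2 m hmE.1) w) hb3 hb2 hμ0
      (by linarith [abs_nonneg Q])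
      (show normSqE (gradVec θ m) ≤ P by
        have := (le_abs_self _).trans (hQ m hmE)
        linarith [le_abs_self Q])
      hτ hC hshift hdet ha.le (by linarith) hε0 hb0.le he hK0.le hKφ.le
      (show φ m ≤ 1 by linarith) (hκη.trans hη1)
      ((mul_le_mul_of_nonneg_right hκη hD0.le).trans hη2) ?_
    filter_upwards [hSnhds (m, e) hmE.1 (hφpos m hφ0) hqr] with z hz
    exact hmin₀ hz
  have hloc : IsLocalMin c (x₀, 0) := by
    filter_upwards [hx₀S] with z hz
    rw [hcz]
    exact hc0.trans (hmin₀ hz)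
  have hφ2 : ContDiffAt ℝ 2 φ x₀ :=
    contDiffAt_const.mul (((contDiffAt_const.mul (hθ2 x₀ hx₀)).exp).sub contDiffAt_const)
  have h := (second_difference_derivative_test (v := v) (φ := φ) (m := x₀) (e := 0) (K := K)
    (by simpa using hv2 x₀ hx₀) (by simpa using hv2 x₀ hx₀) (hv2 x₀ hx₀) hφ2 hloc 0 w).2
  have hd0 : dotE 0 w = 0 := by simp [dotE]
  have hh0 : hessForm v x₀ (-w) = hessForm v x₀ w := by simp [hessForm]
  have hz1 : hessForm φ x₀ 0 = 0 := by simp [hessForm]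
  have hz2 : hessForm v x₀ 0 = 0 := by simp [hessForm]
  rw [hq0, hd0, add_zero, sub_zero, zero_add, zero_sub, hh0, hz1, hz2] at h
  have hφx : 0 < φ x₀ := by
    have h1 : b < Real.exp (-a * θ x₀) := Real.exp_lt_exp.2 (by nlinarith)
    exact mul_pos hε0 (by linarith)
  have := mul_pos hφx (normSqE_pos hw)
  linarith

lemma IsEigenfunction.two_mul_negLog_le {Ω : Set (Fin 4 → ℝ)} {u : (Fin 4 → ℝ) → ℝ} {Λ : ℝ}
    (hu : IsEigenfunction Ω u Λ) (hconv : Convex ℝ Ω)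
    (hmul : ∀ x ∈ Ω, ∀ y ∈ Ω, u x * u y ≤ u ((1 / 2 : ℝ) • (x + y)) ^ 2) {m e : Fin 4 → ℝ}
    (hx : m + e ∈ Ω) (hy : m - e ∈ Ω) :
    2 * -Real.log (-(u m) / 4) ≤ -Real.log (-(u (m + e)) / 4) + -Real.log (-(u (m - e)) / 4) := by
  have hm : (1 / 2 : ℝ) • ((m + e) + (m - e)) = m := by module
  have h := hmul _ hx _ hy
  have hmΩ := hconv.half_smul_add_mem hx hy
  rw [hm] at h hmΩ
  have h0 := hu.neg _ hmΩ
  have h1 := hu.neg _ hx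
  have h2 := hu.neg _ hy
  have hlog : Real.log (-(u (m + e)) / 4 * (-(u (m - e)) / 4)) ≤ Real.log ((-(u m) / 4) ^ 2) :=
    Real.log_le_log (mul_pos (by linarith) (by linarith)) (by linarith)
  rw [Real.log_mul (by linarith) (by linarith), Real.log_pow] at hlog
  push_cast at hlog
  linarith

/-- the eigenfunction of the complex Monge–Ampère operator on a
bounded, smooth, strictly convex domain `Ω ⊂ ℂ² ≅ ℝ⁴` is log-concave: if `u` solves
`det(u_{i j̄}) = λ(−u)²` in `Ω`, `u < 0` in `Ω`, `u = 0` on `∂Ω`, then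
`v = −log(−u/4)` has positive definite real Hessian at every point of `Ω`. -/
theorem log_concavity_of_cplx_MA_eigenfunction
    (Ω : Set (Fin 4 → ℝ)) (hopen : IsOpen Ω) (hbd : Bornology.IsBounded Ω)
    (hconv : StrictConvex ℝ Ω)
    -- smooth boundary: a smooth global defining function with nonvanishing gradient
    (ρ : (Fin 4 → ℝ) → ℝ) (hρ : ContDiff ℝ (⊤ : ℕ∞) ρ) (hΩρ : Ω = {x | ρ x < 0})
    (hρgrad : ∀ x ∈ frontier Ω, fderiv ℝ ρ x ≠ 0)
    (lam : ℝ) (hlam : 0 < lam)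
    (u : (Fin 4 → ℝ) → ℝ)
    (hcont : ContinuousOn u (closure Ω))
    (hsmooth : ContDiffOn ℝ (⊤ : ℕ∞) u Ω)
    -- `u ∈ C^{1,1}(closure Ω)`
    (hC1 : ContDiffOn ℝ 1 u (closure Ω))
    (hC11 : ∃ K : NNReal,
      LipschitzOnWith K (fun x => fderivWithin ℝ u (closure Ω) x) (closure Ω))
    -- plurisubharmonicity: the complex Hessian is positive semidefinite on `Ω`
    (hpsh : ∀ x ∈ Ω, (cHess u x).PosSemidef)
    -- the complex Monge–Ampère eigenvalue equation
    (heq : ∀ x ∈ Ω, (cHess u x).det = ((lam * (-(u x))^2 : ℝ) : ℂ))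
    (hneg : ∀ x ∈ Ω, u x < 0)
    (hbdry : ∀ x ∈ frontier Ω, u x = 0) :
    ∀ x ∈ Ω, (hessM (fun y => -Real.log (-(u y)/4)) x).PosDef := by
  intro x hx
  have hsm : ∀ y ∈ Ω, ContDiffAt ℝ (⊤ : ℕ∞) u y := fun y hy =>
    hsmooth.contDiffAt (hopen.mem_nhds hy)
  have h16 : 0 < 16 * lam := by positivity
  have hlevi : ∀ y ∈ Ω, 0 ≤ levi u y 0 ∧ 0 ≤ levi u y 1 ∧
      hermDet (levi u y) = 16 * (lam * (-(u y)) ^ 2) := fun y hy =>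
    levi_of_cHess ((hsm y hy).of_le (WithTop.coe_le_coe.2 le_top)) (hpsh y hy) (heq y hy)
  have hu : IsEigenfunction Ω u (16 * lam) :=
    { contDiffAt := fun y hy => (hsm y hy).of_le (WithTop.coe_le_coe.2 le_top)
      neg := hneg
      levi_zero := fun y hy => (hlevi y hy).1
      levi_one := fun y hy => (hlevi y hy).2.1
      det_eq := fun y hy => by rw [(hlevi y hy).2.2]; ring
      continuousOn := hcont
      boundary := hbdry }
  obtain ⟨K, hK⟩ := hC11
  obtain ⟨x₁, hx₁, L, hmin⟩ := hu.exists_quadratic_min hopen hbd ⟨x, hx⟩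
  have hmul : ∀ y ∈ Ω, ∀ z ∈ Ω, u y * u z ≤ u ((1 / 2 : ℝ) • (y + z)) ^ 2 := fun y hy z hz =>
    hu.mul_le_sq_midpoint hopen hbd hconv.convex (hρ.of_le (WithTop.coe_le_coe.2 le_top)) hΩρ hρgrad
      h16 hK.continuousOn hy hz
  refine hessM_posDef_of_hessForm (hu.isLogSolAt h16 hx).contDiffAt_two fun w hw => ?_
  exact hessForm_pos_of_convex h16 hopen hconv.convex (fun y hy => hu.isLogSolAt h16 hy)
    (fun m e => hu.two_mul_negLog_le hconv.convex hmul) hx₁ hmin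
    (hu.isCompact_sublevel hopen hbd L) hx hw
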